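/- Let d ≥ 3. There exists a constant C > 0, depending only on d and S, such that for every Borel set A = A_∞ × ∏_{p ∈ S_f} A_p ⊆ ℚ_S^d (each factor Borel in the corresponding ℚ_p^d or ℝ^d) with 0 < vol_S(A) < ∞, and every admissible measure μ on G_d/Γ_d: ∫_{G_d/Γ_d} ( N_A(gΓ_d) − vol_S(A)/ζ_S(d) )² dμ ≤ C·vol_S(A), where N_A(gΓ_d) = #( g·P(ℤ_S^d) ∩ A ). -/

import Mathlib

open MeasureTheory Matrix ENNReal

noncomputable section

noncomputable instance Padic.instMeasurableSpace' {p : ℕ} [Fact p.Prime] :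
    MeasurableSpace ℚ_[p] := borel _

instance Padic.instBorelSpace' {p : ℕ} [Fact p.Prime] : BorelSpace ℚ_[p] := ⟨rfl⟩

instance Matrix.SpecialLinearGroup.instTopologicalSpace'
    {n : Type*} [DecidableEq n] [Fintype n] {R : Type*} [CommRing R] [TopologicalSpace R] :
    TopologicalSpace (SpecialLinearGroup n R) :=
  show TopologicalSpace {A : Matrix n n R // A.det = 1} from inferInstance

noncomputable instance Matrix.SpecialLinearGroup.instMeasurableSpace'
    {n : Type*} [DecidableEq n] [Fintype n] {R : Type*} [CommRing R] [TopologicalSpace R] :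
    MeasurableSpace (SpecialLinearGroup n R) := borel _

/-- A finite set of distinct primes `p 0, …, p (s-1)`. -/
structure PrimeTup where
  s : ℕ
  p : Fin s → ℕ
  hp : ∀ i, (p i).Prime
  inj : Function.Injective p

namespace PrimeTup

instance (S : PrimeTup) (i : Fin S.s) : Fact (S.p i).Prime := ⟨S.hp i⟩

/-- The `p i`-adic field. -/
abbrev Qp (S : PrimeTup) (i : Fin S.s) : Type := ℚ_[S.p i]

/-- The space `ℚ_S^d = ℝ^d × ∏ᵢ ℚ_{pᵢ}^d`. -/
abbrev QS (S : PrimeTup) (d : ℕ) : Type :=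
  (Fin d → ℝ) × ((i : Fin S.s) → Fin d → S.Qp i)

/-- The ring `ℤ_S = ℤ[1/p₁, …, 1/p_s] ⊆ ℚ`. -/
def Zs (S : PrimeTup) : Subring ℚ :=
  Subring.closure (Set.range fun i : Fin S.s => ((S.p i : ℚ))⁻¹)

/-- The group `G_d = SL_d(ℝ) × ∏ᵢ SL_d(ℚ_{pᵢ})`. -/
abbrev G (S : PrimeTup) (d : ℕ) : Type :=
  SpecialLinearGroup (Fin d) ℝ × ((i : Fin S.s) → SpecialLinearGroup (Fin d) (S.Qp i))

/-- Diagonal embedding of `SL_d(ℤ_S)` into `G_d`. -/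
def toG (S : PrimeTup) (d : ℕ) : SpecialLinearGroup (Fin d) S.Zs →* S.G d :=
  MonoidHom.prod
    (SpecialLinearGroup.map ((Rat.castHom ℝ).comp S.Zs.subtype))
    (Pi.monoidHom fun i => SpecialLinearGroup.map ((Rat.castHom (S.Qp i)).comp S.Zs.subtype))

/-- The lattice `Γ_d`, the diagonally embedded copy of `SL_d(ℤ_S)` in `G_d`. -/
def Gamma (S : PrimeTup) (d : ℕ) : Subgroup (S.G d) := (S.toG d).range

/-- The componentwise linear action of `G_d` on `ℚ_S^d`. -/
def act (S : PrimeTup) {d : ℕ} (g : S.G d) (x : S.QS d) : S.QS d :=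
  ((g.1 : Matrix (Fin d) (Fin d) ℝ).mulVec x.1,
   fun i => ((g.2 i : Matrix (Fin d) (Fin d) (S.Qp i))).mulVec (x.2 i))

/-- Diagonal embedding of rational vectors into `ℚ_S^d`. -/
def diag (S : PrimeTup) {d : ℕ} (v : Fin d → ℚ) : S.QS d :=
  (fun j => (v j : ℝ), fun i j => (v j : S.Qp i))

/-- The first standard basis vector of `ℤ_S^d`. -/
def e1 (S : PrimeTup) (d : ℕ) : Fin d → S.Zs := fun j => if j.1 = 0 then 1 else 0

/-- The set of `S`-primitive vectors `P(ℤ_S^d) = SL_d(ℤ_S)·e₁` inside `(ℤ_S)^d`. -/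
def primZs (S : PrimeTup) (d : ℕ) : Set (Fin d → S.Zs) :=
  {w | ∃ γ : SpecialLinearGroup (Fin d) S.Zs,
    w = (γ : Matrix (Fin d) (Fin d) S.Zs).mulVec (S.e1 d)}

/-- The set of `S`-primitive vectors regarded inside `ℚ_S^d` via the diagonal embedding. -/
def prim (S : PrimeTup) (d : ℕ) : Set (S.QS d) :=
  (fun w : Fin d → S.Zs => S.diag fun j => ((w j : ℚ))) '' S.primZs d

/-- Multiplication of a vector of `ℚ_S^d` by a (diagonally embedded) rational scalar. -/
def ratSMul (S : PrimeTup) {d : ℕ} (q : ℚ) (x : S.QS d) : S.QS d :=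
  (fun j => (q : ℝ) * x.1 j, fun i j => (q : S.Qp i) * x.2 i j)

/-- `ℕ_S`: positive integers coprime to all the primes of `S`. -/
def NS (S : PrimeTup) : Set ℕ := {m | 0 < m ∧ ∀ i, ¬ (S.p i ∣ m)}

/-- The `S`-arithmetic zeta value `ζ_S(d)`. -/
def zetaS (S : PrimeTup) (d : ℕ) : ℝ := ∑' m : S.NS, (1 : ℝ) / ((m : ℕ) : ℝ) ^ d

/-- The "unit box" `[0,1]^d × ∏ᵢ ℤ_{pᵢ}^d` used to normalize the volume on `ℚ_S^d`. -/
def unitBox (S : PrimeTup) (d : ℕ) : Set (S.QS d) :=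
  {x | (∀ j, x.1 j ∈ Set.Icc (0:ℝ) 1) ∧ ∀ i j, ‖x.2 i j‖ ≤ 1}

/-- `v` is the measure `vol_S` on `ℚ_S^d`: the (unique) translation-invariant regular Borel
measure giving the unit box `[0,1]^d × ∏ᵢ ℤ_{pᵢ}^d` measure one; equivalently, the product of
Lebesgue measure on `ℝ^d` and the normalized Haar measures on the `ℚ_{pᵢ}^d`. -/
def IsVolS (S : PrimeTup) (d : ℕ) (v : Measure (S.QS d)) : Prop :=
  v.IsAddHaarMeasure ∧ v.Regular ∧ v (S.unitBox d) = 1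

/-- `μ` is an admissible measure on `G_d/Γ_d`: a regular Borel probability measure invariant
under the left `G_d`-action. -/
def Admissible (S : PrimeTup) (d : ℕ) (μ : Measure (S.G d ⧸ S.Gamma d)) : Prop :=
  IsProbabilityMeasure μ ∧ μ.Regular ∧ SMulInvariantMeasure (S.G d) (S.G d ⧸ S.Gamma d) μ

end PrimeTup

end

namespace PrimeTup

/-- The product of the primes of `S`. -/
def primeProd (S : PrimeTup) : ℕ := ∏ i, S.p i

theorem primeProd_pos (S : PrimeTup) : 0 < S.primeProd :=
  Finset.prod_pos fun i _ => (S.hp i).pos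

theorem inv_prime_mem_Zs (S : PrimeTup) (i : Fin S.s) : ((S.p i : ℚ))⁻¹ ∈ S.Zs :=
  Subring.subset_closure ⟨i, rfl⟩

theorem inv_primeProd_mem_Zs (S : PrimeTup) : ((S.primeProd : ℚ))⁻¹ ∈ S.Zs := by
  rw [primeProd, Nat.cast_prod, ← Finset.prod_inv_distrib]
  exact Subring.prod_mem _ fun i _ => S.inv_prime_mem_Zs i

theorem exists_primeProd_pow_mul_eq_int (S : PrimeTup) {q : ℚ} (hq : q ∈ S.Zs) :
    ∃ (N : ℕ) (m : ℤ), (S.primeProd : ℚ) ^ N * q = m := by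
  have hQ : (S.primeProd : ℚ) ≠ 0 := by exact_mod_cast S.primeProd_pos.ne'
  induction hq using Subring.closure_induction with
  | mem x hx =>
    obtain ⟨i, rfl⟩ := hx
    refine ⟨1, ∏ j ∈ Finset.univ.erase i, (S.p j : ℤ), ?_⟩
    have : (S.p i : ℚ) ≠ 0 := by exact_mod_cast (S.hp i).ne_zero
    rw [pow_one, primeProd, ← Finset.mul_prod_erase _ _ (Finset.mem_univ i)]
    push_cast
    field_simp
  | zero => exact ⟨0, 0, by simp⟩
  | one => exact ⟨0, 1, by simp⟩
  | add x y _ _ hx hy =>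
    obtain ⟨N, m, h⟩ := hx
    obtain ⟨N', m', h'⟩ := hy
    refine ⟨N + N', S.primeProd ^ N' * m + S.primeProd ^ N * m', ?_⟩
    push_cast
    rw [← h, ← h']; ring
  | neg x _ hx =>
    obtain ⟨N, m, h⟩ := hx
    exact ⟨N, -m, by push_cast; rw [← h]; ring⟩
  | mul x y _ _ hx hy =>
    obtain ⟨N, m, h⟩ := hx
    obtain ⟨N', m', h'⟩ := hy
    exact ⟨N + N', m * m', by push_cast; rw [← h, ← h']; ring⟩

theorem eq_prime_of_dvd_den (S : PrimeTup) {q : ℚ} (hq : q ∈ S.Zs) {l : ℕ} (hl : l.Prime)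
    (h : l ∣ q.den) : ∃ i, l = S.p i := by
  obtain ⟨N, m, hm⟩ := S.exists_primeProd_pow_mul_eq_int hq
  have h1 : q.den ∣ S.primeProd ^ N := by
    have hq' : q = Rat.divInt m ((S.primeProd ^ N : ℕ) : ℤ) := by
      rw [Rat.divInt_eq_div, ← hm]
      have hQ : (S.primeProd : ℚ) ≠ 0 := by exact_mod_cast S.primeProd_pos.ne'
      push_cast
      field_simp
    have := Rat.den_dvd m ((S.primeProd ^ N : ℕ) : ℤ)
    rw [← hq'] at this
    exact_mod_cast this
  have h2 : l ∣ S.primeProd := hl.dvd_of_dvd_pow (h.trans h1)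
  obtain ⟨i, _, hi⟩ := (hl.prime.dvd_finsetProd_iff _).1 h2
  exact ⟨i, (Nat.prime_dvd_prime_iff_eq hl (S.hp i)).1 hi⟩

theorem exists_int_eq_of_norm_le_one (S : PrimeTup) {q : ℚ} (hq : q ∈ S.Zs)
    (h : ∀ i, ‖(q : S.Qp i)‖ ≤ 1) : ∃ m : ℤ, q = m := by
  refine ⟨q.num, ?_⟩
  have hden : q.den = 1 := by
    by_contra hne
    obtain ⟨l, hl, hld⟩ := Nat.exists_prime_and_dvd hne
    obtain ⟨i, rfl⟩ := S.eq_prime_of_dvd_den hq hl hld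
    have h1 := h i
    have h2 : ‖((q.num : ℤ) : S.Qp i)‖ < 1 := by
      have h3 : ((q.num : ℤ) : S.Qp i) = q * (q.den : ℕ) := by
        have := congrArg (Rat.cast : ℚ → S.Qp i) (Rat.mul_den_eq_num q)
        push_cast at this
        exact this.symm
      rw [h3, norm_mul]
      exact (mul_le_of_le_one_left (norm_nonneg _) h1).trans_lt
        (Padic.norm_natCast_lt_one_iff.2 hld)
    rw [Padic.norm_intCast_lt_one_iff] at h2
    have h4 := Nat.dvd_gcd (Int.natCast_dvd.1 h2) hld
    rw [q.reduced.gcd_eq_one, Nat.dvd_one] at h4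
    exact (S.hp i).one_lt.ne' h4
  exact (Rat.den_eq_one_iff q).1 hden |>.symm

theorem norm_primeProd_padic (S : PrimeTup) (i : Fin S.s) :
    ‖(S.primeProd : S.Qp i)‖ = ((S.p i : ℝ))⁻¹ := by
  rw [primeProd, Nat.cast_prod, norm_prod, Finset.prod_eq_single i]
  · exact Padic.norm_p
  · intro j _ hj
    rw [Padic.norm_natCast_eq_one_iff]
    exact (Nat.coprime_primes (S.hp i) (S.hp j)).2 fun h => hj (S.inj h).symm
  · simp

theorem exists_int_near (S : PrimeTup) (k : ℕ) (x : ∀ i, ℤ_[S.p i]) :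
    ∃ m : ℕ, ∀ i, ‖x i - (m : ℤ_[S.p i])‖ ≤ (S.p i : ℝ) ^ (-(k : ℤ)) := by
  let a : Fin S.s → ℕ := fun i => (x i).appr k
  obtain ⟨m, hm⟩ := Nat.chineseRemainderOfFinset a (fun i => S.p i ^ k) Finset.univ
    (fun i _ => pow_ne_zero _ (S.hp i).ne_zero)
    (fun i _ j _ hij => Nat.Coprime.pow _ _ ((Nat.coprime_primes (S.hp i) (S.hp j)).2
      fun h => hij (S.inj h)))
  refine ⟨m, fun i => ?_⟩
  have h1 := PadicInt.appr_spec k (x i)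
  rw [PadicInt.norm_le_pow_iff_mem_span_pow]
  have h2 : ((a i : ℤ_[S.p i]) - m) ∈ (Ideal.span {(S.p i : ℤ_[S.p i]) ^ k}) := by
    rw [Ideal.mem_span_singleton]
    have := (hm i (Finset.mem_univ i)).dvd
    obtain ⟨c, hc⟩ := this
    refine ⟨(c : ℤ_[S.p i]), ?_⟩
    have h3 := congrArg (Int.cast : ℤ → ℤ_[S.p i]) hc
    push_cast at h3
    linear_combination h3
  have := Ideal.add_mem _ h1 h2
  simpa [a] using this

theorem exists_round (S : PrimeTup) (t : ℕ) (r : ℝ) (x : ∀ i, S.Qp i) :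
    ∃ z : S.Zs, (0 ≤ r - ((z : ℚ) : ℝ) ∧ r - ((z : ℚ) : ℝ) < (S.primeProd : ℝ) ^ t) ∧
      ∀ i, ‖x i - ((z : ℚ) : S.Qp i)‖ ≤ (S.p i : ℝ) ^ (-(t : ℤ)) := by
  have hQ : (S.primeProd : ℚ) ≠ 0 := by exact_mod_cast S.primeProd_pos.ne'
  have hQR : (0 : ℝ) < S.primeProd := by exact_mod_cast S.primeProd_pos
  obtain ⟨N, hN⟩ : ∃ N : ℕ, ∀ i, ‖(S.primeProd : S.Qp i) ^ N * x i‖ ≤ 1 := by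
    have : ∀ᶠ N : ℕ in Filter.atTop, ∀ i, ‖(S.primeProd : S.Qp i) ^ N * x i‖ ≤ 1 := by
      rw [Filter.eventually_all]
      intro i
      have h0 : Filter.Tendsto (fun N : ℕ => ‖(S.primeProd : S.Qp i) ^ N * x i‖) Filter.atTop
          (nhds 0) := by
        simp only [norm_mul, norm_pow, norm_primeProd_padic]
        have := (tendsto_pow_atTop_nhds_zero_of_lt_one (r := ((S.p i : ℝ))⁻¹) (by positivity)
          (inv_lt_one_of_one_lt₀ (by exact_mod_cast (S.hp i).one_lt))).mul_const ‖x i‖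
        simpa using this
      exact (h0.eventually_lt_const one_pos).mono fun _ h => h.le
    exact this.exists
  obtain ⟨y, hy⟩ : ∃ y : ∀ i, ℤ_[S.p i],
      ∀ i, (y i : S.Qp i) = (S.primeProd : S.Qp i) ^ N * x i :=
    ⟨fun i => ⟨_, hN i⟩, fun i => rfl⟩
  obtain ⟨m, hm⟩ := S.exists_int_near (N + t) y
  set z0 : ℚ := (S.primeProd : ℚ)⁻¹ ^ N * m with hz0
  set f : ℤ := ⌊(r - z0) / (S.primeProd : ℝ) ^ t⌋ with hf
  have hz : z0 + S.primeProd ^ t * f ∈ S.Zs :=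
    add_mem (mul_mem (pow_mem S.inv_primeProd_mem_Zs _) (natCast_mem _ _))
      (mul_mem (pow_mem (natCast_mem _ _) _) (intCast_mem _ _))
  refine ⟨⟨_, hz⟩, ⟨?_, ?_⟩, fun i => ?_⟩
  · have := Int.floor_le ((r - z0) / (S.primeProd : ℝ) ^ t)
    rw [← hf, le_div_iff₀ (by positivity)] at this
    push_cast
    linarith
  · have := Int.lt_floor_add_one ((r - z0) / (S.primeProd : ℝ) ^ t)
    rw [← hf, div_lt_iff₀ (by positivity)] at this
    push_cast
    linarith
  · have hQi : (S.primeProd : S.Qp i) ≠ 0 := by exact_mod_cast S.primeProd_pos.ne'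
    have hp : (0 : ℝ) < S.p i := by exact_mod_cast (S.hp i).pos
    have h1 := hm i
    rw [PadicInt.norm_def, PadicInt.coe_sub, PadicInt.coe_natCast, hy] at h1
    have h2 : x i - ((z0 + S.primeProd ^ t * f : ℚ) : S.Qp i) =
        (S.primeProd : S.Qp i)⁻¹ ^ N * ((S.primeProd : S.Qp i) ^ N * x i - m) +
        (- (S.primeProd : S.Qp i) ^ t * f) := by
      rw [hz0]; push_cast
      have h5 : (S.primeProd : S.Qp i)⁻¹ ^ N * (S.primeProd : S.Qp i) ^ N = 1 := by
        rw [← mul_pow, inv_mul_cancel₀ hQi, one_pow]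
      linear_combination (-x i) * h5
    rw [h2]
    refine (Padic.nonarchimedean _ _).trans (max_le ?_ ?_)
    · rw [norm_mul, norm_pow, norm_inv, norm_primeProd_padic, inv_inv]
      calc (S.p i : ℝ) ^ N * _ ≤ (S.p i : ℝ) ^ N * (S.p i : ℝ) ^ (-((N + t : ℕ) : ℤ)) := by
            exact mul_le_mul_of_nonneg_left h1 (by positivity)
        _ = _ := by
            rw [← zpow_natCast, ← zpow_add₀ hp.ne']; congr 1; push_cast; ring
    · rw [norm_mul, norm_neg, norm_pow, norm_primeProd_padic, _root_.zpow_neg, zpow_natCast, inv_pow]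
      exact mul_le_of_le_one_right (by positivity) (Padic.norm_int_le_one f)

theorem round_unique (S : PrimeTup) (t : ℕ) (r : ℝ) (x : ∀ i, S.Qp i) {z w : S.Zs}
    (hz : (0 ≤ r - ((z : ℚ) : ℝ) ∧ r - ((z : ℚ) : ℝ) < (S.primeProd : ℝ) ^ t) ∧
      ∀ i, ‖x i - ((z : ℚ) : S.Qp i)‖ ≤ (S.p i : ℝ) ^ (-(t : ℤ)))
    (hw : (0 ≤ r - ((w : ℚ) : ℝ) ∧ r - ((w : ℚ) : ℝ) < (S.primeProd : ℝ) ^ t) ∧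
      ∀ i, ‖x i - ((w : ℚ) : S.Qp i)‖ ≤ (S.p i : ℝ) ^ (-(t : ℤ))) : z = w := by
  have hQ : (S.primeProd : ℚ) ≠ 0 := by exact_mod_cast S.primeProd_pos.ne'
  have hQR : (0 : ℝ) < S.primeProd := by exact_mod_cast S.primeProd_pos
  obtain ⟨m, hm⟩ := S.exists_int_eq_of_norm_le_one
    (q := (S.primeProd : ℚ)⁻¹ ^ t * ((z : ℚ) - w))
    (mul_mem (pow_mem S.inv_primeProd_mem_Zs _) (sub_mem z.2 w.2)) (by
      intro i
      have hp : (0 : ℝ) < S.p i := by exact_mod_cast (S.hp i).pos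
      push_cast
      rw [norm_mul, norm_pow, norm_inv, norm_primeProd_padic, inv_inv]
      have h2 : (((z : ℚ) : S.Qp i) - ((w : ℚ) : S.Qp i)) =
        (x i - ((w : ℚ) : S.Qp i)) + -(x i - ((z : ℚ) : S.Qp i)) := by ring
      have h3 : ‖((z : ℚ) : S.Qp i) - ((w : ℚ) : S.Qp i)‖ ≤ (S.p i : ℝ) ^ (-(t : ℤ)) := by
        rw [h2]
        refine (Padic.nonarchimedean _ _).trans (max_le (hw.2 i) ?_)
        rw [norm_neg]; exact hz.2 i
      rw [_root_.zpow_neg, zpow_natCast] at h3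
      calc _ ≤ (S.p i : ℝ) ^ t * ((S.p i : ℝ) ^ t)⁻¹ := by gcongr
        _ = 1 := mul_inv_cancel₀ (by positivity))
  have h1 : ((z : ℚ) : ℝ) - ((w : ℚ) : ℝ) = (S.primeProd : ℝ) ^ t * m := by
    have h2 : ((z : ℚ)) - (w : ℚ) = (S.primeProd : ℚ) ^ t * m := by
      rw [← hm, ← mul_assoc, ← mul_pow, mul_inv_cancel₀ hQ, one_pow, one_mul]
    exact_mod_cast congrArg (Rat.cast : ℚ → ℝ) h2
  have hm0 : m = 0 := by
    have hpos : (0 : ℝ) < (S.primeProd : ℝ) ^ t := by positivity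
    have h3 : (m : ℝ) < 1 := by
      have : (S.primeProd : ℝ) ^ t * m < (S.primeProd : ℝ) ^ t * 1 := by linarith [hz.1.1, hw.1.2]
      exact lt_of_mul_lt_mul_left this hpos.le
    have h4 : (-1 : ℝ) < (m : ℝ) := by
      have : (S.primeProd : ℝ) ^ t * (-1) < (S.primeProd : ℝ) ^ t * m := by
        linarith [hz.1.2, hw.1.1]
      exact lt_of_mul_lt_mul_left this hpos.le
    have h3' : m < 1 := by exact_mod_cast h3
    have h4' : -1 < m := by exact_mod_cast h4
    omega
  rw [hm0, Int.cast_zero, mul_zero, sub_eq_zero] at h1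
  exact Subtype.ext (by exact_mod_cast h1)

end PrimeTup

section PadicVolume

open scoped Pointwise

variable {p : ℕ} [hp : Fact p.Prime]

/-- The closed unit ball of `ℚ_[p]` as a compact set with nonempty interior. -/
def Padic.unitBallCompacts (p : ℕ) [Fact p.Prime] : TopologicalSpace.PositiveCompacts ℚ_[p] where
  carrier := Metric.closedBall 0 1
  isCompact' := isCompact_closedBall 0 1
  interior_nonempty' :=
    ⟨0, Metric.ball_subset_interior_closedBall (Metric.mem_ball_self one_pos)⟩

/-- The Haar measure on `ℚ_[p]` giving `ℤ_[p]` measure one. -/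
@[reducible] noncomputable def Padic.measureSpace (p : ℕ) [Fact p.Prime] : MeasureSpace ℚ_[p] where
  toMeasurableSpace := Padic.instMeasurableSpace'
  volume := Measure.addHaarMeasure (Padic.unitBallCompacts p)

attribute [local instance] Padic.measureSpace

theorem Padic.isAddHaarMeasure_volume : (volume : Measure ℚ_[p]).IsAddHaarMeasure :=
  inferInstanceAs (Measure.addHaarMeasure (Padic.unitBallCompacts p)).IsAddHaarMeasure

attribute [local instance] Padic.isAddHaarMeasure_volume

theorem Padic.volume_closedBall_one : volume (Metric.closedBall (0 : ℚ_[p]) 1) = 1 :=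
  Measure.addHaarMeasure_self (K₀ := Padic.unitBallCompacts p)

theorem Padic.distribHaarChar_eq_one_of_norm_eq_one {u : ℚ_[p]ˣ} (hu : ‖(u : ℚ_[p])‖ = 1) :
    distribHaarChar ℚ_[p] u = 1 := by
  refine distribHaarChar_eq_of_measure_smul_eq_mul (μ := (volume : Measure ℚ_[p]))
    (s := Metric.closedBall (0 : ℚ_[p]) 1) ?_ ?_ ?_
  · rw [volume_closedBall_one]; simp
  · rw [volume_closedBall_one]; simp
  · rw [ENNReal.coe_one, one_mul]
    congr 1
    ext x
    rw [Set.mem_smul_set_iff_inv_smul_mem]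
    simp [Units.smul_def, hu]

theorem Padic.norm_natCast_sub_lt_one {a b : ℕ} (ha : a < p) (hb : b < p)
    (h : ‖((a : ℚ_[p]) - b)‖ < 1) : a = b := by
  have h1 : ‖((a - b : ℤ) : ℚ_[p])‖ < 1 := by push_cast; exact h
  rw [Padic.norm_intCast_lt_one_iff] at h1
  obtain ⟨c, hc⟩ := h1
  have hc0 : c = 0 := by
    by_contra hc0
    have h2 : (p : ℤ) ≤ |(p : ℤ) * c| := by
      rw [abs_mul]
      have := Int.one_le_abs hc0
      have hp0 : (0 : ℤ) ≤ p := by positivity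
      rw [abs_of_nonneg hp0]
      nlinarith
    rw [← hc] at h2
    have h3 : |(a : ℤ) - b| < p := by rw [abs_lt]; omega
    omega
  rw [hc0] at hc
  omega

theorem Padic.distribHaarChar_prime {u : ℚ_[p]ˣ} (hu : (u : ℚ_[p]) = p) :
    distribHaarChar ℚ_[p] u = (p : NNReal)⁻¹ := by
  have hp0 : (p : ℚ_[p]) ≠ 0 := by exact_mod_cast hp.out.ne_zero
  have hmem : ∀ (j : ℕ) (x : ℚ_[p]),
      x ∈ ((j : ℚ_[p]) +ᵥ (u • Metric.closedBall (0 : ℚ_[p]) 1)) ↔ ‖x - j‖ < 1 := by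
    intro j x
    have hpos : (0 : ℝ) < p := by exact_mod_cast hp.out.pos
    have h1 := Padic.norm_le_pow_iff_norm_lt_pow_add_one (x - (j : ℚ_[p])) (-1)
    rw [neg_add_cancel, zpow_zero, _root_.zpow_neg_one] at h1
    rw [Set.mem_vadd_set_iff_neg_vadd_mem, Set.mem_smul_set_iff_inv_smul_mem, ← h1]
    simp only [Units.smul_def, mem_closedBall_zero_iff, smul_eq_mul, vadd_eq_add, norm_mul,
      Units.val_inv_eq_inv_val, hu, norm_inv, Padic.norm_p, inv_inv, neg_add_eq_sub]
    rw [← le_inv_mul_iff₀ hpos, mul_one]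
  have hcover : Metric.closedBall (0 : ℚ_[p]) 1 =
      ⋃ j ∈ Finset.range p, ((j : ℚ_[p]) +ᵥ (u • Metric.closedBall (0 : ℚ_[p]) 1)) := by
    ext x
    simp only [Set.mem_iUnion, hmem, Finset.mem_range, exists_prop, mem_closedBall_zero_iff]
    constructor
    · intro hx
      obtain ⟨y, rfl⟩ : ∃ y : ℤ_[p], (y : ℚ_[p]) = x := ⟨⟨x, hx⟩, rfl⟩
      obtain ⟨n, hn, hny⟩ := PadicInt.exists_mem_range y
      refine ⟨n, hn, ?_⟩
      have h2 : ‖y - n‖ < 1 := PadicInt.mem_nonunits.1 hny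
      rwa [PadicInt.norm_def, PadicInt.coe_sub, PadicInt.coe_natCast] at h2
    · rintro ⟨n, _, hn⟩
      have h2 : x = (x - n) + n := by ring
      rw [h2]
      exact (Padic.nonarchimedean _ _).trans (max_le hn.le (by simpa using Padic.norm_int_le_one (p := p) n))
  have hdisj : ((Finset.range p : Finset ℕ) : Set ℕ).PairwiseDisjoint
      fun j : ℕ => ((j : ℚ_[p]) +ᵥ (u • Metric.closedBall (0 : ℚ_[p]) 1)) := by
    intro i hi j hj hij
    rw [Function.onFun, Set.disjoint_left]
    intro x hxi hxj
    rw [hmem] at hxi hxj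
    refine hij (Padic.norm_natCast_sub_lt_one (p := p) (by simpa using hi) (by simpa using hj) ?_)
    have h2 : (i : ℚ_[p]) - j = (x - j) + -(x - i) := by ring
    rw [h2]
    refine (Padic.nonarchimedean _ _).trans_lt (max_lt hxj ?_)
    rwa [norm_neg]
  have hmeas : ∀ j ∈ Finset.range p,
      MeasurableSet ((j : ℚ_[p]) +ᵥ (u • Metric.closedBall (0 : ℚ_[p]) 1)) := fun j _ =>
    ((Metric.isClosed_closedBall.measurableSet).const_smul u).const_vadd _
  have h1 := congrArg (volume : Measure ℚ_[p]) hcover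
  rw [measure_biUnion_finset hdisj hmeas, volume_closedBall_one] at h1
  simp only [measure_vadd, ← distribHaarChar_mul (volume : Measure ℚ_[p]) u,
    volume_closedBall_one, mul_one, Finset.sum_const, Finset.card_range, nsmul_eq_mul] at h1
  have h2 : (1 : NNReal) = p * distribHaarChar ℚ_[p] u := by exact_mod_cast h1
  exact eq_inv_of_mul_eq_one_right h2.symm

theorem Padic.distribHaarChar_eq_norm (u : ℚ_[p]ˣ) :
    (distribHaarChar ℚ_[p] u : ℝ≥0∞) = ENNReal.ofReal ‖(u : ℚ_[p])‖ := by
  have hp0 : (p : ℚ_[p]) ≠ 0 := by exact_mod_cast hp.out.ne_zero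
  have hpR : (p : ℝ) ≠ 0 := by exact_mod_cast hp.out.ne_zero
  set P : ℚ_[p]ˣ := Units.mk0 (p : ℚ_[p]) hp0 with hP
  set n := (u : ℚ_[p]).valuation
  have hu : ‖(u : ℚ_[p])‖ = (p : ℝ) ^ (-n) := Padic.norm_eq_zpow_neg_valuation u.ne_zero
  have hv : distribHaarChar ℚ_[p] (u * P ^ (-n)) = 1 := by
    apply distribHaarChar_eq_one_of_norm_eq_one
    rw [Units.val_mul, norm_mul, hu, Units.val_zpow_eq_zpow_val, hP, Units.val_mk0, norm_zpow,
      Padic.norm_p, _root_.inv_zpow', neg_neg, ← zpow_add₀ hpR, neg_add_cancel, zpow_zero]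
  have h1 : u = (u * P ^ (-n)) * P ^ n := by group
  have h2 : distribHaarChar ℚ_[p] u = (p : NNReal) ^ (-n) := by
    rw [h1, map_mul, hv, one_mul, map_zpow, distribHaarChar_prime (u := P) rfl,
      _root_.inv_zpow']
  rw [h2, hu, ENNReal.ofReal, ENNReal.coe_inj]
  rw [Real.toNNReal_zpow (by positivity), Real.toNNReal_natCast]

theorem Padic.map_volume_mul_left {a : ℚ_[p]} (h : a ≠ 0) :
    Measure.map (a * ·) volume = ENNReal.ofReal ‖a⁻¹‖ • (volume : Measure ℚ_[p]) := by
  ext s hs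
  rw [Measure.map_apply (by fun_prop) hs, Measure.smul_apply, smul_eq_mul]
  have := distribHaarChar_mul (volume : Measure ℚ_[p]) (Units.mk0 a h)⁻¹ s
  rw [distribHaarChar_eq_norm] at this
  simp only [Units.val_inv_eq_inv_val, Units.val_mk0] at this
  rw [this]
  congr 1
  ext x
  rw [Set.mem_smul_set_iff_inv_smul_mem]
  simp [Units.smul_def]

theorem Padic.volume_closedBall_zpow (m : ℤ) :
    volume (Metric.closedBall (0 : ℚ_[p]) ((p : ℝ) ^ (-m))) = ENNReal.ofReal ((p : ℝ) ^ (-m)) := by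
  have hp0 : (p : ℚ_[p]) ≠ 0 := by exact_mod_cast hp.out.ne_zero
  have hpR : (0 : ℝ) < p := by exact_mod_cast hp.out.pos
  set u : ℚ_[p]ˣ := Units.mk0 (p : ℚ_[p]) hp0 ^ m with hu
  have hnu : ‖(u : ℚ_[p])‖ = (p : ℝ) ^ (-m) := by
    rw [hu, Units.val_zpow_eq_zpow_val, Units.val_mk0, norm_zpow, Padic.norm_p, _root_.inv_zpow']
  have h := distribHaarChar_mul (volume : Measure ℚ_[p]) u (Metric.closedBall 0 1)
  rw [volume_closedBall_one, mul_one, distribHaarChar_eq_norm, hnu] at h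
  rw [h]
  congr 1
  ext x
  rw [Set.mem_smul_set_iff_inv_smul_mem]
  have hpos : 0 < (p : ℝ) ^ (-m) := by positivity
  simp only [Units.smul_def, mem_closedBall_zero_iff, smul_eq_mul, norm_mul,
    Units.val_inv_eq_inv_val, norm_inv, hnu]
  rw [inv_mul_le_iff₀ hpos, mul_one]

variable {ι : Type*} [Fintype ι] [DecidableEq ι]

theorem Padic.smul_map_diagonal_volume_pi {D : ι → ℚ_[p]} (h : det (diagonal D) ≠ 0) :
    ENNReal.ofReal ‖det (diagonal D)‖ • Measure.map (toLin' (diagonal D)) volume =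
      (volume : Measure (ι → ℚ_[p])) := by
  refine (Measure.pi_eq fun s hs => ?_).symm
  simp only [det_diagonal, Measure.coe_smul, smul_eq_mul, Pi.smul_apply]
  have hD : ∀ i, D i ≠ 0 := by
    intro i
    simp only [det_diagonal, Ne] at h
    exact Finset.prod_ne_zero_iff.1 h i (Finset.mem_univ i)
  rw [Measure.map_apply _ (MeasurableSet.univ_pi hs)]
  swap; · exact Continuous.measurable (LinearMap.continuous_on_pi _)
  have : (Matrix.toLin' (diagonal D) ⁻¹' Set.pi Set.univ fun i : ι => s i) =
      Set.pi Set.univ fun i : ι => (D i * ·) ⁻¹' s i := by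
    ext f
    simp only [LinearMap.coe_proj, smul_eq_mul, LinearMap.smul_apply, Set.mem_univ_pi,
      Set.mem_preimage, LinearMap.pi_apply, diagonal_toLin']
  have B : ∀ i, ENNReal.ofReal ‖D i‖ * volume ((D i * ·) ⁻¹' s i) = volume (s i) := by
    intro i
    rw [← Measure.map_apply (by fun_prop) (hs i), Padic.map_volume_mul_left (hD i),
      Measure.smul_apply, smul_eq_mul, ← mul_assoc, ← ENNReal.ofReal_mul (norm_nonneg _),
      ← norm_mul, mul_inv_cancel₀ (hD i), norm_one, ENNReal.ofReal_one, one_mul]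
  rw [this, volume_pi_pi, norm_prod,
    ENNReal.ofReal_prod_of_nonneg fun i _ => norm_nonneg (D i), ← Finset.prod_mul_distrib]
  simp only [B]

theorem Padic.volume_preserving_transvectionStruct (t : TransvectionStruct ι ℚ_[p]) :
    MeasurePreserving (toLin' t.toMatrix) := by
  have ht : Measurable (toLin' t.toMatrix) :=
    (toLin' t.toMatrix).continuous_of_finiteDimensional.measurable
  refine ⟨ht, ?_⟩
  refine (Measure.pi_eq fun s hs ↦ ?_).symm
  have h2s : MeasurableSet (Set.univ.pi s) := .pi Set.countable_univ fun i _ ↦ hs i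
  simp_rw [← Measure.pi_pi, ← lintegral_indicator_one h2s]
  rw [lintegral_map (measurable_one.indicator h2s) ht, volume_pi]
  refine lintegral_eq_of_lmarginal_eq {t.i} ((measurable_one.indicator h2s).comp ht)
    (measurable_one.indicator h2s) ?_
  simp_rw [lmarginal_singleton]
  ext x
  cases t with | mk t_i t_j t_hij t_c =>
  simp [transvection, single_mulVec, t_hij.symm, ← Function.update_add,
    lintegral_add_right_eq_self fun xᵢ ↦
      Set.indicator (Set.univ.pi s) 1 (Function.update x t_i xᵢ)]

/-- An invertible matrix rescales the Haar measure of `ℚ_[p]^ι` through the norm of its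
determinant. -/
theorem Padic.map_matrix_volume_pi_eq_smul_volume_pi {M : Matrix ι ι ℚ_[p]} (hM : det M ≠ 0) :
    Measure.map (toLin' M) volume = ENNReal.ofReal ‖(det M)⁻¹‖ • (volume : Measure (ι → ℚ_[p])) := by
  apply diagonal_transvection_induction_of_det_ne_zero _ M hM
  · intro D hD
    conv_rhs => rw [← smul_map_diagonal_volume_pi hD]
    rw [smul_smul, ← ENNReal.ofReal_mul (norm_nonneg _), ← norm_mul, inv_mul_cancel₀ hD, norm_one,
      ENNReal.ofReal_one, one_smul]
  · intro t
    simp_rw [Matrix.TransvectionStruct.det, _root_.inv_one, norm_one, ENNReal.ofReal_one, one_smul,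
      (volume_preserving_transvectionStruct _).map_eq]
  · intro A B _ _ IHA IHB
    rw [toLin'_mul, det_mul, LinearMap.coe_comp, ← Measure.map_map, IHB, Measure.map_smul, IHA,
      smul_smul, ← ENNReal.ofReal_mul (norm_nonneg _), ← norm_mul, mul_comm, mul_inv]
    · apply Continuous.measurable
      apply LinearMap.continuous_on_pi
    · apply Continuous.measurable
      apply LinearMap.continuous_on_pi

end PadicVolume

namespace PrimeTup

attribute [local instance] Padic.measureSpace Padic.isAddHaarMeasure_volume

variable {S : PrimeTup} {n d : ℕ}

/-- Tuples of `n` vectors of `ℚ_S^d`, sorted by places. -/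
abbrev Tup (S : PrimeTup) (n d : ℕ) : Type :=
  (Fin n → Fin d → ℝ) × ((i : Fin S.s) → Fin n → Fin d → S.Qp i)

instance : SecondCountableTopology (S.Tup n d) :=
  inferInstanceAs (SecondCountableTopology
    ((Fin n → Fin d → ℝ) × ((i : Fin S.s) → Fin n → Fin d → S.Qp i)))

instance : BorelSpace (S.Tup n d) := Prod.borelSpace

theorem isAddHaarMeasure_volume_tup : (volume : Measure (S.Tup n d)).IsAddHaarMeasure := by
  have h0 : ∀ i, (volume : Measure (Fin d → S.Qp i)).IsAddHaarMeasure :=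
    fun i => Measure.pi.isAddHaarMeasure _
  have h1 : ∀ i, (volume : Measure (Fin n → Fin d → S.Qp i)).IsAddHaarMeasure :=
    fun i => Measure.pi.isAddHaarMeasure _
  have h2 : (volume : Measure ((i : Fin S.s) → Fin n → Fin d → S.Qp i)).IsAddHaarMeasure :=
    Measure.pi.isAddHaarMeasure _
  have h3 : (volume : Measure (Fin d → ℝ)).IsAddHaarMeasure := Measure.pi.isAddHaarMeasure _
  have h4 : (volume : Measure (Fin n → Fin d → ℝ)).IsAddHaarMeasure :=
    Measure.pi.isAddHaarMeasure _
  exact Measure.prod.instIsAddHaarMeasure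
    (volume : Measure (Fin n → Fin d → ℝ))
    (volume : Measure ((i : Fin S.s) → Fin n → Fin d → S.Qp i))

attribute [local instance] isAddHaarMeasure_volume_tup

/-- The entrywise action of `G_d` on tuples of vectors. -/
noncomputable def actTup (g : S.G d) (x : S.Tup n d) : S.Tup n d :=
  (fun a => (g.1 : Matrix (Fin d) (Fin d) ℝ).mulVec (x.1 a),
   fun i a => ((g.2 i : Matrix (Fin d) (Fin d) (S.Qp i))).mulVec (x.2 i a))

/-- The diagonal embedding on tuples of `S`-integral vectors. -/
noncomputable def diagTup (S : PrimeTup) (z : Fin n → Fin d → S.Zs) : S.Tup n d :=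
  (fun a j => ((z a j : ℚ) : ℝ), fun i a j => ((z a j : ℚ) : S.Qp i))

theorem actTup_mul (g h : S.G d) (x : S.Tup n d) :
    actTup (g * h) x = actTup g (actTup h x) := by
  simp [actTup]

theorem actTup_one (x : S.Tup n d) : actTup (1 : S.G d) x = x := by
  simp [actTup]

theorem actTup_sub (g : S.G d) (x y : S.Tup n d) :
    actTup g (x - y) = actTup g x - actTup g y := by
  ext <;> simp [actTup, mulVec_sub]

theorem continuous_actTup_uncurry :
    Continuous fun q : S.G d × S.Tup n d => actTup q.1 q.2 := by
  have h1 : Continuous fun A : SpecialLinearGroup (Fin d) ℝ => (A : Matrix (Fin d) (Fin d) ℝ) :=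
    continuous_subtype_val
  have h2 : ∀ i, Continuous fun A : SpecialLinearGroup (Fin d) (S.Qp i) =>
      (A : Matrix (Fin d) (Fin d) (S.Qp i)) := fun i => continuous_subtype_val
  refine Continuous.prodMk ?_ ?_
  · refine continuous_pi fun a => Continuous.matrix_mulVec ?_ ?_
    · exact h1.comp (by fun_prop)
    · fun_prop
  · refine continuous_pi fun i => continuous_pi fun a => Continuous.matrix_mulVec ?_ ?_
    · exact (h2 i).comp (by fun_prop)
    · fun_prop

theorem continuous_actTup (g : S.G d) : Continuous fun x : S.Tup n d => actTup g x :=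
  continuous_actTup_uncurry.comp (by fun_prop : Continuous fun x => (g, x))

theorem measurable_actTup_left (x : S.Tup n d) : Measurable fun g : S.G d => actTup g x := by
  refine Measurable.prodMk ?_ ?_
  · have h : Measurable fun A : SpecialLinearGroup (Fin d) ℝ => fun a => A.1.mulVec (x.1 a) := by
      have : BorelSpace (SpecialLinearGroup (Fin d) ℝ) := ⟨rfl⟩
      refine Continuous.measurable ?_
      exact continuous_pi fun a => Continuous.matrix_mulVec continuous_subtype_val continuous_const
    exact h.comp measurable_fst
  · refine measurable_pi_lambda _ fun i => ?_
    have h : Measurable fun A : SpecialLinearGroup (Fin d) (S.Qp i) =>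
        fun a => A.1.mulVec (x.2 i a) := by
      have : BorelSpace (SpecialLinearGroup (Fin d) (S.Qp i)) := ⟨rfl⟩
      refine Continuous.measurable ?_
      exact continuous_pi fun a => Continuous.matrix_mulVec continuous_subtype_val continuous_const
    exact h.comp ((measurable_pi_apply i).comp measurable_snd)

theorem measurePreserving_actTup (g : S.G d) :
    MeasurePreserving (actTup g : S.Tup n d → S.Tup n d) := by
  refine MeasurePreserving.prod
    (f := fun x a => (g.1 : Matrix (Fin d) (Fin d) ℝ).mulVec (x a))
    (g := fun x i a => ((g.2 i : Matrix (Fin d) (Fin d) (S.Qp i))).mulVec (x i a))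
    (μa := (volume : Measure (Fin n → Fin d → ℝ)))
    (μb := (volume : Measure (Fin n → Fin d → ℝ)))
    (μc := (volume : Measure ((i : Fin S.s) → Fin n → Fin d → S.Qp i)))
    (μd := (volume : Measure ((i : Fin S.s) → Fin n → Fin d → S.Qp i))) ?_ ?_
  · refine measurePreserving_pi _ _ fun a => ⟨by fun_prop, ?_⟩
    have hdet := g.1.2
    have := Real.map_matrix_volume_pi_eq_smul_volume_pi (M := g.1.1) (by rw [hdet]; simp)
    rw [hdet, inv_one, abs_one, ENNReal.ofReal_one, one_smul] at this
    exact this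
  · refine measurePreserving_pi (fun i => (volume : Measure (Fin n → Fin d → S.Qp i)))
      (fun i => (volume : Measure (Fin n → Fin d → S.Qp i)))
      (f := fun i x a => ((g.2 i : Matrix (Fin d) (Fin d) (S.Qp i))).mulVec (x a)) fun i => ?_
    refine measurePreserving_pi _ _ fun a => ⟨by fun_prop, ?_⟩
    have hdet := (g.2 i).2
    have := Padic.map_matrix_volume_pi_eq_smul_volume_pi (M := (g.2 i).1) (by rw [hdet]; simp)
    rw [hdet, inv_one, norm_one, ENNReal.ofReal_one, one_smul] at this
    exact this

/-- Multiplication of the real components by a scalar. -/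
def realScale (T : ℝ) (x : S.Tup n d) : S.Tup n d := (T • x.1, x.2)

theorem continuous_realScale (T : ℝ) : Continuous (realScale T : S.Tup n d → S.Tup n d) := by
  unfold realScale; fun_prop

theorem map_realScale_volume {T : ℝ} (hT : 0 < T) :
    Measure.map (realScale T : S.Tup n d → S.Tup n d) volume =
      ENNReal.ofReal ((T ^ (n * d))⁻¹) • volume := by
  have h1 : Measure.map (fun x : Fin n → Fin d → ℝ => T • x) volume =
      ENNReal.ofReal ((T ^ (n * d))⁻¹) • volume := by
    have := Measure.map_addHaar_smul (volume : Measure (Fin n → Fin d → ℝ)) hT.ne'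
    rw [this]
    congr 2
    rw [Module.finrank_pi_fintype]
    simp [abs_of_pos hT]
  have h2 : (realScale T : S.Tup n d → S.Tup n d) = Prod.map (fun x => T • x) id := rfl
  rw [h2]
  change Measure.map _ (Measure.prod volume volume) = _ • Measure.prod volume volume
  rw [← Measure.map_prod_map _ _ (by fun_prop) measurable_id, h1, Measure.map_id,
    Measure.prod_smul_left]

/-- A fundamental box for the translation action of the `S`-integral tuples. -/
def roundBox (S : PrimeTup) (n d t : ℕ) : Set (S.Tup n d) :=
  {x | (∀ a j, x.1 a j ∈ Set.Ico (0 : ℝ) ((S.primeProd : ℝ) ^ t)) ∧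
    ∀ i a j, ‖x.2 i a j‖ ≤ (S.p i : ℝ) ^ (-(t : ℤ))}

theorem roundBox_eq (t : ℕ) : S.roundBox n d t =
    (Set.univ.pi fun _ => Set.univ.pi fun _ => Set.Ico (0 : ℝ) ((S.primeProd : ℝ) ^ t)) ×ˢ
    (Set.univ.pi fun i => Set.univ.pi fun _ => Set.univ.pi fun _ =>
      Metric.closedBall (0 : S.Qp i) ((S.p i : ℝ) ^ (-(t : ℤ)))) := by
  ext x
  simp [roundBox]

theorem measurableSet_roundBox (t : ℕ) : MeasurableSet (S.roundBox n d t) := by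
  rw [roundBox_eq]
  refine MeasurableSet.prod ?_ ?_
  · exact .univ_pi fun _ => .univ_pi fun _ => measurableSet_Ico
  · exact .univ_pi fun i => .univ_pi fun _ => .univ_pi fun _ =>
      Metric.isClosed_closedBall.measurableSet

theorem volume_roundBox (t : ℕ) : volume (S.roundBox n d t) = 1 := by
  rw [roundBox_eq, Measure.volume_eq_prod, Measure.prod_prod]
  simp only [volume_pi_pi, Real.volume_Ico, Padic.volume_closedBall_zpow, Finset.prod_const,
    Finset.card_univ, Fintype.card_fin, sub_zero]
  rw [Finset.prod_pow, Finset.prod_pow, ← mul_pow, ← mul_pow,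
    ← ENNReal.ofReal_prod_of_nonneg (fun i _ => by positivity), ← ENNReal.ofReal_mul (by positivity)]
  have h1 : (S.primeProd : ℝ) ^ t * ∏ i, (S.p i : ℝ) ^ (-(t : ℤ)) = 1 := by
    rw [primeProd, Nat.cast_prod, ← Finset.prod_pow, ← Finset.prod_mul_distrib]
    refine Finset.prod_eq_one fun i _ => ?_
    have : (S.p i : ℝ) ≠ 0 := by exact_mod_cast (S.hp i).ne_zero
    rw [_root_.zpow_neg, zpow_natCast, mul_inv_cancel₀ (pow_ne_zero _ this)]
  rw [h1, ENNReal.ofReal_one, one_pow, one_pow]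

theorem exists_unique_round (t : ℕ) (x : S.Tup n d) :
    ∃! z : Fin n → Fin d → S.Zs, x - S.diagTup z ∈ S.roundBox n d t := by
  choose z hz using fun a j => S.exists_round t (x.1 a j) fun i => x.2 i a j
  refine ⟨z, ⟨fun a j => (hz a j).1, fun i a j => (hz a j).2 i⟩, fun w hw => ?_⟩
  ext1 a
  ext1 j
  exact S.round_unique t _ _ ⟨hw.1 a j, fun i => hw.2 i a j⟩ (hz a j)

/-- The `S`-integral tuple whose translate of the box contains a given tuple. -/
noncomputable def round (t : ℕ) (x : S.Tup n d) : Fin n → Fin d → S.Zs :=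
  (exists_unique_round t x).exists.choose

theorem sub_round_mem (t : ℕ) (x : S.Tup n d) : x - S.diagTup (round t x) ∈ S.roundBox n d t :=
  (exists_unique_round t x).exists.choose_spec

theorem round_eq_iff (t : ℕ) (x : S.Tup n d) (z : Fin n → Fin d → S.Zs) :
    round t x = z ↔ x - S.diagTup z ∈ S.roundBox n d t :=
  ⟨fun h => h ▸ sub_round_mem t x,
    fun h => (exists_unique_round t x).unique (sub_round_mem t x) h⟩

theorem preimage_round_singleton (t : ℕ) (z : Fin n → Fin d → S.Zs) :
    (round t : S.Tup n d → _) ⁻¹' {z} = (fun x => x - S.diagTup z) ⁻¹' S.roundBox n d t := by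
  ext x
  simp [round_eq_iff]

instance : Countable S.Zs := inferInstanceAs (Countable {x // x ∈ S.Zs})

/-- Sums over `S`-integral tuples as integrals of a rounded function. -/
theorem tsum_diagTup_eq_lintegral (t : ℕ) (f : S.Tup n d → ℝ≥0∞) :
    ∑' z, f (S.diagTup z) = ∫⁻ x, f (S.diagTup (round t x)) := by
  have hm : ∀ z, MeasurableSet ((round t : S.Tup n d → _) ⁻¹' {z}) := fun z => by
    rw [preimage_round_singleton]
    exact (measurableSet_roundBox t).preimage (by fun_prop)
  have hcover : ⋃ z, (round t : S.Tup n d → _) ⁻¹' {z} = Set.univ := by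
    ext x; simp
  rw [← setLIntegral_univ, ← hcover, lintegral_iUnion hm]
  · refine tsum_congr fun z => ?_
    rw [setLIntegral_congr_fun (g := fun _ => f (S.diagTup z)) (hm z)
      (fun x hx => by rw [Set.mem_preimage, Set.mem_singleton_iff] at hx; simp only [hx]),
      setLIntegral_const, preimage_round_singleton]
    simp only [sub_eq_add_neg]
    rw [measure_preimage_add_right, volume_roundBox, mul_one]
  · intro z w hzw
    exact Disjoint.preimage _ (by simpa using hzw)

theorem norm_le_of_mem_roundBox {t : ℕ} {x : S.Tup n d} (hx : x ∈ S.roundBox n d t) :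
    ‖x‖ ≤ max ((S.primeProd : ℝ) ^ t) 1 := by
  rw [Prod.norm_def]
  refine max_le_max ?_ ?_
  · refine (pi_norm_le_iff_of_nonneg (by positivity)).2 fun a =>
      (pi_norm_le_iff_of_nonneg (by positivity)).2 fun j => ?_
    rw [Real.norm_of_nonneg (hx.1 a j).1]
    exact (hx.1 a j).2.le
  · refine (pi_norm_le_iff_of_nonneg zero_le_one).2 fun i =>
      (pi_norm_le_iff_of_nonneg zero_le_one).2 fun a =>
      (pi_norm_le_iff_of_nonneg zero_le_one).2 fun j => (hx.2 i a j).trans ?_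
    exact zpow_le_one_of_nonpos₀ (by exact_mod_cast (S.hp i).one_lt.le) (by simp)

theorem finite_diagTup_mem_of_isBounded {B : Set (S.Tup n d)} (hB : Bornology.IsBounded B) :
    {z | S.diagTup z ∈ B}.Finite := by
  obtain ⟨R, hR⟩ := hB.exists_norm_le
  have h1 : ∑' z, B.indicator (fun _ => (1 : ℝ≥0∞)) (S.diagTup z) ≠ ∞ := by
    rw [tsum_diagTup_eq_lintegral 0]
    refine ne_of_lt ?_
    calc ∫⁻ x, B.indicator (fun _ => (1 : ℝ≥0∞)) (S.diagTup (round 0 x))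
        ≤ ∫⁻ x, (Metric.closedBall (0 : S.Tup n d) (R + 1)).indicator 1 x := by
          refine lintegral_mono fun x => ?_
          by_cases hx : S.diagTup (round 0 x) ∈ B
          · rw [Set.indicator_of_mem hx, Set.indicator_of_mem]
            · rfl
            rw [mem_closedBall_zero_iff]
            calc ‖x‖ = ‖S.diagTup (round 0 x) + (x - S.diagTup (round 0 x))‖ := by
                  rw [add_sub_cancel]
              _ ≤ _ := (norm_add_le _ _).trans (add_le_add (hR _ hx)
                  (by simpa using norm_le_of_mem_roundBox (sub_round_mem 0 x)))
          · rw [Set.indicator_of_notMem hx]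
            exact zero_le
      _ = volume (Metric.closedBall (0 : S.Tup n d) (R + 1)) :=
          lintegral_indicator_one Metric.isClosed_closedBall.measurableSet
      _ < ∞ := (isCompact_closedBall _ _).measure_lt_top
  refine (ENNReal.finite_const_le_of_tsum_ne_top h1 one_ne_zero).subset fun z hz => ?_
  have hz' : S.diagTup z ∈ B := hz
  simp [hz']

end PrimeTup

namespace PrimeTup

attribute [local instance] Padic.measureSpace Padic.isAddHaarMeasure_volume
  isAddHaarMeasure_volume_tup

variable {S : PrimeTup} {n d : ℕ}

/-- The coefficients of the linear form `x ↦ ∑ a, s a * x (e a)`. -/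
noncomputable def shearForm (e : Fin n → Fin d) (s : Fin n → ℝ) : Fin d → ℝ :=
  ∑ a, s a • Pi.single (e a) 1

theorem shearForm_dotProduct (e : Fin n → Fin d) (s : Fin n → ℝ) (x : Fin d → ℝ) :
    shearForm e s ⬝ᵥ x = ∑ a, s a * x (e a) := by
  simp [shearForm, sum_dotProduct]

/-- The matrix adding a linear form to the `k`-th coordinate. -/
noncomputable def shearMatrix (e : Fin n → Fin d) (k : Fin d) (s : Fin n → ℝ) :
    Matrix (Fin d) (Fin d) ℝ :=
  1 + replicateCol Unit (Pi.single k (1 : ℝ)) * replicateRow Unit (shearForm e s)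

theorem det_shearMatrix {e : Fin n → Fin d} {k : Fin d} (hk : ∀ a, e a ≠ k) (s : Fin n → ℝ) :
    (shearMatrix e k s).det = 1 := by
  rw [shearMatrix, det_one_add_replicateCol_mul_replicateRow, shearForm_dotProduct]
  simp [hk]

theorem shearMatrix_mulVec (e : Fin n → Fin d) (k : Fin d) (s : Fin n → ℝ) (x : Fin d → ℝ) :
    (shearMatrix e k s).mulVec x = x + Pi.single k (∑ a, s a * x (e a)) := by
  rw [shearMatrix, add_mulVec, one_mulVec, ← shearForm_dotProduct]
  congr 1
  ext j
  rw [← mulVec_mulVec]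
  simp [mulVec, dotProduct, replicateCol_apply, replicateRow_apply, Pi.single_apply]

/-- The diagonal matrix contracting all coordinates but the `k`-th. -/
noncomputable def stretchMatrix (k : Fin d) (T : ℝ) : Matrix (Fin d) (Fin d) ℝ :=
  diagonal (Function.update (fun _ => T⁻¹) k (T ^ (d - 1)))

theorem det_stretchMatrix (k : Fin d) {T : ℝ} (hT : T ≠ 0) : (stretchMatrix k T).det = 1 := by
  rw [stretchMatrix, det_diagonal, Finset.prod_update_of_mem (Finset.mem_univ k),
    Finset.prod_const]
  simp [Finset.card_sdiff, hT]

/-- The element of `G_d` shearing and then stretching the `k`-th real coordinate. -/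
noncomputable def shearStretch (S : PrimeTup) {e : Fin n → Fin d} {k : Fin d} (hk : ∀ a, e a ≠ k)
    {T : ℝ} (hT : T ≠ 0) (s : Fin n → ℝ) : S.G d :=
  (⟨stretchMatrix k T * shearMatrix e k s, by
    rw [det_mul, det_stretchMatrix k hT, det_shearMatrix hk, one_mul]⟩, 1)

theorem continuous_shearStretch {e : Fin n → Fin d} {k : Fin d} (hk : ∀ a, e a ≠ k)
    {T : ℝ} (hT : T ≠ 0) : Continuous (S.shearStretch hk hT) := by
  refine Continuous.prodMk ?_ continuous_const
  refine Continuous.subtype_mk ?_ _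
  refine Continuous.matrix_mul continuous_const ?_
  unfold shearMatrix shearForm
  refine continuous_const.add (Continuous.matrix_mul continuous_const ?_)
  refine continuous_matrix fun i j => ?_
  simp only [replicateRow_apply]
  fun_prop

/-- Replace the `k`-th real coordinates of a tuple. -/
noncomputable def updateReal (k : Fin d) (y : S.Tup n d) (u : Fin n → ℝ) : S.Tup n d :=
  (fun b => Function.update (y.1 b) k (u b), y.2)

theorem continuous_updateReal (k : Fin d) :
    Continuous fun q : S.Tup n d × (Fin n → ℝ) => updateReal k q.1 q.2 := by
  unfold updateReal
  fun_prop

/-- The real minor of a tuple with columns `e`. -/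
noncomputable def realMinor (e : Fin n → Fin d) (y : S.Tup n d) : Matrix (Fin n) (Fin n) ℝ :=
  of fun b a => y.1 b (e a)

theorem continuous_realMinor (e : Fin n → Fin d) :
    Continuous (realMinor e : S.Tup n d → Matrix (Fin n) (Fin n) ℝ) := by
  unfold realMinor
  exact continuous_matrix fun i j => by simp only [of_apply]; fun_prop

theorem realMinor_updateReal {e : Fin n → Fin d} {k : Fin d} (hk : ∀ a, e a ≠ k)
    (y : S.Tup n d) (u : Fin n → ℝ) : realMinor e (updateReal k y u) = realMinor e y := by
  ext b a
  simp [realMinor, updateReal, hk]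

theorem actTup_shearStretch_realScale {e : Fin n → Fin d} {k : Fin d} (hk : ∀ a, e a ≠ k)
    {T : ℝ} (hT : T ≠ 0) (s : Fin n → ℝ) (y : S.Tup n d) :
    actTup (S.shearStretch hk hT s) (realScale T y) =
      updateReal k y (T ^ d • ((fun b => y.1 b k) + realMinor e y *ᵥ s)) := by
  have hd : d ≠ 0 := by rintro rfl; exact k.elim0
  refine Prod.ext ?_ ?_
  · ext b j
    simp only [actTup, shearStretch, realScale, updateReal, ← mulVec_mulVec, shearMatrix_mulVec]
    rw [stretchMatrix, mulVec_diagonal]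
    by_cases hj : j = k
    · subst hj
      simp only [Function.update_self, Pi.add_apply, Pi.smul_apply, smul_eq_mul, Pi.single_eq_same]
      have : T ^ d = T ^ (d - 1) * T := by rw [← pow_succ, Nat.sub_add_cancel (by omega)]
      rw [this, mulVec, dotProduct, mul_assoc]
      congr 1
      rw [mul_add, Finset.mul_sum]
      congr 1
      exact Finset.sum_congr rfl fun a _ => by simp [realMinor]; ring
    · simp [Function.update_of_ne hj, Pi.single_eq_of_ne hj, hT]
  · ext i b j
    simp [actTup, shearStretch, realScale, updateReal]

end PrimeTup

namespace PrimeTup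

attribute [local instance] Padic.measureSpace Padic.isAddHaarMeasure_volume
  isAddHaarMeasure_volume_tup

variable {S : PrimeTup} {n d : ℕ}

/-- The density obtained from averaging over shears, after a change of variables. -/
noncomputable def shearKernel (e : Fin n → Fin d) (k : Fin d) (ρ : (Fin n → ℝ) → ℝ)
    (φ : S.Tup n d → ℝ) (ε : ℝ) (y : S.Tup n d) (u : Fin n → ℝ) : ℝ :=
  |(realMinor e y).det|⁻¹ *
    (ρ ((realMinor e y).det⁻¹ • ((realMinor e y).adjugate *ᵥ (ε • u - fun b => y.1 b k))) *
      φ (updateReal k y u))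

section

variable {e : Fin n → Fin d} {k : Fin d} {ρ : (Fin n → ℝ) → ℝ} {φ : S.Tup n d → ℝ}

theorem continuous_shearKernel (hk : ∀ a, e a ≠ k) (hρ : Continuous ρ) (hφ : Continuous φ)
    (hdet : ∀ y ∈ tsupport φ, (realMinor e y).det ≠ 0) :
    Continuous fun q : ℝ × S.Tup n d × (Fin n → ℝ) => shearKernel e k ρ φ q.1 q.2.1 q.2.2 := by
  have hu : Continuous fun q : ℝ × S.Tup n d × (Fin n → ℝ) => updateReal k q.2.1 q.2.2 :=
    (continuous_updateReal k).comp continuous_snd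
  have hY : Continuous fun q : ℝ × S.Tup n d × (Fin n → ℝ) => realMinor e q.2.1 :=
    (continuous_realMinor e).comp (continuous_fst.comp continuous_snd)
  have hD := hY.matrix_det
  refine continuous_iff_continuousAt.2 fun q => ?_
  by_cases hq : (realMinor e q.2.1).det = 0
  · have hmem : updateReal k q.2.1 q.2.2 ∉ tsupport φ := fun h =>
      hdet _ h (by rw [realMinor_updateReal hk, hq])
    have hev : ∀ᶠ r in nhds q, shearKernel e k ρ φ r.1 r.2.1 r.2.2 = 0 := by
      filter_upwards [((isClosed_tsupport φ).isOpen_compl.preimage hu).mem_nhds hmem] with r hr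
      rw [shearKernel, image_eq_zero_of_notMem_tsupport hr, mul_zero, mul_zero]
    exact continuousAt_const.congr (hev.mono fun r hr => hr.symm)
  · unfold shearKernel
    refine ContinuousAt.mul ?_ (ContinuousAt.mul ?_ ?_)
    · exact hD.abs.continuousAt.inv₀ (abs_ne_zero.2 hq)
    · refine hρ.continuousAt.comp' ?_
      refine (hD.continuousAt.inv₀ hq).smul (Continuous.continuousAt ?_)
      exact hY.matrix_adjugate.matrix_mulVec (by fun_prop)
    · exact (hφ.comp hu).continuousAt

theorem eq_mulVec_of_det_ne_zero {Y : Matrix (Fin n) (Fin n) ℝ} (hY : Y.det ≠ 0)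
    (v : Fin n → ℝ) : Y *ᵥ (Y.det⁻¹ • (Y.adjugate *ᵥ v)) = v := by
  rw [mulVec_smul, mulVec_mulVec, mul_adjugate, smul_mulVec, one_mulVec, smul_smul,
    inv_mul_cancel₀ hY, one_smul]

theorem adjugate_mulVec_mulVec {Y : Matrix (Fin n) (Fin n) ℝ} (hY : Y.det ≠ 0)
    (v : Fin n → ℝ) : Y.det⁻¹ • (Y.adjugate *ᵥ (Y *ᵥ v)) = v := by
  rw [mulVec_mulVec, adjugate_mul, smul_mulVec, one_mulVec, smul_smul,
    inv_mul_cancel₀ hY, one_smul]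

theorem exists_shearKernel_eq_zero (hk : ∀ a, e a ≠ k) (hρc : HasCompactSupport ρ)
    (hφc : HasCompactSupport φ) (hdet : ∀ y ∈ tsupport φ, (realMinor e y).det ≠ 0) :
    ∃ R : ℝ, ∀ ε : ℝ, |ε| ≤ 1 → ∀ y u, shearKernel e k ρ φ ε y u ≠ 0 → ‖y‖ ≤ R ∧ ‖u‖ ≤ R := by
  obtain ⟨R₁, hR₁⟩ := hρc.isCompact.isBounded.exists_norm_le
  obtain ⟨R₂, hR₂⟩ := hφc.isCompact.isBounded.exists_norm_le
  set R := max (max R₁ R₂) 0 with hR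
  have hR0 : 0 ≤ R := le_max_right _ _
  refine ⟨R + n * (R * R), fun ε hε y u h => ?_⟩
  have hnR : 0 ≤ n * (R * R) := by positivity
  have h1 : φ (updateReal k y u) ≠ 0 := fun h0 => h (by rw [shearKernel, h0, mul_zero, mul_zero])
  have h2 : ρ ((realMinor e y).det⁻¹ •
      ((realMinor e y).adjugate *ᵥ (ε • u - fun b => y.1 b k))) ≠ 0 :=
    fun h0 => h (by rw [shearKernel, h0, zero_mul, mul_zero])
  have hφm := subset_tsupport φ h1
  have hdet' : (realMinor e y).det ≠ 0 := by
    have := hdet _ hφm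
    rwa [realMinor_updateReal hk] at this
  have h3 : ‖updateReal k y u‖ ≤ R :=
    (hR₂ _ hφm).trans ((le_max_right _ _).trans (le_max_left _ _))
  have h4 := (hR₁ _ (subset_tsupport ρ h2)).trans ((le_max_left R₁ R₂).trans (le_max_left _ 0))
  rw [← hR] at h4
  set s := (realMinor e y).det⁻¹ • ((realMinor e y).adjugate *ᵥ (ε • u - fun b => y.1 b k))
  have h5 : realMinor e y *ᵥ s = ε • u - fun b => y.1 b k := eq_mulVec_of_det_ne_zero hdet' _
  have hcoord : ∀ b j, |Function.update (y.1 b) k (u b) j| ≤ R := fun b j =>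
    (norm_le_pi_norm ((updateReal k y u).1 b) j).trans
      ((norm_le_pi_norm (updateReal k y u).1 b).trans ((le_max_left _ _).trans h3))
  have hu : ∀ b, |u b| ≤ R := fun b => by simpa using hcoord b k
  have hy : ∀ b j, j ≠ k → |y.1 b j| ≤ R := fun b j hj => by
    simpa [Function.update_of_ne hj] using hcoord b j
  have hyk : ∀ b, |y.1 b k| ≤ R + n * (R * R) := fun b => by
    have h6 : y.1 b k = ε * u b - ∑ a, y.1 b (e a) * s a := by
      have := congrFun h5 b
      simp only [mulVec, dotProduct, realMinor, of_apply, Pi.sub_apply, Pi.smul_apply,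
        smul_eq_mul] at this
      linarith
    rw [h6]
    refine (abs_sub _ _).trans (add_le_add ?_ ?_)
    · rw [abs_mul]
      calc |ε| * |u b| ≤ 1 * R := mul_le_mul hε (hu b) (abs_nonneg _) zero_le_one
        _ = R := one_mul R
    · refine (Finset.abs_sum_le_sum_abs _ _).trans ?_
      calc ∑ a, |y.1 b (e a) * s a| ≤ ∑ _a : Fin n, R * R := by
            refine Finset.sum_le_sum fun a _ => ?_
            rw [abs_mul]
            exact mul_le_mul (hy b _ (hk a)) ((norm_le_pi_norm s a).trans h4) (abs_nonneg _) hR0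
        _ = n * (R * R) := by simp
  refine ⟨?_, ?_⟩
  · rw [Prod.norm_def]
    refine max_le ?_ ?_
    · refine (pi_norm_le_iff_of_nonneg (by positivity)).2 fun b =>
        (pi_norm_le_iff_of_nonneg (by positivity)).2 fun j => ?_
      by_cases hj : j = k
      · rw [hj]; exact hyk b
      · exact (hy b j hj).trans (by linarith)
    · exact ((le_max_right _ _).trans h3).trans (by linarith)
  · exact (pi_norm_le_iff_of_nonneg (by positivity)).2 fun b => (hu b).trans (by linarith)

theorem tendsto_lintegral_shearKernel (hk : ∀ a, e a ≠ k) (hρ : Continuous ρ) (hφ : Continuous φ)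
    (hρc : HasCompactSupport ρ) (hφc : HasCompactSupport φ)
    (hdet : ∀ y ∈ tsupport φ, (realMinor e y).det ≠ 0)
    {ε : ℕ → ℝ} (hε : Filter.Tendsto ε Filter.atTop (nhds 0)) (hε1 : ∀ t, |ε t| ≤ 1)
    {w : ℕ → S.Tup n d → S.Tup n d} (hwm : ∀ t, Measurable (w t))
    (hw : ∀ y, Filter.Tendsto (fun t => w t y) Filter.atTop (nhds y))
    (hw1 : ∀ᶠ t in Filter.atTop, ∀ y, ‖w t y - y‖ ≤ 1) :
    Filter.Tendsto (fun t => ∫⁻ y, ∫⁻ u, ENNReal.ofReal (shearKernel e k ρ φ (ε t) (w t y) u))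
      Filter.atTop (nhds (∫⁻ y, ∫⁻ u, ENNReal.ofReal (shearKernel e k ρ φ 0 y u))) := by
  have hK := continuous_shearKernel hk hρ hφ hdet
  obtain ⟨R, hR⟩ := exists_shearKernel_eq_zero hk hρc hφc hdet
  have hcomp : IsCompact (Set.Icc (-1 : ℝ) 1 ×ˢ
      (Metric.closedBall (0 : S.Tup n d) R ×ˢ Metric.closedBall (0 : Fin n → ℝ) R)) :=
    isCompact_Icc.prod ((isCompact_closedBall _ _).prod (isCompact_closedBall _ _))
  obtain ⟨C, hC⟩ := hcomp.exists_bound_of_continuousOn hK.continuousOn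
  have hmeas : ∀ t, Measurable fun q : S.Tup n d × (Fin n → ℝ) =>
      ENNReal.ofReal (shearKernel e k ρ φ (ε t) (w t q.1) q.2) := fun t => by
    have h1 : Measurable fun q : ℝ × S.Tup n d × (Fin n → ℝ) =>
        shearKernel e k ρ φ q.1 q.2.1 q.2.2 := hK.measurable
    exact (h1.comp (measurable_const.prodMk
      (((hwm t).comp measurable_fst).prodMk measurable_snd))).ennreal_ofReal
  have hmeas0 : Measurable fun q : S.Tup n d × (Fin n → ℝ) =>
      ENNReal.ofReal (shearKernel e k ρ φ 0 q.1 q.2) :=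
    (hK.comp (by fun_prop : Continuous fun q : S.Tup n d × (Fin n → ℝ) =>
      ((0 : ℝ), q))).measurable.ennreal_ofReal
  have hinner : ∀ t, ∫⁻ y, ∫⁻ u, ENNReal.ofReal (shearKernel e k ρ φ (ε t) (w t y) u) =
      ∫⁻ q : S.Tup n d × (Fin n → ℝ), ENNReal.ofReal (shearKernel e k ρ φ (ε t) (w t q.1) q.2)
        ∂((volume : Measure (S.Tup n d)).prod volume) := fun t =>
    (lintegral_prod _ (hmeas t).aemeasurable).symm
  simp only [hinner]
  rw [← lintegral_prod (fun q : S.Tup n d × (Fin n → ℝ) =>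
    ENNReal.ofReal (shearKernel e k ρ φ 0 q.1 q.2)) hmeas0.aemeasurable]
  refine tendsto_lintegral_filter_of_dominated_convergence
    ((Metric.closedBall (0 : S.Tup n d) (R + 1) ×ˢ Metric.closedBall (0 : Fin n → ℝ) R).indicator
      fun _ => ENNReal.ofReal C) (Filter.Eventually.of_forall hmeas) ?_ ?_ ?_
  · filter_upwards [hw1] with t ht
    refine Filter.Eventually.of_forall fun q => ?_
    by_cases h0 : shearKernel e k ρ φ (ε t) (w t q.1) q.2 = 0
    · rw [h0, ENNReal.ofReal_zero]; exact zero_le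
    · obtain ⟨h1, h2⟩ := hR _ (hε1 t) _ _ h0
      rw [Set.indicator_of_mem]
      · refine ENNReal.ofReal_le_ofReal ((le_abs_self _).trans
          (hC (ε t, w t q.1, q.2) ⟨abs_le.1 (hε1 t), ?_, ?_⟩))
        · simpa using h1
        · simpa using h2
      · refine ⟨?_, by simpa using h2⟩
        rw [mem_closedBall_zero_iff]
        calc ‖q.1‖ = ‖w t q.1 - (w t q.1 - q.1)‖ := by congr 1; abel
          _ ≤ R + 1 := (norm_sub_le _ _).trans (add_le_add h1 (ht _))
  · rw [lintegral_indicator_const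
      (Metric.isClosed_closedBall.measurableSet.prod Metric.isClosed_closedBall.measurableSet),
      Measure.prod_prod]
    exact ENNReal.mul_ne_top ENNReal.ofReal_ne_top (ENNReal.mul_ne_top
      (isCompact_closedBall _ _).measure_lt_top.ne (isCompact_closedBall _ _).measure_lt_top.ne)
  · refine Filter.Eventually.of_forall fun q => ?_
    have h1 : Filter.Tendsto (fun r : ℝ × S.Tup n d × (Fin n → ℝ) =>
        ENNReal.ofReal (shearKernel e k ρ φ r.1 r.2.1 r.2.2)) (nhds ((0 : ℝ), q.1, q.2))
        (nhds (ENNReal.ofReal (shearKernel e k ρ φ 0 q.1 q.2))) :=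
      (ENNReal.continuous_ofReal.comp hK).tendsto ((0 : ℝ), q.1, q.2)
    have h2 : Filter.Tendsto (fun t => (ε t, w t q.1, q.2)) Filter.atTop
        (nhds ((0 : ℝ), q.1, q.2)) :=
      hε.prodMk_nhds ((hw q.1).prodMk_nhds tendsto_const_nhds)
    have h3 := h1.comp h2
    simp only [Function.comp_def] at h3
    exact h3

theorem lintegral_shearStretch_realScale (hk : ∀ a, e a ≠ k) (hφ : Continuous φ)
    (hρ : Continuous ρ)
    (hdet : ∀ y ∈ tsupport φ, (realMinor e y).det ≠ 0) {T : ℝ} (hT : 0 < T) (y : S.Tup n d) :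
    ∫⁻ s, ENNReal.ofReal (ρ s * φ (actTup (S.shearStretch hk hT.ne' s) (realScale T y))) =
      ENNReal.ofReal ((T ^ (n * d))⁻¹) *
        ∫⁻ u, ENNReal.ofReal (shearKernel e k ρ φ ((T ^ d)⁻¹) y u) := by
  simp only [actTup_shearStretch_realScale]
  by_cases hY : (realMinor e y).det = 0
  · have h0 : ∀ u, φ (updateReal k y u) = 0 := fun u =>
      image_eq_zero_of_notMem_tsupport fun h => hdet _ h (by rw [realMinor_updateReal hk, hY])
    simp [h0, shearKernel]
  set Y := realMinor e y with hYdef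
  set v : Fin n → ℝ := fun b => y.1 b k with hv
  have hTd : T ^ d ≠ 0 := (pow_pos hT d).ne'
  let f : (Fin n → ℝ) → ℝ := fun u =>
    ρ (Y.det⁻¹ • (Y.adjugate *ᵥ ((T ^ d)⁻¹ • u - v))) * φ (updateReal k y u)
  have hf : Continuous f := by
    refine Continuous.mul (hρ.comp ?_) (hφ.comp ?_)
    · have hc : Continuous fun u : Fin n → ℝ => Y.adjugate *ᵥ ((T ^ d)⁻¹ • u - v) :=
        Continuous.matrix_mulVec continuous_const (by fun_prop)
      exact hc.const_smul Y.det⁻¹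
    · exact (continuous_updateReal k).comp (by fun_prop : Continuous fun u => (y, u))
  have hM : (T ^ d • Y).det ≠ 0 := by
    rw [det_smul]; exact mul_ne_zero (pow_ne_zero _ hTd) hY
  have h1 : ∀ s, ρ s * φ (updateReal k y (T ^ d • (v + Y *ᵥ s))) =
      f (T ^ d • v + (toLin' (T ^ d • Y)) s) := fun s => by
    have h2 : T ^ d • v + (toLin' (T ^ d • Y)) s = T ^ d • (v + Y *ᵥ s) := by
      rw [toLin'_apply, smul_mulVec, smul_add]
    rw [h2]
    simp only [f]
    rw [smul_smul, inv_mul_cancel₀ hTd, one_smul, add_sub_cancel_left, adjugate_mulVec_mulVec hY]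
  have hmeasf : Measurable fun u => ENNReal.ofReal (f u) := hf.measurable.ennreal_ofReal
  calc ∫⁻ s, ENNReal.ofReal (ρ s * φ (updateReal k y (T ^ d • (v + Y *ᵥ s))))
      = ∫⁻ s, ENNReal.ofReal (f (T ^ d • v + (toLin' (T ^ d • Y)) s)) := by simp only [h1]
    _ = ∫⁻ x, ENNReal.ofReal (f (T ^ d • v + x))
          ∂(Measure.map (toLin' (T ^ d • Y)) volume) := by
        rw [lintegral_map]
        · exact hmeasf.comp (measurable_const_add _)
        · exact (LinearMap.continuous_on_pi _).measurable
    _ = ENNReal.ofReal |(T ^ d • Y).det⁻¹| * ∫⁻ u, ENNReal.ofReal (f u) := by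
        rw [Real.map_matrix_volume_pi_eq_smul_volume_pi hM, lintegral_smul_measure, smul_eq_mul,
          lintegral_add_left_eq_self (fun u => ENNReal.ofReal (f u))]
    _ = _ := by
        have h3 : |(T ^ d • Y).det⁻¹| = (T ^ (n * d))⁻¹ * |Y.det|⁻¹ := by
          rw [det_smul, Fintype.card_fin, abs_inv, abs_mul, abs_of_pos (pow_pos (pow_pos hT d) n),
            mul_inv, ← pow_mul, mul_comm d n]
        rw [h3, ENNReal.ofReal_mul (by positivity), mul_assoc,
          ← lintegral_const_mul _ hmeasf]
        congr 1
        refine lintegral_congr fun u => ?_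
        rw [shearKernel, ← ENNReal.ofReal_mul (inv_nonneg.2 (abs_nonneg _))]

end

end PrimeTup

namespace PrimeTup

attribute [local instance] Padic.measureSpace Padic.isAddHaarMeasure_volume
  isAddHaarMeasure_volume_tup

variable {S : PrimeTup} {n d : ℕ}

/-- A sequence of stretching factors dominating the size of the fundamental boxes. -/
noncomputable def stretchRate (S : PrimeTup) (t : ℕ) : ℝ := (t + 1) * (S.primeProd : ℝ) ^ t

theorem one_le_primeProd (S : PrimeTup) : (1 : ℝ) ≤ S.primeProd := by
  exact_mod_cast S.primeProd_pos

theorem add_one_le_stretchRate (t : ℕ) : (t : ℝ) + 1 ≤ S.stretchRate t :=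
  le_mul_of_one_le_right (by positivity) (one_le_pow₀ S.one_le_primeProd)

theorem stretchRate_pos (S : PrimeTup) (t : ℕ) : 0 < S.stretchRate t :=
  lt_of_lt_of_le (by positivity) (add_one_le_stretchRate t)

theorem one_le_stretchRate (t : ℕ) : 1 ≤ S.stretchRate t :=
  le_trans (by linarith [(Nat.cast_nonneg t : (0 : ℝ) ≤ t)]) (add_one_le_stretchRate t)

theorem tendsto_inv_stretchRate_pow (hd : d ≠ 0) :
    Filter.Tendsto (fun t => (S.stretchRate t ^ d)⁻¹) Filter.atTop (nhds 0) := by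
  refine tendsto_inv_atTop_zero.comp ((Filter.tendsto_pow_atTop hd).comp ?_)
  exact Filter.tendsto_atTop_mono add_one_le_stretchRate
    (Filter.tendsto_atTop_add_const_right _ _ tendsto_natCast_atTop_atTop)

theorem abs_inv_stretchRate_pow_le (t : ℕ) : |(S.stretchRate t ^ d)⁻¹| ≤ 1 := by
  rw [abs_of_pos (inv_pos.2 (pow_pos (S.stretchRate_pos t) d))]
  exact inv_le_one_of_one_le₀ (one_le_pow₀ (one_le_stretchRate t))

theorem actTup_realScale (g : S.G d) (T : ℝ) (x : S.Tup n d) :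
    actTup g (realScale T x) = realScale T (actTup g x) := by
  ext <;> simp [actTup, realScale, mulVec_smul]

theorem realScale_realScale (T U : ℝ) (x : S.Tup n d) :
    realScale T (realScale U x) = realScale (T * U) x := by
  simp [realScale, smul_smul]

theorem realScale_one (x : S.Tup n d) : realScale 1 x = x := by
  simp [realScale]

theorem realScale_sub (T : ℝ) (x y : S.Tup n d) :
    realScale T (x - y) = realScale T x - realScale T y := by
  ext <;> simp [realScale, mul_sub]

theorem lintegral_realScale {T : ℝ} (hT : 0 < T) {f : S.Tup n d → ℝ≥0∞} (hf : Measurable f) :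
    ∫⁻ y, f (realScale T y) = ENNReal.ofReal ((T ^ (n * d))⁻¹) * ∫⁻ x, f x := by
  rw [← lintegral_map hf (continuous_realScale T).measurable, map_realScale_volume hT,
    lintegral_smul_measure, smul_eq_mul]

theorem measurable_diagTup_round (t : ℕ) :
    Measurable fun x : S.Tup n d => S.diagTup (round t x) := by
  let m : MeasurableSpace (Fin n → Fin d → S.Zs) := ⊤
  have h1 : Measurable (round t : S.Tup n d → Fin n → Fin d → S.Zs) := by
    refine measurable_to_countable' fun z => ?_
    rw [preimage_round_singleton]
    exact (measurableSet_roundBox t).preimage (by fun_prop)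
  exact (measurable_from_top (f := S.diagTup)).comp h1

/-- Rounding in the coordinates stretched by `T` and moved by `g`. -/
noncomputable def stretchRound (t : ℕ) (T : ℝ) (g : S.G d) (y : S.Tup n d) : S.Tup n d :=
  realScale T⁻¹ (actTup g (S.diagTup (round t (actTup g⁻¹ (realScale T y)))))

theorem measurable_stretchRound (t : ℕ) (T : ℝ) (g : S.G d) :
    Measurable (stretchRound t T g : S.Tup n d → S.Tup n d) :=
  (continuous_realScale _).measurable.comp ((continuous_actTup g).measurable.comp
    ((measurable_diagTup_round t).comp ((continuous_actTup _).measurable.comp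
      (continuous_realScale T).measurable)))

theorem realScale_stretchRound (t : ℕ) {T : ℝ} (hT : T ≠ 0) (g : S.G d) (y : S.Tup n d) :
    realScale T (stretchRound t T g y) =
      actTup g (S.diagTup (round t (actTup g⁻¹ (realScale T y)))) := by
  rw [stretchRound, realScale_realScale, mul_inv_cancel₀ hT, realScale_one]

theorem norm_realScale_le_of_mem_roundBox {t : ℕ} {x : S.Tup n d} (hx : x ∈ S.roundBox n d t) :
    ‖realScale (S.stretchRate t)⁻¹ x‖ ≤ ((t : ℝ) + 1)⁻¹ := by
  rw [Prod.norm_def]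
  refine max_le ?_ ?_
  · refine (pi_norm_le_iff_of_nonneg (by positivity)).2 fun a =>
      (pi_norm_le_iff_of_nonneg (by positivity)).2 fun j => ?_
    have h1 := hx.1 a j
    have h2 : 0 < (S.primeProd : ℝ) ^ t := pow_pos (by linarith [S.one_le_primeProd]) t
    simp only [realScale, Pi.smul_apply, smul_eq_mul]
    rw [Real.norm_of_nonneg (mul_nonneg (inv_nonneg.2 (S.stretchRate_pos t).le) h1.1),
      stretchRate, mul_inv, mul_assoc]
    refine mul_le_of_le_one_right (by positivity) ?_
    rw [inv_mul_le_iff₀ h2, mul_one]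
    exact h1.2.le
  · refine (pi_norm_le_iff_of_nonneg (by positivity)).2 fun i =>
      (pi_norm_le_iff_of_nonneg (by positivity)).2 fun a =>
      (pi_norm_le_iff_of_nonneg (by positivity)).2 fun j => (hx.2 i a j).trans ?_
    rw [_root_.zpow_neg, zpow_natCast]
    refine inv_anti₀ (by positivity) ?_
    have h2 : t + 1 ≤ S.p i ^ t := t.lt_pow_self (S.hp i).one_lt
    exact_mod_cast h2

theorem eventually_norm_stretchRound_sub_lt (g : S.G d) {δ : ℝ} (hδ : 0 < δ) :
    ∀ᶠ t in Filter.atTop, ∀ y : S.Tup n d, ‖stretchRound t (S.stretchRate t) g y - y‖ < δ := by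
  have hc : Filter.Tendsto (actTup g : S.Tup n d → S.Tup n d) (nhds 0) (nhds 0) := by
    have h := (continuous_actTup (n := n) g).tendsto 0
    have h0 : actTup g (0 : S.Tup n d) = 0 := by
      rw [← sub_self (0 : S.Tup n d), actTup_sub, sub_self, sub_self]
    rwa [h0] at h
  obtain ⟨η, hη, hη'⟩ := Metric.tendsto_nhds_nhds.1 hc δ hδ
  have h1 : Filter.Tendsto (fun t : ℕ => ((t : ℝ) + 1)⁻¹) Filter.atTop (nhds 0) :=
    tendsto_inv_atTop_zero.comp
      (Filter.tendsto_atTop_add_const_right _ _ tendsto_natCast_atTop_atTop)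
  filter_upwards [h1.eventually_lt_const hη] with t ht y
  have hT := (S.stretchRate_pos t).ne'
  set T := S.stretchRate t with hTdef
  set r := actTup g⁻¹ (realScale T y) - S.diagTup (round t (actTup g⁻¹ (realScale T y))) with hr
  have h2 : stretchRound t T g y - y = - actTup g (realScale T⁻¹ r) := by
    have hy : y = realScale T⁻¹ (actTup g (actTup g⁻¹ (realScale T y))) := by
      rw [← actTup_mul, mul_inv_cancel, actTup_one, realScale_realScale, inv_mul_cancel₀ hT,
        realScale_one]
    rw [actTup_realScale, hr, actTup_sub, realScale_sub, ← hy, stretchRound]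
    abel
  rw [h2, norm_neg]
  have h3 := hη' (x := realScale T⁻¹ r) (by
    rw [dist_zero_right]
    exact (norm_realScale_le_of_mem_roundBox (sub_round_mem t _)).trans_lt ht)
  rwa [dist_zero_right] at h3

section

variable {e : Fin n → Fin d} {k : Fin d} {ρ : (Fin n → ℝ) → ℝ} {φ : S.Tup n d → ℝ}

theorem continuous_shear_integrand (hk : ∀ a, e a ≠ k) {T : ℝ} (hT : T ≠ 0) (hρ : Continuous ρ)
    (hφ : Continuous φ) : Continuous fun q : S.Tup n d × (Fin n → ℝ) =>
      ρ q.2 * φ (actTup (S.shearStretch hk hT q.2) q.1) := by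
  refine (hρ.comp continuous_snd).mul (hφ.comp ?_)
  exact continuous_actTup_uncurry.comp
    (((continuous_shearStretch hk hT).comp continuous_snd).prodMk continuous_fst)

theorem lintegral_lintegral_shearKernel (hk : ∀ a, e a ≠ k) (hφ : Continuous φ)
    (hρ : Continuous ρ) (hρ0 : ∀ s, 0 ≤ ρ s) (hρ1 : ∫⁻ s, ENNReal.ofReal (ρ s) = 1)
    (hdet : ∀ y ∈ tsupport φ, (realMinor e y).det ≠ 0) {T : ℝ} (hT : 0 < T) :
    ∫⁻ y, ∫⁻ u, ENNReal.ofReal (shearKernel e k ρ φ ((T ^ d)⁻¹) y u) =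
      ∫⁻ y, ENNReal.ofReal (φ y) := by
  have hm : Measurable fun q : S.Tup n d × (Fin n → ℝ) =>
      ENNReal.ofReal (ρ q.2 * φ (actTup (S.shearStretch hk hT.ne' q.2) q.1)) :=
    (continuous_shear_integrand hk hT.ne' hρ hφ).measurable.ennreal_ofReal
  have hc0 : ENNReal.ofReal ((T ^ (n * d))⁻¹) ≠ 0 := by
    rw [Ne, ENNReal.ofReal_eq_zero, not_le]
    positivity
  refine (ENNReal.mul_right_inj hc0 ENNReal.ofReal_ne_top).1 ?_
  rw [← lintegral_const_mul' _ _ ENNReal.ofReal_ne_top]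
  simp only [← lintegral_shearStretch_realScale hk hφ hρ hdet hT]
  rw [lintegral_realScale hT (f := fun x => ∫⁻ s, ENNReal.ofReal
    (ρ s * φ (actTup (S.shearStretch hk hT.ne' s) x))) hm.lintegral_prod_right',
    lintegral_lintegral_swap hm.aemeasurable]
  congr 1
  have h1 : ∀ s, ∫⁻ x, ENNReal.ofReal (ρ s * φ (actTup (S.shearStretch hk hT.ne' s) x)) =
      ENNReal.ofReal (ρ s) * ∫⁻ x, ENNReal.ofReal (φ x) := fun s => by
    simp only [ENNReal.ofReal_mul (hρ0 s)]
    rw [lintegral_const_mul' _ _ ENNReal.ofReal_ne_top,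
      (measurePreserving_actTup (S.shearStretch hk hT.ne' s)).lintegral_comp
        hφ.measurable.ennreal_ofReal]
  simp only [h1]
  rw [lintegral_mul_const _ hρ.measurable.ennreal_ofReal, hρ1, one_mul]

theorem lintegral_lintegral_shearKernel_zero (hk : ∀ a, e a ≠ k) (hφ : Continuous φ)
    (hφc : HasCompactSupport φ) (hρ : Continuous ρ) (hρ0 : ∀ s, 0 ≤ ρ s)
    (hρc : HasCompactSupport ρ) (hρ1 : ∫⁻ s, ENNReal.ofReal (ρ s) = 1)
    (hdet : ∀ y ∈ tsupport φ, (realMinor e y).det ≠ 0) :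
    ∫⁻ y, ∫⁻ u, ENNReal.ofReal (shearKernel e k ρ φ 0 y u) = ∫⁻ y, ENNReal.ofReal (φ y) := by
  have hd : d ≠ 0 := by rintro rfl; exact k.elim0
  have h := tendsto_lintegral_shearKernel hk hρ hφ hρc hφc hdet
    (tendsto_inv_stretchRate_pow (S := S) hd) abs_inv_stretchRate_pow_le (w := fun _ => id) (fun _ => measurable_id)
    (fun y => tendsto_const_nhds)
    (Filter.Eventually.of_forall fun t y => by rw [id, sub_self, norm_zero]; exact zero_le_one)
  refine tendsto_nhds_unique h ?_
  simp only [id, lintegral_lintegral_shearKernel hk hφ hρ hρ0 hρ1 hdet (S.stretchRate_pos _)]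
  exact tendsto_const_nhds

/-- Averaging the lattice sums of `φ` over stretched shears recovers the integral of `φ`. -/
theorem tendsto_lintegral_tsum_shearStretch (hk : ∀ a, e a ≠ k) (hφ : Continuous φ)
    (hφc : HasCompactSupport φ) (hρ : Continuous ρ) (hρ0 : ∀ s, 0 ≤ ρ s)
    (hρc : HasCompactSupport ρ) (hρ1 : ∫⁻ s, ENNReal.ofReal (ρ s) = 1)
    (hdet : ∀ y ∈ tsupport φ, (realMinor e y).det ≠ 0) (g : S.G d) :
    Filter.Tendsto (fun t => ∫⁻ s, ∑' z, ENNReal.ofReal (ρ s *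
      φ (actTup (S.shearStretch hk (S.stretchRate_pos t).ne' s) (actTup g (S.diagTup z)))))
      Filter.atTop (nhds (∫⁻ y, ENNReal.ofReal (φ y))) := by
  have hd : d ≠ 0 := by rintro rfl; exact k.elim0
  have h := tendsto_lintegral_shearKernel hk hρ hφ hρc hφc hdet
    (tendsto_inv_stretchRate_pow (S := S) hd) abs_inv_stretchRate_pow_le (w := fun t => stretchRound t (S.stretchRate t) g)
    (fun t => measurable_stretchRound t _ g)
    (fun y => tendsto_iff_norm_sub_tendsto_zero.2 (Metric.tendsto_nhds.2 fun δ hδ => by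
      filter_upwards [eventually_norm_stretchRound_sub_lt g hδ] with t ht
      simpa using ht y))
    ((eventually_norm_stretchRound_sub_lt g one_pos).mono fun t ht y => (ht y).le)
  rw [lintegral_lintegral_shearKernel_zero hk hφ hφc hρ hρ0 hρc hρ1 hdet] at h
  refine h.congr fun t => ?_
  have hT := S.stretchRate_pos t
  have hcont := continuous_shear_integrand hk hT.ne' hρ hφ
  have hm : Measurable fun q : S.Tup n d × (Fin n → ℝ) =>
      ENNReal.ofReal (ρ q.2 * φ (actTup (S.shearStretch hk hT.ne' q.2) q.1)) :=
    hcont.measurable.ennreal_ofReal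
  have hmz : ∀ x : S.Tup n d, Measurable fun s =>
      ENNReal.ofReal (ρ s * φ (actTup (S.shearStretch hk hT.ne' s) x)) :=
    fun x => hm.comp measurable_prodMk_left
  rw [lintegral_tsum fun z => (hmz (actTup g (S.diagTup z))).aemeasurable]
  let Ψ : S.Tup n d → ℝ≥0∞ := fun x => ∫⁻ s, ENNReal.ofReal
    (ρ s * φ (actTup (S.shearStretch hk hT.ne' s) x))
  have hΨ : Measurable Ψ := hm.lintegral_prod_right'
  have hF : Measurable fun x : S.Tup n d => Ψ (actTup g (S.diagTup (round t x))) :=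
    hΨ.comp ((continuous_actTup g).measurable.comp (measurable_diagTup_round t))
  have hc0 : ENNReal.ofReal ((S.stretchRate t ^ (n * d))⁻¹) ≠ 0 := by
    rw [Ne, ENNReal.ofReal_eq_zero, not_le]
    positivity
  change _ = ∑' z, Ψ (actTup g (S.diagTup z))
  rw [tsum_diagTup_eq_lintegral t fun x => Ψ (actTup g x),
    ← (measurePreserving_actTup g⁻¹).lintegral_comp hF]
  refine (ENNReal.mul_right_inj hc0 ENNReal.ofReal_ne_top).1 ?_
  rw [← lintegral_realScale hT (f := fun x => Ψ (actTup g (S.diagTup (round t (actTup g⁻¹ x)))))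
    (hF.comp (continuous_actTup _).measurable),
    ← lintegral_const_mul' _ _ ENNReal.ofReal_ne_top]
  refine lintegral_congr fun y => ?_
  rw [← realScale_stretchRound t hT.ne' g y]
  exact (lintegral_shearStretch_realScale hk hφ hρ hdet hT _).symm

end

end PrimeTup

namespace PrimeTup

attribute [local instance] Padic.measureSpace Padic.isAddHaarMeasure_volume
  isAddHaarMeasure_volume_tup

variable {S : PrimeTup} {n d : ℕ}

theorem continuous_inv_G : Continuous fun g : S.G d => g⁻¹ := by
  have h1 : Continuous fun A : SpecialLinearGroup (Fin d) ℝ => A⁻¹ :=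
    Continuous.subtype_mk (continuous_subtype_val.matrix_adjugate) _
  have h2 : ∀ i, Continuous fun A : SpecialLinearGroup (Fin d) (S.Qp i) => A⁻¹ := fun i =>
    Continuous.subtype_mk (continuous_subtype_val.matrix_adjugate) _
  refine (h1.comp continuous_fst).prodMk (continuous_pi fun i => ?_)
  exact (h2 i).comp ((continuous_apply i).comp continuous_snd)

theorem continuous_tsum_actTup {X : Type*} [TopologicalSpace X] [WeaklyLocallyCompactSpace X]
    {h : X → S.G d} (hh : Continuous h) {φ : S.Tup n d → ℝ} (hφ : Continuous φ)
    (hφc : HasCompactSupport φ) (g : S.G d) : Continuous fun s =>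
      ∑' z, ENNReal.ofReal (φ (actTup (h s) (actTup g (S.diagTup z)))) := by
  refine continuous_iff_continuousAt.2 fun s₀ => ?_
  obtain ⟨K, hK, hKs⟩ := exists_compact_mem_nhds s₀
  let F : X × S.Tup n d → S.Tup n d := fun q => actTup (g⁻¹ * (h q.1)⁻¹) q.2
  have hF : Continuous F := by
    have h1 : Continuous fun q : X × S.Tup n d =>
        actTup g⁻¹ (actTup (h q.1)⁻¹ q.2) :=
      (continuous_actTup g⁻¹).comp (continuous_actTup_uncurry.comp
        (((continuous_inv_G.comp hh).comp continuous_fst).prodMk continuous_snd))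
    simpa only [F, actTup_mul] using h1
  have hB := ((hK.prod hφc.isCompact).image hF).isBounded
  have hfin := finite_diagTup_mem_of_isBounded hB
  have hev : (fun s => ∑' z, ENNReal.ofReal (φ (actTup (h s) (actTup g (S.diagTup z))))) =ᶠ[nhds s₀]
      fun s => ∑ z ∈ hfin.toFinset, ENNReal.ofReal (φ (actTup (h s) (actTup g (S.diagTup z)))) := by
    filter_upwards [hKs] with s hs
    refine tsum_eq_sum fun z hz => ?_
    suffices h0 : φ (actTup (h s) (actTup g (S.diagTup z))) = 0 by rw [h0, ENNReal.ofReal_zero]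
    refine image_eq_zero_of_notMem_tsupport fun hmem => ?_
    refine hz (hfin.mem_toFinset.2 ⟨(s, actTup (h s) (actTup g (S.diagTup z))), ⟨hs, hmem⟩, ?_⟩)
    simp only [F]
    have h1 : g⁻¹ * (h s)⁻¹ * h s * g = 1 := by group
    rw [← actTup_mul, ← actTup_mul, h1, actTup_one]
  refine ContinuousAt.congr (Continuous.continuousAt ?_) hev.symm
  refine continuous_finsetSum _ fun z _ => ENNReal.continuous_ofReal.comp (hφ.comp ?_)
  exact continuous_actTup_uncurry.comp (hh.prodMk continuous_const)

theorem actTup_toG_diagTup (γ : SpecialLinearGroup (Fin d) S.Zs) (z : Fin n → Fin d → S.Zs) :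
    actTup (S.toG d γ) (S.diagTup z) = S.diagTup fun a => γ.1.mulVec (z a) := by
  ext
  · simp [actTup, toG, diagTup, mulVec, dotProduct]
  · simp [actTup, toG, diagTup, mulVec, dotProduct]
    rfl

/-- The permutation of `S`-integral tuples given by an element of `SL_d(ℤ_S)`. -/
def tupPerm (n : ℕ) (γ : SpecialLinearGroup (Fin d) S.Zs) :
    Equiv.Perm (Fin n → Fin d → S.Zs) where
  toFun z a := γ.1.mulVec (z a)
  invFun z a := γ.1.adjugate.mulVec (z a)
  left_inv z := by
    ext1 a
    change γ.1.adjugate.mulVec (γ.1.mulVec (z a)) = z a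
    rw [mulVec_mulVec, adjugate_mul, γ.2, one_smul, one_mulVec]
  right_inv z := by
    ext1 a
    change γ.1.mulVec (γ.1.adjugate.mulVec (z a)) = z a
    rw [mulVec_mulVec, mul_adjugate, γ.2, one_smul, one_mulVec]

/-- The sum of `f` over the tuples of a set `Z` of integral tuples transported by a coset. -/
noncomputable def latticeSum (Z : Set (Fin n → Fin d → S.Zs)) (f : S.Tup n d → ℝ≥0∞)
    (y : S.G d ⧸ S.Gamma d) : ℝ≥0∞ :=
  ∑' z, Z.indicator (fun z => f (actTup y.out (S.diagTup z))) z

theorem latticeSum_mk {Z : Set (Fin n → Fin d → S.Zs)}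
    (hZ : ∀ γ z, tupPerm n γ z ∈ Z ↔ z ∈ Z) (f : S.Tup n d → ℝ≥0∞) (g : S.G d) :
    latticeSum Z f (QuotientGroup.mk g) =
      ∑' z, Z.indicator (fun z => f (actTup g (S.diagTup z))) z := by
  obtain ⟨⟨_, γ, rfl⟩, hγ⟩ := QuotientGroup.mk_out_eq_mul (S.Gamma d) g
  rw [latticeSum, hγ,
    ← (tupPerm n γ).tsum_eq (Z.indicator fun z => f (actTup g (S.diagTup z)))]
  refine tsum_congr fun z => ?_
  by_cases hz : z ∈ Z
  · rw [Set.indicator_of_mem hz, Set.indicator_of_mem ((hZ γ z).2 hz), actTup_mul,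
      actTup_toG_diagTup]
    rfl
  · rw [Set.indicator_of_notMem hz, Set.indicator_of_notMem fun h => hz ((hZ γ z).1 h)]

theorem measurable_latticeSum {Z : Set (Fin n → Fin d → S.Zs)}
    (hZ : ∀ γ z, tupPerm n γ z ∈ Z ↔ z ∈ Z) {f : S.Tup n d → ℝ≥0∞} (hf : Measurable f) :
    Measurable (latticeSum Z f) := by
  rw [QuotientGroup.measurable_from_quotient]
  have : latticeSum Z f ∘ ((↑) : S.G d → S.G d ⧸ S.Gamma d) = fun g =>
      ∑' z, Z.indicator (fun z => f (actTup g (S.diagTup z))) z :=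
    funext fun g => latticeSum_mk hZ f g
  rw [this]
  refine Measurable.tsum fun z => ?_
  by_cases hz : z ∈ Z
  · simp only [Set.indicator_of_mem hz]
    exact hf.comp (measurable_actTup_left _)
  · simp only [Set.indicator_of_notMem hz]
    exact measurable_const

/-- The random measure carried by the tuples of `Z`. -/
noncomputable def latticeMeasure (Z : Set (Fin n → Fin d → S.Zs)) (y : S.G d ⧸ S.Gamma d) :
    Measure (S.Tup n d) :=
  Measure.sum fun z : Z => Measure.dirac (actTup y.out (S.diagTup z))

theorem lintegral_latticeMeasure (Z : Set (Fin n → Fin d → S.Zs)) {f : S.Tup n d → ℝ≥0∞}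
    (hf : Measurable f) (y : S.G d ⧸ S.Gamma d) :
    ∫⁻ x, f x ∂(latticeMeasure Z y) = latticeSum Z f y := by
  rw [latticeMeasure, lintegral_sum_measure, latticeSum, ← tsum_subtype]
  exact tsum_congr fun z => lintegral_dirac' _ hf

theorem measurable_latticeMeasure {Z : Set (Fin n → Fin d → S.Zs)}
    (hZ : ∀ γ z, tupPerm n γ z ∈ Z ↔ z ∈ Z) : Measurable (latticeMeasure Z) := by
  refine Measure.measurable_of_measurable_coe _ fun E hE => ?_
  have : ∀ y, latticeMeasure Z y E = latticeSum Z (E.indicator 1) y := fun y => by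
    rw [← lintegral_indicator_one hE, lintegral_latticeMeasure Z (measurable_one.indicator hE)]
  simp only [this]
  exact measurable_latticeSum hZ (measurable_one.indicator hE)

/-- The intensity measure of the random set of tuples of `Z`. -/
noncomputable def siegelMeasure (μ : Measure (S.G d ⧸ S.Gamma d))
    (Z : Set (Fin n → Fin d → S.Zs)) : Measure (S.Tup n d) :=
  μ.bind (latticeMeasure Z)

theorem lintegral_siegelMeasure (μ : Measure (S.G d ⧸ S.Gamma d))
    {Z : Set (Fin n → Fin d → S.Zs)} (hZ : ∀ γ z, tupPerm n γ z ∈ Z ↔ z ∈ Z)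
    {f : S.Tup n d → ℝ≥0∞} (hf : Measurable f) :
    ∫⁻ x, f x ∂(siegelMeasure μ Z) = ∫⁻ y, latticeSum Z f y ∂μ := by
  rw [siegelMeasure, Measure.lintegral_bind (measurable_latticeMeasure hZ).aemeasurable
    hf.aemeasurable]
  simp only [lintegral_latticeMeasure Z hf]

theorem measurable_smul_quotient (c : S.G d) :
    Measurable fun y : S.G d ⧸ S.Gamma d => c • y := by
  rw [QuotientGroup.measurable_from_quotient]
  have h1 : Measurable fun g : S.G d => c * g := by
    refine Measurable.prodMk ?_ ?_
    · have hB : BorelSpace (SpecialLinearGroup (Fin d) ℝ) := ⟨rfl⟩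
      have h : Measurable fun A : SpecialLinearGroup (Fin d) ℝ => c.1 * A := by
        have hc : Continuous fun A : SpecialLinearGroup (Fin d) ℝ => c.1 * A := Continuous.subtype_mk
          (Continuous.matrix_mul continuous_const continuous_subtype_val) _
        exact hc.measurable
      exact h.comp measurable_fst
    · refine measurable_pi_lambda _ fun i => ?_
      have hB : BorelSpace (SpecialLinearGroup (Fin d) (S.Qp i)) := ⟨rfl⟩
      have h : Measurable fun A : SpecialLinearGroup (Fin d) (S.Qp i) => c.2 i * A := by
        have hc : Continuous fun A : SpecialLinearGroup (Fin d) (S.Qp i) => c.2 i * A := Continuous.subtype_mk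
          (Continuous.matrix_mul continuous_const continuous_subtype_val) _
        exact hc.measurable
      exact h.comp ((measurable_pi_apply i).comp measurable_snd)
  have h2 : Measurable fun g : S.G d => (QuotientGroup.mk g : S.G d ⧸ S.Gamma d) :=
    measurable_quotient_mk''
  exact h2.comp h1

theorem lintegral_smul_quotient {μ : Measure (S.G d ⧸ S.Gamma d)}
    (hμ : SMulInvariantMeasure (S.G d) (S.G d ⧸ S.Gamma d) μ) (c : S.G d)
    {f : S.G d ⧸ S.Gamma d → ℝ≥0∞} (hf : Measurable f) :
    ∫⁻ y, f (c • y) ∂μ = ∫⁻ y, f y ∂μ := by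
  have h : Measure.map (fun y => c • y) μ = μ := by
    ext E hE
    rw [Measure.map_apply (measurable_smul_quotient c) hE]
    exact hμ.measure_preimage_smul c hE
  conv_rhs => rw [← h]
  rw [lintegral_map hf (measurable_smul_quotient c)]

end PrimeTup

namespace PrimeTup

attribute [local instance] Padic.measureSpace Padic.isAddHaarMeasure_volume
  isAddHaarMeasure_volume_tup

variable {S : PrimeTup} {n d : ℕ}

section

variable {e : Fin n → Fin d} {k : Fin d} {ρ : (Fin n → ℝ) → ℝ} {φ : S.Tup n d → ℝ}
  {μ : Measure (S.G d ⧸ S.Gamma d)}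

theorem tupPerm_mem_univ (γ : SpecialLinearGroup (Fin d) S.Zs) (z : Fin n → Fin d → S.Zs) :
    tupPerm n γ z ∈ (Set.univ : Set (Fin n → Fin d → S.Zs)) ↔ z ∈ Set.univ := by simp

theorem latticeSum_univ_mk (f : S.Tup n d → ℝ≥0∞) (g : S.G d) :
    latticeSum Set.univ f (QuotientGroup.mk g) = ∑' z, f (actTup g (S.diagTup z)) := by
  rw [latticeSum_mk tupPerm_mem_univ]
  simp

theorem measurable_latticeSum_smul {h : (Fin n → ℝ) → S.G d} (hh : Continuous h)
    (hφ : Continuous φ) (hφc : HasCompactSupport φ) :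
    Measurable fun q : (Fin n → ℝ) × (S.G d ⧸ S.Gamma d) =>
      latticeSum Set.univ (fun x => ENNReal.ofReal (φ x)) (h q.1 • q.2) := by
  refine measurable_uncurry_of_continuous_of_measurable
    (u := fun s y => latticeSum Set.univ (fun x => ENNReal.ofReal (φ x)) (h s • y)) ?_ ?_
  · intro y
    induction y using QuotientGroup.induction_on with
    | H g =>
      have h1 : ∀ s, latticeSum Set.univ (fun x => ENNReal.ofReal (φ x))
          (h s • (QuotientGroup.mk g : S.G d ⧸ S.Gamma d)) =
          ∑' z, ENNReal.ofReal (φ (actTup (h s) (actTup g (S.diagTup z)))) := fun s => by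
        have h2 : h s • (QuotientGroup.mk g : S.G d ⧸ S.Gamma d) = QuotientGroup.mk (h s * g) :=
          rfl
        rw [h2, latticeSum_univ_mk]
        simp only [actTup_mul]
      simp only [h1]
      exact continuous_tsum_actTup hh hφ hφc g
  · exact fun s => (measurable_latticeSum tupPerm_mem_univ hφ.measurable.ennreal_ofReal).comp
      (measurable_smul_quotient _)

/-- The lattice sums of `φ` averaged over stretched shears converge to the integral of `φ`. -/
theorem tendsto_lintegral_latticeSum_smul (hk : ∀ a, e a ≠ k) (hφ : Continuous φ)
    (hφc : HasCompactSupport φ) (hρ : Continuous ρ) (hρ0 : ∀ s, 0 ≤ ρ s)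
    (hρc : HasCompactSupport ρ) (hρ1 : ∫⁻ s, ENNReal.ofReal (ρ s) = 1)
    (hdet : ∀ y ∈ tsupport φ, (realMinor e y).det ≠ 0) (y : S.G d ⧸ S.Gamma d) :
    Filter.Tendsto (fun t => ∫⁻ s, ENNReal.ofReal (ρ s) *
      latticeSum Set.univ (fun x => ENNReal.ofReal (φ x))
        (S.shearStretch hk (S.stretchRate_pos t).ne' s • y))
      Filter.atTop (nhds (∫⁻ y, ENNReal.ofReal (φ y))) := by
  induction y using QuotientGroup.induction_on with
  | H g =>
    refine (tendsto_lintegral_tsum_shearStretch hk hφ hφc hρ hρ0 hρc hρ1 hdet g).congr fun t => ?_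
    refine lintegral_congr fun s => ?_
    have h2 : S.shearStretch hk (S.stretchRate_pos t).ne' s •
        (QuotientGroup.mk g : S.G d ⧸ S.Gamma d) =
        QuotientGroup.mk (S.shearStretch hk (S.stretchRate_pos t).ne' s * g) := rfl
    rw [h2, latticeSum_univ_mk, ← ENNReal.tsum_mul_left]
    simp only [actTup_mul, ENNReal.ofReal_mul (hρ0 s)]

theorem lintegral_lintegral_smul [IsProbabilityMeasure μ]
    (hμ : SMulInvariantMeasure (S.G d) (S.G d ⧸ S.Gamma d) μ)
    {h : (Fin n → ℝ) → S.G d} {N : S.G d ⧸ S.Gamma d → ℝ≥0∞} (hN : Measurable N)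
    (hNh : Measurable fun q : (Fin n → ℝ) × (S.G d ⧸ S.Gamma d) => N (h q.1 • q.2))
    (hρ : Continuous ρ) (hρ1 : ∫⁻ s, ENNReal.ofReal (ρ s) = 1) :
    ∫⁻ y, (∫⁻ s, ENNReal.ofReal (ρ s) * N (h s • y)) ∂μ = ∫⁻ y, N y ∂μ := by
  rw [lintegral_lintegral_swap]
  · have h1 : ∀ s, ∫⁻ y, ENNReal.ofReal (ρ s) * N (h s • y) ∂μ =
        ENNReal.ofReal (ρ s) * ∫⁻ y, N y ∂μ := fun s => by
      rw [lintegral_const_mul' _ _ ENNReal.ofReal_ne_top, lintegral_smul_quotient hμ _ hN]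
    simp only [h1]
    rw [lintegral_mul_const _ hρ.measurable.ennreal_ofReal, hρ1, one_mul]
  · have h2 : Measurable fun q : (S.G d ⧸ S.Gamma d) × (Fin n → ℝ) =>
        ENNReal.ofReal (ρ q.2) * N (h q.2 • q.1) :=
      (hρ.measurable.ennreal_ofReal.comp measurable_snd).mul (hNh.comp measurable_swap)
    exact h2.aemeasurable

/-- If the averages of `N` over `h t` converge pointwise to a constant, then that constant is the
integral of `N`. -/
theorem lintegral_eq_of_tendsto_average [IsProbabilityMeasure μ]
    (hμ : SMulInvariantMeasure (S.G d) (S.G d ⧸ S.Gamma d) μ)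
    {h : ℕ → (Fin n → ℝ) → S.G d} {N : S.G d ⧸ S.Gamma d → ℝ≥0∞} {I : ℝ≥0∞} (hN : Measurable N)
    (hNh : ∀ t, Measurable fun q : (Fin n → ℝ) × (S.G d ⧸ S.Gamma d) => N (h t q.1 • q.2))
    (hρ : Continuous ρ) (hρ1 : ∫⁻ s, ENNReal.ofReal (ρ s) = 1)
    (hJt : ∀ y, Filter.Tendsto (fun t => ∫⁻ s, ENNReal.ofReal (ρ s) * N (h t s • y))
      Filter.atTop (nhds I)) :
    ∫⁻ y, N y ∂μ = I := by
  have hJ : ∀ t, Measurable fun y => ∫⁻ s, ENNReal.ofReal (ρ s) * N (h t s • y) := fun t => by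
    have h2 : Measurable fun q : (S.G d ⧸ S.Gamma d) × (Fin n → ℝ) =>
        ENNReal.ofReal (ρ q.2) * N (h t q.2 • q.1) :=
      (hρ.measurable.ennreal_ofReal.comp measurable_snd).mul ((hNh t).comp measurable_swap)
    exact h2.lintegral_prod_right'
  refine le_antisymm ?_ ?_
  · have hmin : ∀ M : ℕ, ∫⁻ y, min (N y) M ∂μ ≤ I := fun M => by
      have hle : ∀ t, ∫⁻ y, min (N y) M ∂μ ≤
          ∫⁻ y, min (∫⁻ s, ENNReal.ofReal (ρ s) * N (h t s • y)) M ∂μ := fun t => by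
        rw [← lintegral_lintegral_smul hμ (h := h t) (hN.min measurable_const)
          ((hNh t).min measurable_const) hρ hρ1]
        refine lintegral_mono fun y => le_min ?_ ?_
        · exact lintegral_mono fun s => by gcongr; exact min_le_left _ _
        · calc ∫⁻ s, ENNReal.ofReal (ρ s) * min (N (h t s • y)) M
              ≤ ∫⁻ s, ENNReal.ofReal (ρ s) * M :=
                lintegral_mono fun s => by gcongr; exact min_le_right _ _
            _ = M := by rw [lintegral_mul_const _ hρ.measurable.ennreal_ofReal, hρ1, one_mul]
      have hlim : Filter.Tendsto (fun t =>
          ∫⁻ y, min (∫⁻ s, ENNReal.ofReal (ρ s) * N (h t s • y)) M ∂μ) Filter.atTop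
          (nhds (∫⁻ _y, min I M ∂μ)) := by
        refine tendsto_lintegral_of_dominated_convergence (fun _ => (M : ℝ≥0∞))
          (fun t => (hJ t).min measurable_const)
          (fun t => Filter.Eventually.of_forall fun y => min_le_right _ _) (by simp)
          (Filter.Eventually.of_forall fun y => (hJt y).min tendsto_const_nhds)
      refine (ge_of_tendsto' hlim hle).trans ?_
      rw [lintegral_const, measure_univ, mul_one]
      exact min_le_left _ _
    have hsup : ∀ y, N y = ⨆ M : ℕ, min (N y) M := fun y => by
      rw [← inf_iSup_eq, ENNReal.iSup_natCast, inf_top_eq]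
    calc ∫⁻ y, N y ∂μ = ∫⁻ y, ⨆ M : ℕ, min (N y) M ∂μ := lintegral_congr hsup
      _ = ⨆ M : ℕ, ∫⁻ y, min (N y) M ∂μ := by
          refine lintegral_iSup (fun M => hN.min measurable_const) fun a b hab y => ?_
          exact min_le_min le_rfl (by exact_mod_cast hab)
      _ ≤ I := iSup_le hmin
  · calc I = ∫⁻ y, Filter.liminf (fun t => ∫⁻ s, ENNReal.ofReal (ρ s) * N (h t s • y))
            Filter.atTop ∂μ := by
          simp only [fun y => (hJt y).liminf_eq]
          rw [lintegral_const, measure_univ, mul_one]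
      _ ≤ Filter.liminf (fun t => ∫⁻ y, (∫⁻ s, ENNReal.ofReal (ρ s) * N (h t s • y)) ∂μ)
            Filter.atTop := lintegral_liminf_le hJ
      _ = ∫⁻ y, N y ∂μ := by
          have h3 : ∀ t, ∫⁻ y, (∫⁻ s, ENNReal.ofReal (ρ s) * N (h t s • y)) ∂μ =
              ∫⁻ y, N y ∂μ := fun t => lintegral_lintegral_smul hμ hN (hNh t) hρ hρ1
          simp only [h3]
          exact tendsto_const_nhds.liminf_eq

theorem exists_continuous_density (n : ℕ) : ∃ ρ : (Fin n → ℝ) → ℝ, Continuous ρ ∧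
    (∀ s, 0 ≤ ρ s) ∧ HasCompactSupport ρ ∧ ∫⁻ s, ENNReal.ofReal (ρ s) = 1 := by
  let f : ContDiffBump (0 : Fin n → ℝ) := ⟨1, 2, one_pos, one_lt_two⟩
  refine ⟨f.normed volume, f.continuous_normed, f.nonneg_normed, f.hasCompactSupport_normed, ?_⟩
  rw [← ofReal_integral_eq_lintegral_ofReal f.integrable_normed
    (Filter.Eventually.of_forall f.nonneg_normed), f.integral_normed, ENNReal.ofReal_one]

/-- The mean value formula for test functions supported on tuples with a nonzero real minor. -/
theorem lintegral_latticeSum_eq_lintegral [IsProbabilityMeasure μ]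
    (hμ : SMulInvariantMeasure (S.G d) (S.G d ⧸ S.Gamma d) μ)
    (hk : ∀ a, e a ≠ k) (hφ : Continuous φ) (hφc : HasCompactSupport φ)
    (hdet : ∀ y ∈ tsupport φ, (realMinor e y).det ≠ 0) :
    ∫⁻ y, latticeSum Set.univ (fun x => ENNReal.ofReal (φ x)) y ∂μ =
      ∫⁻ y, ENNReal.ofReal (φ y) := by
  obtain ⟨ρ, hρ, hρ0, hρc, hρ1⟩ := exists_continuous_density n
  exact lintegral_eq_of_tendsto_average hμ
    (h := fun t => S.shearStretch hk (S.stretchRate_pos t).ne')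
    (measurable_latticeSum tupPerm_mem_univ hφ.measurable.ennreal_ofReal)
    (fun t => measurable_latticeSum_smul (continuous_shearStretch hk _) hφ hφc) hρ hρ1
    (tendsto_lintegral_latticeSum_smul hk hφ hφc hρ hρ0 hρc hρ1 hdet)

end

end PrimeTup

section RestrictEq

variable {X : Type*} [NormedAddCommGroup X]

/-- A cutoff function with support in `{f ≠ 0}`, increasing in `m` to the indicator. -/
def supportCutoff (f : X → ℝ) (m : ℕ) (x : X) : ℝ :=
  max 0 (min 1 (m * |f x| - 1)) * max 0 (min 1 (m - ‖x‖))

theorem continuous_supportCutoff {f : X → ℝ} (hf : Continuous f) (m : ℕ) :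
    Continuous (supportCutoff f m) := by
  unfold supportCutoff; fun_prop

theorem supportCutoff_nonneg (f : X → ℝ) (m : ℕ) (x : X) : 0 ≤ supportCutoff f m x :=
  mul_nonneg (le_max_left _ _) (le_max_left _ _)

theorem monotone_supportCutoff (f : X → ℝ) (x : X) : Monotone fun m => supportCutoff f m x := by
  intro a b hab
  have hab' : (a : ℝ) ≤ b := by exact_mod_cast hab
  have h1 : (a : ℝ) * |f x| ≤ b * |f x| := mul_le_mul_of_nonneg_right hab' (abs_nonneg _)
  exact mul_le_mul (max_le_max le_rfl (min_le_min le_rfl (by linarith)))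
    (max_le_max le_rfl (min_le_min le_rfl (by linarith))) (le_max_left _ _) (le_max_left _ _)

theorem exists_supportCutoff_eq_one {f : X → ℝ} {x : X} (hx : f x ≠ 0) :
    ∃ m, supportCutoff f m x = 1 := by
  obtain ⟨m, hm⟩ := exists_nat_ge (max (2 / |f x|) (‖x‖ + 1))
  have h0 : 0 < |f x| := abs_pos.2 hx
  have h1 : 2 ≤ m * |f x| := (div_le_iff₀ h0).1 ((le_max_left _ _).trans hm)
  have h2 : ‖x‖ + 1 ≤ m := (le_max_right _ _).trans hm
  refine ⟨m, ?_⟩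
  unfold supportCutoff
  rw [min_eq_left (by linarith), min_eq_left (by linarith)]
  simp

theorem supportCutoff_le_one (f : X → ℝ) (m : ℕ) (x : X) : supportCutoff f m x ≤ 1 :=
  mul_le_one₀ (max_le zero_le_one (min_le_left _ _)) (le_max_left _ _)
    (max_le zero_le_one (min_le_left _ _))

theorem supportCutoff_ne_zero {f : X → ℝ} {m : ℕ} {x : X} (hx : supportCutoff f m x ≠ 0) :
    1 ≤ m * |f x| ∧ ‖x‖ ≤ m := by
  by_contra h
  apply hx
  rw [not_and_or, not_le, not_le] at h
  unfold supportCutoff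
  rcases h with h | h
  · rw [max_eq_left ((min_le_right _ _).trans (by linarith)), zero_mul]
  · rw [max_eq_left ((min_le_right _ _).trans (by linarith) : min 1 ((m : ℝ) - ‖x‖) ≤ 0), mul_zero]

theorem tsupport_supportCutoff_subset {f : X → ℝ} (hf : Continuous f) (m : ℕ) :
    tsupport (supportCutoff f m) ⊆ {x | 1 ≤ m * |f x| ∧ ‖x‖ ≤ m} := by
  refine closure_minimal (fun x hx => supportCutoff_ne_zero hx) ?_
  have h1 : IsClosed {x | 1 ≤ m * |f x|} :=
    isClosed_le continuous_const (continuous_const.mul hf.abs)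
  exact h1.inter (isClosed_le continuous_norm continuous_const)

theorem hasCompactSupport_supportCutoff [ProperSpace X] (f : X → ℝ) (m : ℕ) :
    HasCompactSupport (supportCutoff f m) := by
  refine HasCompactSupport.of_support_subset_isCompact (isCompact_closedBall (0 : X) m) ?_
  intro x hx
  simpa using (supportCutoff_ne_zero hx).2

variable [ProperSpace X] [MeasurableSpace X] [BorelSpace X]

/-- Measures agreeing on compactly supported test functions in `{f ≠ 0}` agree on `{f ≠ 0}`. -/
theorem MeasureTheory.Measure.restrict_eq_of_forall_lintegral_eq {f : X → ℝ} (hf : Continuous f)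
    {ν l : Measure X} [IsFiniteMeasureOnCompacts l]
    (h : ∀ φ : X → ℝ, Continuous φ → HasCompactSupport φ → (∀ x ∈ tsupport φ, f x ≠ 0) →
      ∫⁻ x, ENNReal.ofReal (φ x) ∂ν = ∫⁻ x, ENNReal.ofReal (φ x) ∂l) :
    ν.restrict {x | f x ≠ 0} = l.restrict {x | f x ≠ 0} := by
  set w : ℕ → X → ℝ≥0∞ := fun m x => ENNReal.ofReal (supportCutoff f m x) with hw
  have hwm : ∀ m, Measurable (w m) := fun m =>
    (continuous_supportCutoff hf m).measurable.ennreal_ofReal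
  have hts : ∀ m, ∀ x ∈ tsupport (supportCutoff f m), f x ≠ 0 := fun m x hx h0 => by
    have := (tsupport_supportCutoff_subset hf m hx).1
    simp [h0] at this
    linarith
  have hmass : ∀ m, ∫⁻ x, w m x ∂ν = ∫⁻ x, w m x ∂l := fun m =>
    h _ (continuous_supportCutoff hf m) (hasCompactSupport_supportCutoff f m) (hts m)
  have hfin : ∀ m, ∫⁻ x, w m x ∂l ≠ ⊤ := fun m =>
    ((continuous_supportCutoff hf m).integrable_of_hasCompactSupport
      (hasCompactSupport_supportCutoff f m)).lintegral_lt_top.ne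
  have heq : ∀ m, ν.withDensity (w m) = l.withDensity (w m) := fun m => by
    have i1 : IsFiniteMeasure (ν.withDensity (w m)) :=
      isFiniteMeasure_withDensity (by rw [hmass m]; exact hfin m)
    have i2 : IsFiniteMeasure (l.withDensity (w m)) := isFiniteMeasure_withDensity (hfin m)
    refine ext_of_forall_lintegral_eq_of_IsFiniteMeasure fun ψ => ?_
    have hψ : Continuous fun x => (ψ x : ℝ) := by fun_prop
    have hψm : Measurable fun x => (ψ x : ℝ≥0∞) := by fun_prop
    rw [lintegral_withDensity_eq_lintegral_mul _ (hwm m) hψm,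
      lintegral_withDensity_eq_lintegral_mul _ (hwm m) hψm]
    have e1 : ∀ x, (w m * fun x => (ψ x : ℝ≥0∞)) x =
        ENNReal.ofReal (supportCutoff f m x * ψ x) := fun x => by
      simp [hw, ENNReal.ofReal_mul (supportCutoff_nonneg f m x)]
    simp only [e1]
    refine h _ ((continuous_supportCutoff hf m).mul hψ)
      (hasCompactSupport_supportCutoff f m).mul_right fun x hx => hts m x ?_
    exact tsupport_mul_subset_left hx
  have key : ∀ (κ : Measure X) {E : Set X}, MeasurableSet E → E ⊆ {x | f x ≠ 0} →
      κ E = ⨆ m, κ.withDensity (w m) E := fun κ E hE hEf => by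
    simp only [withDensity_apply _ hE]
    rw [← lintegral_iSup hwm fun a b hab x =>
      ENNReal.ofReal_le_ofReal (monotone_supportCutoff f x hab), ← setLIntegral_one]
    refine setLIntegral_congr_fun hE fun x hx => ?_
    refine le_antisymm ?_ (iSup_le fun m => ?_)
    · obtain ⟨m, hm⟩ := exists_supportCutoff_eq_one (hEf hx)
      exact le_iSup_of_le m (by simp [hw, hm])
    · exact ENNReal.ofReal_le_one.2 (supportCutoff_le_one f m x)
  have hΩ : MeasurableSet {x | f x ≠ 0} := (isOpen_ne_fun hf continuous_const).measurableSet
  ext E hE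
  rw [Measure.restrict_apply hE, Measure.restrict_apply hE,
    key ν (hE.inter hΩ) Set.inter_subset_right, key l (hE.inter hΩ) Set.inter_subset_right]
  simp only [heq]

end RestrictEq

namespace PrimeTup

attribute [local instance] Padic.measureSpace Padic.isAddHaarMeasure_volume
  isAddHaarMeasure_volume_tup

variable {S : PrimeTup} {n d : ℕ} {μ : Measure (S.G d ⧸ S.Gamma d)}

theorem siegelMeasure_restrict_realMinor [IsProbabilityMeasure μ]
    (hμ : SMulInvariantMeasure (S.G d) (S.G d ⧸ S.Gamma d) μ) {e : Fin n → Fin d} {k : Fin d}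
    (hk : ∀ a, e a ≠ k) :
    (siegelMeasure μ (Set.univ : Set (Fin n → Fin d → S.Zs))).restrict
        {y | (realMinor e y).det ≠ 0} =
      (volume : Measure (S.Tup n d)).restrict {y | (realMinor e y).det ≠ 0} := by
  refine Measure.restrict_eq_of_forall_lintegral_eq (continuous_realMinor e).matrix_det
    fun φ hφ hφc hdet => ?_
  rw [lintegral_siegelMeasure μ tupPerm_mem_univ hφ.measurable.ennreal_ofReal]
  exact lintegral_latticeSum_eq_lintegral hμ hk hφ hφc hdet

/-- The tuples whose real parts are linearly independent. -/
def realIndep (S : PrimeTup) (n d : ℕ) : Set (S.Tup n d) :=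
  ⋃ e : Fin n → Fin d, {y | (realMinor e y).det ≠ 0}

theorem isOpen_realIndep : IsOpen (S.realIndep n d) :=
  isOpen_iUnion fun e => isOpen_ne_fun (continuous_realMinor e).matrix_det continuous_const

/-- The mean value formula on tuples with linearly independent real parts. -/
theorem siegelMeasure_restrict_realIndep [IsProbabilityMeasure μ]
    (hμ : SMulInvariantMeasure (S.G d) (S.G d ⧸ S.Gamma d) μ) (hnd : n < d) :
    (siegelMeasure μ (Set.univ : Set (Fin n → Fin d → S.Zs))).restrict (S.realIndep n d) =
      (volume : Measure (S.Tup n d)).restrict (S.realIndep n d) := by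
  rw [realIndep, Measure.restrict_iUnion_congr]
  intro e
  have h1 : ∃ k, ∀ a, e a ≠ k := by
    by_contra h
    push Not at h
    have h2 := Fintype.card_le_of_surjective e h
    simp at h2
    omega
  obtain ⟨k, hk⟩ := h1
  exact siegelMeasure_restrict_realMinor hμ hk

end PrimeTup

namespace Matrix

variable {d : ℕ}

theorem sum_natAbs_transvection_mulVec_lt {i j : Fin d} (hij : i ≠ j) {c : ℤ} {w : Fin d → ℤ}
    (h : (w i + c * w j).natAbs < (w i).natAbs) :
    ∑ k, ((transvection i j c *ᵥ w) k).natAbs < ∑ k, (w k).natAbs := by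
  have h1 : ∀ k, (transvection i j c *ᵥ w) k = w k + if k = i then c * w j else 0 := fun k => by
    rw [transvection, add_mulVec, one_mulVec, Pi.add_apply, single_mulVec]
    by_cases hk : k = i
    · subst hk; simp
    · simp [hk]
  refine Finset.sum_lt_sum (fun k _ => ?_) ⟨i, Finset.mem_univ i, ?_⟩
  · rw [h1]
    split_ifs with hk
    · subst hk; exact h.le
    · simp
  · rw [h1, if_pos rfl]; exact h

/-- Every integral vector can be moved to a coordinate axis by an integral matrix of
determinant one. -/
theorem exists_mulVec_eq_single (u : Fin d → ℤ) (i₀ : Fin d) :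
    ∃ (γ : SpecialLinearGroup (Fin d) ℤ) (c : ℤ), γ.1 *ᵥ u = Pi.single i₀ c := by
  have key : ∀ (N : ℕ) (u : Fin d → ℤ), ∑ k, (u k).natAbs ≤ N →
      ∃ (γ : SpecialLinearGroup (Fin d) ℤ) (c : ℤ) (i : Fin d), γ.1 *ᵥ u = Pi.single i c := by
    intro N
    induction N with
    | zero =>
      intro u hu
      refine ⟨1, 0, i₀, ?_⟩
      have : u = 0 := by
        ext k
        have := Finset.single_le_sum (f := fun k => (u k).natAbs) (fun _ _ => Nat.zero_le _)
          (Finset.mem_univ k)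
        simp only [Pi.zero_apply]
        omega
      simp [this]
    | succ N ih =>
      intro u hu
      by_cases hu2 : ∃ i j, i ≠ j ∧ u i ≠ 0 ∧ u j ≠ 0
      · have h1 : ∃ i j, i ≠ j ∧ u j ≠ 0 ∧ (u j).natAbs ≤ (u i).natAbs := by
          obtain ⟨i, j, hij, hi, hj⟩ := hu2
          rcases le_total (u j).natAbs (u i).natAbs with h | h
          · exact ⟨i, j, hij, hj, h⟩
          · exact ⟨j, i, hij.symm, hi, h⟩
        obtain ⟨i, j, hij, hj, hle⟩ := h1
        have h2 : ∃ c : ℤ, (u i + c * u j).natAbs < (u i).natAbs := by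
          rcases le_total 0 (u i) with h3 | h3 <;> rcases le_total 0 (u j) with h4 | h4
          · exact ⟨-1, by omega⟩
          · exact ⟨1, by omega⟩
          · exact ⟨1, by omega⟩
          · exact ⟨-1, by omega⟩
        obtain ⟨c, hc⟩ := h2
        obtain ⟨γ, c', i', h⟩ := ih (transvection i j c *ᵥ u) (by
          have := sum_natAbs_transvection_mulVec_lt hij hc
          omega)
        refine ⟨γ * SpecialLinearGroup.transvection hij c, c', i', ?_⟩
        rw [← h, SpecialLinearGroup.coe_mul, ← mulVec_mulVec]
        rfl
      · push Not at hu2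
        by_cases h0 : ∃ i, u i ≠ 0
        · obtain ⟨i, hi⟩ := h0
          refine ⟨1, u i, i, ?_⟩
          ext k
          by_cases hk : k = i
          · subst hk; simp
          · simp [hk, hu2 i k (Ne.symm hk) hi]
        · push Not at h0
          refine ⟨1, 0, i₀, ?_⟩
          have : u = 0 := funext h0
          simp [this]
  obtain ⟨γ, c, i, h⟩ := key _ u le_rfl
  by_cases hi : i = i₀
  · exact ⟨γ, c, hi ▸ h⟩
  · refine ⟨SpecialLinearGroup.transvection hi (-1) * SpecialLinearGroup.transvection (Ne.symm hi) 1 * γ, c, ?_⟩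
    rw [SpecialLinearGroup.coe_mul, SpecialLinearGroup.coe_mul, ← mulVec_mulVec, ← mulVec_mulVec, h]
    ext k
    simp only [SpecialLinearGroup.transvection, transvection, add_mulVec, one_mulVec, single_mulVec, Pi.add_apply]
    by_cases hk : k = i
    · subst hk; simp [hi, Ne.symm hi]
    · by_cases hk' : k = i₀
      · subst hk'; simp [Ne.symm hi]
      · simp [hk, hk', Ne.symm hi]

end Matrix

namespace PrimeTup

variable {S : PrimeTup} {d : ℕ}

theorem exists_mul_unit (S : PrimeTup) {q : S.Zs} (hq : q ≠ 0) :
    ∃ m ∈ S.NS, ∃ u : S.Zsˣ, q = (m : S.Zs) * u := by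
  have hP0 : (S.primeProd : ℚ) ≠ 0 := by exact_mod_cast S.primeProd_pos.ne'
  have hPu : IsUnit (S.primeProd : S.Zs) :=
    IsUnit.of_mul_eq_one ⟨_, S.inv_primeProd_mem_Zs⟩ (by ext; simp [hP0])
  have hpu : ∀ i, IsUnit (S.p i : S.Zs) := fun i =>
    IsUnit.of_mul_eq_one ⟨_, S.inv_prime_mem_Zs i⟩ (by
      ext
      have : (S.p i : ℚ) ≠ 0 := by exact_mod_cast (S.hp i).ne_zero
      simp [this])
  have hex : ∃ m : ℕ, 0 < m ∧ ∃ u : S.Zsˣ, q = (m : S.Zs) * u := by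
    obtain ⟨N, c, hc⟩ := S.exists_primeProd_pow_mul_eq_int q.2
    obtain ⟨P, hP⟩ := hPu
    have hc' : (P : S.Zs) ^ N * q = (c : S.Zs) := by
      rw [hP]; ext; simpa using hc
    have hc0 : c ≠ 0 := by
      rintro rfl
      rw [Int.cast_zero, mul_eq_zero] at hc'
      exact hc'.elim ((P ^ N).ne_zero) hq
    refine ⟨c.natAbs, Int.natAbs_pos.2 hc0, P⁻¹ ^ N * Units.map (Int.castRingHom S.Zs).toMonoidHom
      (if 0 ≤ c then 1 else -1), ?_⟩
    have h1 : ((c.natAbs : ℕ) : S.Zs) *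
        (Units.map (Int.castRingHom S.Zs).toMonoidHom (if 0 ≤ c then 1 else -1) : S.Zsˣ) = c := by
      split_ifs with h
      · obtain ⟨n, rfl⟩ := Int.eq_ofNat_of_zero_le h
        simp
      · obtain ⟨n, hn⟩ := Int.eq_ofNat_of_zero_le (show 0 ≤ -c by omega)
        obtain rfl : c = -n := by omega
        simp
    rw [Units.val_mul, mul_left_comm, h1, ← hc', Units.val_pow_eq_pow_val, ← mul_assoc, ← mul_pow,
      Units.inv_mul, one_pow, one_mul]
  classical
  obtain ⟨hm, u, hu⟩ := Nat.find_spec hex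
  refine ⟨Nat.find hex, ⟨hm, fun i hi => ?_⟩, u, hu⟩
  obtain ⟨k, hk⟩ := hi
  obtain ⟨p, hp⟩ := hpu i
  have hk0 : 0 < k := Nat.pos_of_ne_zero fun h => by rw [h] at hk; omega
  refine Nat.find_min hex (m := k) ?_ ⟨hk0, p * u, ?_⟩
  · rw [hk]; exact lt_mul_of_one_lt_left hk0 (S.hp i).one_lt
  · rw [hu, hk, Units.val_mul, hp]; push_cast; ring

theorem dvd_of_Zs_mul_eq (S : PrimeTup) {m m' : ℕ} (hm' : m' ∈ S.NS) {q : S.Zs}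
    (h : (m : S.Zs) = m' * q) : m' ∣ m := by
  have h' : (m : ℚ) = m' * (q : ℚ) := by
    have := congrArg (Subtype.val : S.Zs → ℚ) h
    simpa using this
  have h0 : (m' : ℚ) ≠ 0 := by exact_mod_cast hm'.1.ne'
  have hden : (q : ℚ).den = 1 := by
    by_contra hne
    obtain ⟨l, hl, hld⟩ := Nat.exists_prime_and_dvd hne
    obtain ⟨i, rfl⟩ := S.eq_prime_of_dvd_den q.2 hl hld
    refine hm'.2 i (hld.trans ?_)
    have h1 : (q : ℚ) = Rat.divInt m (m' : ℤ) := by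
      rw [Rat.divInt_eq_div, _root_.eq_div_iff (by exact_mod_cast hm'.1.ne'), mul_comm]
      exact_mod_cast h'.symm
    have := Rat.den_dvd m (m' : ℤ)
    rw [← h1] at this
    exact_mod_cast this
  have h2 : (q : ℚ) = (q : ℚ).num := ((Rat.den_eq_one_iff _).1 hden).symm
  rw [h2] at h'
  have h3 : (m : ℤ) = m' * (q : ℚ).num := by exact_mod_cast h'
  exact Int.natCast_dvd_natCast.1 ⟨_, h3⟩

end PrimeTup

namespace PrimeTup

variable {S : PrimeTup} {d : ℕ}

theorem e1_eq_single (hd : 0 < d) : S.e1 d = Pi.single ⟨0, hd⟩ 1 := by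
  ext j
  by_cases hj : j = ⟨0, hd⟩
  · subst hj; simp [e1]
  · have : j.1 ≠ 0 := fun h => hj (Fin.ext h)
    simp [e1, hj, this]

theorem mul_val_mulVec (γ δ : SpecialLinearGroup (Fin d) S.Zs) (w : Fin d → S.Zs) :
    (γ * δ).1 *ᵥ w = γ.1 *ᵥ (δ.1 *ᵥ w) := by
  rw [mulVec_mulVec]; rfl

theorem inv_val_mulVec_mulVec (γ : SpecialLinearGroup (Fin d) S.Zs) (w : Fin d → S.Zs) :
    (γ⁻¹).1 *ᵥ (γ.1 *ᵥ w) = w := by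
  rw [← mul_val_mulVec, inv_mul_cancel]
  exact one_mulVec w

theorem mulVec_mem_primZs_iff (γ : SpecialLinearGroup (Fin d) S.Zs) (v : Fin d → S.Zs) :
    γ.1 *ᵥ v ∈ S.primZs d ↔ v ∈ S.primZs d := by
  have h : ∀ (δ : SpecialLinearGroup (Fin d) S.Zs) (w : Fin d → S.Zs), w ∈ S.primZs d →
      δ.1 *ᵥ w ∈ S.primZs d := by
    rintro δ w ⟨η, rfl⟩
    exact ⟨δ * η, (mul_val_mulVec _ _ _).symm⟩
  refine ⟨fun hv => ?_, h γ v⟩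
  have := h γ⁻¹ _ hv
  rwa [inv_val_mulVec_mulVec] at this

/-- A primitive vector has a unimodular dual vector. -/
theorem exists_dotProduct_eq_one (hd : 0 < d) {v : Fin d → S.Zs} (hv : v ∈ S.primZs d) :
    ∃ r : Fin d → S.Zs, r ⬝ᵥ v = 1 := by
  obtain ⟨γ, rfl⟩ := hv
  refine ⟨(γ⁻¹).1 ⟨0, hd⟩, ?_⟩
  have h : (γ⁻¹).1 *ᵥ (γ.1 *ᵥ S.e1 d) = S.e1 d :=
    inv_val_mulVec_mulVec _ _
  have h2 := congrFun h ⟨0, hd⟩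
  rw [e1_eq_single hd, Pi.single_eq_same, ← e1_eq_single hd] at h2
  exact h2

/-- A diagonal matrix of determinant one scaling the first coordinate by a unit. -/
theorem exists_mulVec_e1_eq_smul (hd : 2 ≤ d) (u : S.Zsˣ) :
    ∃ γ : SpecialLinearGroup (Fin d) S.Zs, γ.1 *ᵥ S.e1 d = (u : S.Zs) • S.e1 d := by
  obtain ⟨k, rfl⟩ := Nat.exists_eq_add_of_le' hd
  refine ⟨⟨diagonal (Fin.cons (u : S.Zs) (Fin.cons ((u⁻¹ : S.Zsˣ) : S.Zs) fun _ => 1)), ?_⟩, ?_⟩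
  · rw [det_diagonal, Fin.prod_univ_succ, Fin.prod_univ_succ]
    simp
  · ext1 j
    rw [mulVec_diagonal]
    refine Fin.cases ?_ (fun i => ?_) j
    · simp
    · simp [e1]

theorem exists_primZs_smul (hd : 2 ≤ d) {z : Fin d → S.Zs} (hz : z ≠ 0) :
    ∃ m ∈ S.NS, ∃ v ∈ S.primZs d, z = (m : S.Zs) • v := by
  have hd0 : 0 < d := by omega
  have hPu : IsUnit (S.primeProd : S.Zs) := by
    have hP0 : (S.primeProd : ℚ) ≠ 0 := by exact_mod_cast S.primeProd_pos.ne'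
    exact IsUnit.of_mul_eq_one ⟨_, S.inv_primeProd_mem_Zs⟩ (by ext; simp [hP0])
  have hinner : ∃ (N : ℕ) (x : Fin d → ℤ), ∀ j, (S.primeProd : S.Zs) ^ N * z j = x j := by
    choose N x hx using fun j => S.exists_primeProd_pow_mul_eq_int (z j).2
    refine ⟨∑ j, N j, fun j => S.primeProd ^ (∑ i ∈ Finset.univ.erase j, N i) * x j, fun j => ?_⟩
    ext
    push_cast
    rw [← hx, ← Finset.add_sum_erase _ _ (Finset.mem_univ j), pow_add]
    ring
  obtain ⟨N, x, hx⟩ := hinner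
  obtain ⟨γ, c, hγ⟩ := exists_mulVec_eq_single x ⟨0, hd0⟩
  set δ : SpecialLinearGroup (Fin d) S.Zs := SpecialLinearGroup.map (Int.castRingHom S.Zs) γ
  have hδ : δ.1 *ᵥ ((S.primeProd : S.Zs) ^ N • z) = (c : S.Zs) • S.e1 d := by
    have h1 : (S.primeProd : S.Zs) ^ N • z = fun j => Int.castRingHom S.Zs (x j) := by
      ext1 j
      simpa using hx j
    rw [h1]
    ext1 j
    have h2 := RingHom.map_mulVec (Int.castRingHom S.Zs) γ.1 x j
    rw [hγ] at h2
    refine h2.symm.trans ?_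
    rw [e1_eq_single hd0]
    by_cases hj : j = ⟨0, hd0⟩
    · subst hj; simp
    · simp [hj]
  obtain ⟨P, hP⟩ := hPu
  have hz' : δ.1 *ᵥ z = ((P⁻¹ ^ N : S.Zsˣ) * c : S.Zs) • S.e1 d := by
    rw [mul_smul, ← hδ, mulVec_smul, smul_smul, ← hP, ← Units.val_pow_eq_pow_val, ← Units.val_mul,
      inv_pow, inv_mul_cancel, Units.val_one, one_smul]
  have hz2 : z = (δ⁻¹).1 *ᵥ (δ.1 *ᵥ z) := (inv_val_mulVec_mulVec _ _).symm
  have hq : ((P⁻¹ ^ N : S.Zsˣ) * c : S.Zs) ≠ 0 := fun h => by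
    rw [hz', h, zero_smul, mulVec_zero] at hz2
    exact hz hz2
  obtain ⟨m, hm, u, hu⟩ := S.exists_mul_unit hq
  obtain ⟨η, hη⟩ := exists_mulVec_e1_eq_smul hd u
  refine ⟨m, hm, (δ⁻¹).1 *ᵥ (η.1 *ᵥ S.e1 d), ?_, ?_⟩
  · rw [mulVec_mem_primZs_iff]
    exact ⟨η, rfl⟩
  · rw [hη, ← mulVec_smul, smul_smul, ← hu, ← hz', ← hz2]

theorem primZs_smul_injective (hd : 0 < d) {m m' : ℕ} (hm : m ∈ S.NS) (hm' : m' ∈ S.NS)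
    {v v' : Fin d → S.Zs} (hv : v ∈ S.primZs d) (hv' : v' ∈ S.primZs d)
    (h : (m : S.Zs) • v = (m' : S.Zs) • v') : m = m' ∧ v = v' := by
  obtain ⟨r, hr⟩ := exists_dotProduct_eq_one hd hv
  obtain ⟨r', hr'⟩ := exists_dotProduct_eq_one hd hv'
  have h1 : m' ∣ m := S.dvd_of_Zs_mul_eq hm' (q := r ⬝ᵥ v') (by
    have := congrArg (r ⬝ᵥ ·) h
    simpa [dotProduct_smul, hr] using this)
  have h2 : m ∣ m' := S.dvd_of_Zs_mul_eq hm (q := r' ⬝ᵥ v) (by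
    have := congrArg (r' ⬝ᵥ ·) h.symm
    simpa [dotProduct_smul, hr'] using this)
  obtain rfl := Nat.dvd_antisymm h2 h1
  refine ⟨rfl, ?_⟩
  have h0 : (m : S.Zs) ≠ 0 := by exact_mod_cast hm.1.ne'
  exact smul_right_injective _ h0 h

theorem primZs_ne_zero (hd : 0 < d) {v : Fin d → S.Zs} (hv : v ∈ S.primZs d) : v ≠ 0 := by
  rintro rfl
  obtain ⟨r, hr⟩ := exists_dotProduct_eq_one hd hv
  simp at hr

theorem exists_unit_smul_eq_of_mul_eq (hd : 0 < d) {v w : Fin d → S.Zs} (hv : v ∈ S.primZs d)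
    (hw : w ∈ S.primZs d) (h : ∀ i j, v i * w j = v j * w i) :
    ∃ u : S.Zsˣ, w = (u : S.Zs) • v := by
  have key : ∀ {v w : Fin d → S.Zs} {r : Fin d → S.Zs}, r ⬝ᵥ v = 1 →
      (∀ i j, v i * w j = v j * w i) → w = (r ⬝ᵥ w) • v := by
    intro v w r hr h
    ext1 i
    calc w i = (r ⬝ᵥ v) * w i := by rw [hr, one_mul]
      _ = (r ⬝ᵥ w) * v i := by
        simp only [dotProduct, Finset.sum_mul]
        refine Finset.sum_congr rfl fun j _ => ?_
        rw [mul_assoc, ← h i j]; ring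
  obtain ⟨r, hr⟩ := exists_dotProduct_eq_one hd hv
  obtain ⟨r', hr'⟩ := exists_dotProduct_eq_one hd hw
  have h1 := key hr h
  have h2 : v = _ := key hr' fun i j => by rw [mul_comm (w i), mul_comm (w j), h j i]
  have h3 : (r ⬝ᵥ w) * (r' ⬝ᵥ v) = 1 := by
    have h4 := congrArg (r' ⬝ᵥ ·) h1
    simpa [dotProduct_smul, hr'] using h4.symm
  exact ⟨⟨_, _, h3, by rw [mul_comm, h3]⟩, h1⟩

end PrimeTup

namespace Matrix

theorem exists_det_submatrix_ne_zero {n d : ℕ} {Y : Fin n → Fin d → ℝ}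
    (hY : LinearIndependent ℝ Y) : ∃ e : Fin n → Fin d, (of fun b a => Y b (e a)).det ≠ 0 := by
  have hspan : Submodule.span ℝ (Set.range fun j b => Y b j) = ⊤ := by
    refine Submodule.eq_top_of_finrank_eq ?_
    have h1 := LinearIndependent.rank_matrix (M := of Y) hY
    rw [rank_eq_finrank_span_cols, Fintype.card_fin] at h1
    rw [Module.finrank_fin_fun]
    exact h1
  obtain ⟨b, hb, hbs, hbi⟩ := exists_linearIndependent ℝ (Set.range fun j b => Y b j)
  rw [hspan] at hbs
  let B := Module.Basis.mk hbi (by rw [Subtype.range_coe, hbs])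
  have hfin : Fintype b := FiniteDimensional.fintypeBasisIndex B
  have hcard : Fintype.card b = n := by
    have := Module.finrank_eq_card_basis B
    simpa using this.symm
  let ε : Fin n ≃ b := (Fintype.equivFinOfCardEq hcard).symm
  choose e he using fun a => hb (ε a).2
  refine ⟨e, ?_⟩
  have hli : LinearIndependent ℝ fun a : Fin n => ((ε a : b) : Fin n → ℝ) :=
    hbi.comp _ ε.injective
  have h2 : (of fun b a => Y b (e a)).col = fun a : Fin n => ((ε a : b) : Fin n → ℝ) :=
    funext fun a => he a
  rw [← h2, linearIndependent_cols_iff_isUnit, isUnit_iff_isUnit_det, isUnit_iff_ne_zero] at hli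
  exact hli

end Matrix

namespace PrimeTup

variable {S : PrimeTup} {n d : ℕ}

theorem mem_realIndep_iff {y : S.Tup n d} : y ∈ S.realIndep n d ↔ LinearIndependent ℝ y.1 := by
  rw [realIndep, Set.mem_iUnion]
  constructor
  · rintro ⟨e, he⟩
    have h1 : LinearIndependent ℝ (realMinor e y).row := by
      rw [linearIndependent_rows_iff_isUnit, isUnit_iff_isUnit_det, isUnit_iff_ne_zero]
      exact he
    exact LinearIndependent.of_comp (LinearMap.funLeft ℝ ℝ e) h1
  · exact fun h => exists_det_submatrix_ne_zero h

theorem actTup_mem_realIndep_iff (g : S.G d) {y : S.Tup n d} :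
    actTup g y ∈ S.realIndep n d ↔ y ∈ S.realIndep n d := by
  have h : ∀ (g : S.G d) (y : S.Tup n d), actTup g y ∈ S.realIndep n d → y ∈ S.realIndep n d := by
    intro g y hy
    rw [mem_realIndep_iff] at hy ⊢
    exact LinearIndependent.of_comp g.1.1.mulVecLin hy
  refine ⟨h g y, fun hy => h g⁻¹ _ ?_⟩
  rwa [← actTup_mul, inv_mul_cancel, actTup_one]

/-- The integral tuples that are linearly independent. -/
def indepTup (S : PrimeTup) (n d : ℕ) : Set (Fin n → Fin d → S.Zs) :=
  {z | S.diagTup z ∈ S.realIndep n d}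

theorem tupPerm_mem_indepTup (γ : SpecialLinearGroup (Fin d) S.Zs) (z : Fin n → Fin d → S.Zs) :
    tupPerm n γ z ∈ S.indepTup n d ↔ z ∈ S.indepTup n d := by
  have h : S.diagTup (tupPerm n γ z) = actTup (S.toG d γ) (S.diagTup z) :=
    (actTup_toG_diagTup γ z).symm
  rw [indepTup, Set.mem_ofPred_eq, h, actTup_mem_realIndep_iff, Set.mem_ofPred_eq]

theorem smul_mem_indepTup_iff {m : Fin n → S.Zs} (hm : ∀ a, m a ≠ 0) (z : Fin n → Fin d → S.Zs) :
    (fun a => m a • z a) ∈ S.indepTup n d ↔ z ∈ S.indepTup n d := by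
  have hm' : ∀ a, ((m a : ℚ) : ℝ) ≠ 0 := fun a => by
    have := hm a
    exact_mod_cast this
  have h := LinearIndependent.units_smul_iff (R := ℝ) (v := (S.diagTup z).1)
    (w := fun a => Units.mk0 _ (hm' a))
  rw [indepTup, Set.mem_ofPred_eq, Set.mem_ofPred_eq, mem_realIndep_iff, mem_realIndep_iff, ← h]
  have e1 : (S.diagTup fun a => m a • z a).1 = (fun a => Units.mk0 _ (hm' a)) • (S.diagTup z).1 := by
    ext a j
    simp [diagTup, Units.smul_def]
  rw [e1]

theorem mem_indepTup_one {z : Fin 1 → Fin d → S.Zs} : z ∈ S.indepTup 1 d ↔ z 0 ≠ 0 := by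
  rw [indepTup, Set.mem_ofPred_eq, mem_realIndep_iff, linearIndependent_unique_iff]
  rw [not_iff_not]
  constructor
  · intro h
    ext j
    have := congrFun h j
    simpa [diagTup] using this
  · intro h
    ext j
    simp [diagTup, h]

theorem exists_unit_smul_eq_of_notMem_indepTup (hd : 0 < d) {z : Fin 2 → Fin d → S.Zs}
    (h0 : z 0 ∈ S.primZs d) (h1 : z 1 ∈ S.primZs d) (hz : z ∉ S.indepTup 2 d) :
    ∃ u : S.Zsˣ, z 1 = (u : S.Zs) • z 0 := by
  refine exists_unit_smul_eq_of_mul_eq hd h0 h1 fun i j => ?_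
  have h2 : ∀ e, (realMinor e (S.diagTup z)).det = 0 := by
    simpa [indepTup, realIndep] using hz
  have h3 := h2 ![i, j]
  rw [det_fin_two] at h3
  simp only [realMinor, diagTup, of_apply, cons_val_zero, cons_val_one] at h3
  ext
  push_cast
  have h4 : ((z 0 i : ℚ) : ℝ) * (z 1 j : ℚ) = (z 0 j : ℚ) * (z 1 i : ℚ) := by linarith
  exact_mod_cast h4

end PrimeTup

attribute [local instance] Padic.measureSpace Padic.isAddHaarMeasure_volume in
theorem Padic.map_smul_volume_pi {p : ℕ} [Fact p.Prime] {d : ℕ} {c : ℚ_[p]} (hc : c ≠ 0) :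
    Measure.map (fun x : Fin d → ℚ_[p] => c • x) volume =
      ENNReal.ofReal ‖c⁻¹‖ ^ d • volume := by
  have h := Padic.map_matrix_volume_pi_eq_smul_volume_pi (p := p)
    (M := c • (1 : Matrix (Fin d) (Fin d) ℚ_[p])) (by simp [hc])
  have h1 : ⇑(Matrix.toLin' (c • (1 : Matrix (Fin d) (Fin d) ℚ_[p]))) = fun x => c • x := by
    ext1 x
    rw [toLin'_apply, smul_mulVec, one_mulVec]
  rw [h1] at h
  rw [h, det_smul, det_one, mul_one, Fintype.card_fin, ← ENNReal.ofReal_pow (norm_nonneg _),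
    ← norm_pow, inv_pow]

theorem MeasureTheory.Measure.pi_const_smul {ι : Type*} [Fintype ι] {α : ι → Type*}
    [∀ i, MeasurableSpace (α i)] (μ : ∀ i, Measure (α i)) [∀ i, SigmaFinite (μ i)]
    (c : ι → ℝ≥0∞) (hc : ∀ i, c i ≠ ⊤) :
    Measure.pi (fun i => c i • μ i) = (∏ i, c i) • Measure.pi μ := by
  have : ∀ i, SigmaFinite (c i • μ i) := fun i => by
    rw [← ENNReal.coe_toNNReal (hc i)]
    exact inferInstanceAs (SigmaFinite ((c i).toNNReal • μ i))
  refine Measure.pi_eq fun s hs => ?_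
  simp [Measure.pi_pi, Finset.prod_mul_distrib]

namespace PrimeTup

attribute [local instance] Padic.measureSpace Padic.isAddHaarMeasure_volume
  isAddHaarMeasure_volume_tup

variable {S : PrimeTup} {n d : ℕ}

theorem lintegral_latticeSum_indepTup {μ : Measure (S.G d ⧸ S.Gamma d)} [IsProbabilityMeasure μ]
    (hμ : SMulInvariantMeasure (S.G d) (S.G d ⧸ S.Gamma d) μ) (hnd : n < d)
    {f : S.Tup n d → ℝ≥0∞} (hf : Measurable f) :
    ∫⁻ y, latticeSum (S.indepTup n d) f y ∂μ = ∫⁻ x in S.realIndep n d, f x := by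
  have hm : MeasurableSet (S.realIndep n d) := isOpen_realIndep.measurableSet
  have h1 : ∀ y, latticeSum (S.indepTup n d) f y =
      latticeSum Set.univ ((S.realIndep n d).indicator f) y := fun y => by
    refine tsum_congr fun z => ?_
    rw [Set.indicator_of_mem (Set.mem_univ z)]
    by_cases hz : z ∈ S.indepTup n d
    · rw [Set.indicator_of_mem hz, Set.indicator_of_mem ((actTup_mem_realIndep_iff _).2 hz)]
    · rw [Set.indicator_of_notMem hz,
        Set.indicator_of_notMem fun h => hz ((actTup_mem_realIndep_iff _).1 h)]
  simp only [h1]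
  rw [← lintegral_siegelMeasure μ tupPerm_mem_univ (hf.indicator hm), lintegral_indicator hm,
    siegelMeasure_restrict_realIndep hμ hnd]

/-- Multiplication of the vectors of a tuple by natural numbers. -/
noncomputable def scaleTup (m : Fin n → ℕ) (x : S.Tup n d) : S.Tup n d :=
  (fun a => (m a : ℝ) • x.1 a, fun i a => (m a : S.Qp i) • x.2 i a)

theorem continuous_scaleTup (m : Fin n → ℕ) :
    Continuous (scaleTup m : S.Tup n d → S.Tup n d) := by
  unfold scaleTup; fun_prop

theorem norm_natCast_of_mem_NS {m : ℕ} (hm : m ∈ S.NS) (i : Fin S.s) : ‖(m : S.Qp i)‖ = 1 := by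
  rw [Padic.norm_natCast_eq_one_iff]
  exact ((S.hp i).coprime_iff_not_dvd).2 (hm.2 i)

theorem map_scaleTup_volume {m : Fin n → ℕ} (hm : ∀ a, m a ∈ S.NS) :
    Measure.map (scaleTup m : S.Tup n d → S.Tup n d) volume =
      (∏ a, ((m a : ℝ≥0∞) ^ d)⁻¹) • volume := by
  have hpos : ∀ a, 0 < m a := fun a => (hm a).1
  have h1 : ∀ a, MeasurePreserving (fun x : Fin d → ℝ => (m a : ℝ) • x) volume
      (((m a : ℝ≥0∞) ^ d)⁻¹ • volume) := fun a => by
    refine ⟨by fun_prop, ?_⟩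
    have h0 : (0 : ℝ) < m a := Nat.cast_pos.2 (hpos a)
    rw [Measure.map_addHaar_smul (volume : Measure (Fin d → ℝ)) h0.ne', Module.finrank_pi,
      Fintype.card_fin, abs_of_pos (by positivity), ENNReal.ofReal_inv_of_pos (by positivity),
      ENNReal.ofReal_pow h0.le, ENNReal.ofReal_natCast]
  have hc : ∀ a, ((m a : ℝ≥0∞) ^ d)⁻¹ ≠ ⊤ := fun a => by
    simp [(hpos a).ne']
  have hsf : ∀ a, SigmaFinite (((m a : ℝ≥0∞) ^ d)⁻¹ • (volume : Measure (Fin d → ℝ))) :=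
    fun a => by
      rw [← ENNReal.coe_toNNReal (hc a)]
      exact inferInstanceAs (SigmaFinite
        ((((m a : ℝ≥0∞) ^ d)⁻¹).toNNReal • (volume : Measure (Fin d → ℝ))))
  have h2 : MeasurePreserving (fun (x : Fin n → Fin d → ℝ) a => (m a : ℝ) • x a) volume
      ((∏ a, ((m a : ℝ≥0∞) ^ d)⁻¹) • volume) := by
    have := measurePreserving_pi (fun _ : Fin n => (volume : Measure (Fin d → ℝ)))
      (fun a => ((m a : ℝ≥0∞) ^ d)⁻¹ • (volume : Measure (Fin d → ℝ))) h1
    rwa [Measure.pi_const_smul _ _ hc] at this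
  have h3 : MeasurePreserving (fun (x : ∀ i, Fin n → Fin d → S.Qp i) i a =>
      (m a : S.Qp i) • x i a) volume volume := by
    refine measurePreserving_pi (fun i => (volume : Measure (Fin n → Fin d → S.Qp i)))
      (fun i => (volume : Measure (Fin n → Fin d → S.Qp i)))
      (f := fun i x a => (m a : S.Qp i) • x a) fun i => ?_
    refine measurePreserving_pi _ _ fun a => ⟨by fun_prop, ?_⟩
    have h0 : (m a : S.Qp i) ≠ 0 := Nat.cast_ne_zero.2 (hpos a).ne'
    rw [Padic.map_smul_volume_pi h0, norm_inv, norm_natCast_of_mem_NS (hm a)]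
    simp
  change Measure.map (Prod.map (fun (x : Fin n → Fin d → ℝ) a => (m a : ℝ) • x a)
    (fun (x : ∀ i, Fin n → Fin d → S.Qp i) i a => (m a : S.Qp i) • x i a))
    (Measure.prod volume volume) = _ • Measure.prod volume volume
  rw [← Measure.map_prod_map _ _ h2.measurable h3.measurable, h2.map_eq, h3.map_eq,
    Measure.prod_smul_left]

theorem scaleTup_mem_realIndep_iff {m : Fin n → ℕ} (hm : ∀ a, m a ∈ S.NS) {x : S.Tup n d} :
    scaleTup m x ∈ S.realIndep n d ↔ x ∈ S.realIndep n d := by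
  rw [mem_realIndep_iff, mem_realIndep_iff]
  have h := LinearIndependent.units_smul_iff (R := ℝ) x.1
    (fun a => Units.mk0 (m a : ℝ) (Nat.cast_ne_zero.2 (hm a).1.ne'))
  exact h

theorem lintegral_latticeSum_scaleTup {μ : Measure (S.G d ⧸ S.Gamma d)} [IsProbabilityMeasure μ]
    (hμ : SMulInvariantMeasure (S.G d) (S.G d ⧸ S.Gamma d) μ) (hnd : n < d)
    {f : S.Tup n d → ℝ≥0∞} (hf : Measurable f) {m : Fin n → ℕ} (hm : ∀ a, m a ∈ S.NS) :
    ∫⁻ y, latticeSum (S.indepTup n d) (fun x => f (scaleTup m x)) y ∂μ =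
      (∏ a, ((m a : ℝ≥0∞) ^ d)⁻¹) * ∫⁻ x in S.realIndep n d, f x := by
  have hI : MeasurableSet (S.realIndep n d) := isOpen_realIndep.measurableSet
  have hs := (continuous_scaleTup (S := S) (d := d) m).measurable
  have h1 := lintegral_latticeSum_indepTup hμ hnd (hf.comp hs)
  simp only [Function.comp_def] at h1
  rw [h1, ← lintegral_indicator hI, ← lintegral_indicator hI, ← smul_eq_mul,
    ← lintegral_smul_measure, ← map_scaleTup_volume hm, lintegral_map (hf.indicator hI) hs]
  refine lintegral_congr fun x => ?_
  by_cases hx : x ∈ S.realIndep n d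
  · rw [Set.indicator_of_mem hx, Set.indicator_of_mem ((scaleTup_mem_realIndep_iff hm).2 hx)]
  · rw [Set.indicator_of_notMem hx,
      Set.indicator_of_notMem fun h => hx ((scaleTup_mem_realIndep_iff hm).1 h)]

end PrimeTup

theorem apply_one_eq_div_of_forall_hasSum_mul {M : Type*} [Monoid M] (X : M →* ℝ)
    (hX : ∀ k, 0 ≤ X k) {Z : ℝ} (hZ : HasSum X Z) (hZ2 : Z < 2) {A : M → ℝ} (hA : ∀ k, 0 ≤ A k)
    {v : ℝ} (h : ∀ k, HasSum (fun m => A (k * m)) (X k * v)) : A 1 = v / Z := by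
  have hZ1 : 1 ≤ Z := by
    have := le_hasSum hZ 1 fun k _ => hX k
    rwa [map_one] at this
  have hv : 0 ≤ v := by
    have := (h 1).nonneg fun m => hA _
    rwa [map_one, one_mul] at this
  have hAle : ∀ k, A k ≤ X k * v := fun k => by
    have := le_hasSum (h k) 1 fun m _ => hA _
    rwa [mul_one] at this
  have hXs : ∀ k, HasSum (fun m => X (k * m)) (X k * Z) := fun k => by
    simp only [map_mul]
    exact hZ.mul_left _
  have hδ : ∀ k, HasSum (fun m => A (k * m) - X (k * m) * (v / Z)) 0 := fun k => by
    have := (h k).sub ((hXs k).mul_right (v / Z))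
    have h0 : X k * v - X k * Z * (v / Z) = 0 := by field_simp; ring
    rwa [h0] at this
  have hstep : ∀ j : ℕ, ∀ k, |A k - X k * (v / Z)| ≤ X k * ((2 * v) * (Z - 1) ^ j) := by
    intro j
    induction j with
    | zero =>
      intro k
      have h1 : v / Z ≤ v := div_le_self hv hZ1
      have h2 : 0 ≤ v / Z := by positivity
      rw [abs_le]
      constructor
      · nlinarith [hX k, hA k, mul_nonneg (hX k) hv, mul_le_mul_of_nonneg_left h1 (hX k)]
      · nlinarith [hX k, hAle k, mul_nonneg (hX k) hv, mul_nonneg (hX k) h2]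
    | succ j ih =>
      intro k
      classical
      have h1 := (hδ k).update 1 0
      rw [mul_one] at h1
      have h2 := ((hXs k).mul_right ((2 * v) * (Z - 1) ^ j)).update 1 0
      rw [mul_one] at h2
      have h3 := h1.norm_le_of_bounded h2 fun m => by
        rcases eq_or_ne m 1 with rfl | hm
        · simp
        · rw [Function.update_of_ne hm, Function.update_of_ne hm]
          exact ih _
      rw [Real.norm_eq_abs] at h3
      have h4 : |A k - X k * (v / Z)| = |0 - (A k - X k * (v / Z)) + 0| := by
        rw [zero_sub, add_zero, abs_neg]
      rw [h4]
      refine le_of_le_of_eq (le_of_eq_of_le (by ring_nf) h3) ?_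
      ring
  have hlim : Filter.Tendsto (fun j : ℕ => X 1 * ((2 * v) * (Z - 1) ^ j)) Filter.atTop
      (nhds (X 1 * ((2 * v) * 0))) :=
    ((_root_.tendsto_pow_atTop_nhds_zero_of_lt_one (by linarith) (by linarith)).const_mul _).const_mul _
  have h0 := ge_of_tendsto' hlim fun j => hstep j 1
  rw [mul_zero, mul_zero, map_one, one_mul] at h0
  linarith [abs_eq_zero.1 (le_antisymm h0 (abs_nonneg _))]

theorem ENNReal.apply_one_eq_div_of_forall_tsum_mul {M : Type*} [Monoid M] (X : M →* ℝ≥0∞)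
    (hX : ∀ k, X k ≠ ⊤) (hZ2 : ∑' k, X k < 2) {A : M → ℝ≥0∞}
    {v : ℝ≥0∞} (hv : v ≠ ⊤) (h : ∀ k, ∑' m, A (k * m) = X k * v) : A 1 = v / ∑' k, X k := by
  have hZ : ∑' k, X k ≠ ⊤ := (hZ2.trans ENNReal.ofNat_lt_top).ne
  have hs : ∀ k, ∑' m, A (k * m) ≠ ⊤ := fun k => h k ▸ ENNReal.mul_ne_top (hX k) hv
  have hA : ∀ k, A k ≠ ⊤ := fun k => by
    have := ENNReal.ne_top_of_tsum_ne_top (hs k) 1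
    rwa [mul_one] at this
  let Y : M →* ℝ :=
    { toFun := fun k => (X k).toReal
      map_one' := by simp
      map_mul' := fun a b => by simp }
  have h1 := apply_one_eq_div_of_forall_hasSum_mul Y (fun k => ENNReal.toReal_nonneg)
    (Z := (∑' k, X k).toReal) (ENNReal.tsum_toReal_eq hX ▸ ENNReal.hasSum_toReal hZ)
    ((ENNReal.toReal_lt_toReal hZ ENNReal.ofNat_ne_top).2 hZ2)
    (A := fun k => (A k).toReal) (fun k => ENNReal.toReal_nonneg) (v := v.toReal) fun k => by
      have := ENNReal.hasSum_toReal (hs k)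
      rw [← ENNReal.tsum_toReal_eq fun m => hA (k * m), h k, ENNReal.toReal_mul] at this
      exact this
  have h2 : 1 ≤ ∑' k, X k := by
    have := ENNReal.le_tsum (f := X) 1
    rwa [map_one] at this
  rw [← ENNReal.toReal_div] at h1
  exact (ENNReal.toReal_eq_toReal_iff' (hA 1)
    (ENNReal.div_ne_top hv (one_pos.trans_le h2).ne')).1 h1

namespace PrimeTup

attribute [local instance] Padic.measureSpace Padic.isAddHaarMeasure_volume
  isAddHaarMeasure_volume_tup

variable {S : PrimeTup} {n d : ℕ}

/-- `ℕ_S` as a multiplicative monoid. -/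
def nsMonoid (S : PrimeTup) : Submonoid ℕ where
  carrier := S.NS
  one_mem' := ⟨one_pos, fun i h => (S.hp i).one_lt.ne' (Nat.dvd_one.1 h)⟩
  mul_mem' := fun ha hb => ⟨mul_pos ha.1 hb.1, fun i h =>
    (((S.hp i).dvd_mul).1 h).elim (ha.2 i) (hb.2 i)⟩

/-- The linearly independent tuples of `S`-primitive vectors. -/
def primTup (S : PrimeTup) (n d : ℕ) : Set (Fin n → Fin d → S.Zs) :=
  {z | (∀ a, z a ∈ S.primZs d) ∧ z ∈ S.indepTup n d}

theorem tupPerm_mem_primTup (γ : SpecialLinearGroup (Fin d) S.Zs) (z : Fin n → Fin d → S.Zs) :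
    tupPerm n γ z ∈ S.primTup n d ↔ z ∈ S.primTup n d :=
  and_congr (forall_congr' fun a => mulVec_mem_primZs_iff γ (z a)) (tupPerm_mem_indepTup γ z)

theorem ne_zero_of_mem_indepTup {z : Fin n → Fin d → S.Zs} (hz : z ∈ S.indepTup n d) (a : Fin n) :
    z a ≠ 0 := by
  intro h
  refine (mem_realIndep_iff.1 hz).ne_zero a ?_
  ext j
  simp [diagTup, h]

theorem natCast_Zs_ne_zero {m : ℕ} (hm : m ∈ S.NS) : (m : S.Zs) ≠ 0 := by
  have := hm.1.ne'
  exact_mod_cast this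

/-- Independent tuples are uniquely multiples of primitive independent tuples. -/
noncomputable def scalePrimEquiv (S : PrimeTup) (n : ℕ) (hd : 2 ≤ d) :
    (Fin n → S.nsMonoid) × S.primTup n d ≃ S.indepTup n d :=
  Equiv.ofBijective
    (fun q => ⟨fun a => ((q.1 a : ℕ) : S.Zs) • q.2.1 a,
      (smul_mem_indepTup_iff (fun a => natCast_Zs_ne_zero (q.1 a).2) _).2 q.2.2.2⟩) <| by
    constructor
    · rintro ⟨m, v, hv⟩ ⟨m', v', hv'⟩ h
      have h1 : ∀ a, (m a : ℕ) = m' a ∧ v a = v' a := fun a =>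
        primZs_smul_injective (by omega) (m a).2 (m' a).2 (hv.1 a) (hv'.1 a)
          (congrFun (Subtype.ext_iff.1 h) a)
      have h2 : m = m' := funext fun a => Subtype.ext (h1 a).1
      have h3 : v = v' := funext fun a => (h1 a).2
      subst h2 h3
      rfl
    · rintro ⟨z, hz⟩
      choose m hm v hv h using fun a => exists_primZs_smul hd (ne_zero_of_mem_indepTup hz a)
      refine ⟨⟨fun a => ⟨m a, hm a⟩, v, hv, ?_⟩, Subtype.ext (funext fun a => (h a).symm)⟩
      refine (smul_mem_indepTup_iff (fun a => natCast_Zs_ne_zero (hm a)) v).1 ?_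
      rw [← funext h]
      exact hz

theorem actTup_scaleTup (g : S.G d) (m : Fin n → ℕ) (x : S.Tup n d) :
    actTup g (scaleTup m x) = scaleTup m (actTup g x) := by
  ext <;> simp [actTup, scaleTup, mulVec_smul]

theorem diagTup_natCast_smul (m : Fin n → ℕ) (z : Fin n → Fin d → S.Zs) :
    S.diagTup (fun a => ((m a : ℕ) : S.Zs) • z a) = scaleTup m (S.diagTup z) := by
  ext <;> simp [diagTup, scaleTup]

theorem scaleTup_scaleTup (m k : Fin n → ℕ) (x : S.Tup n d) :
    scaleTup k (scaleTup m x) = scaleTup (fun a => k a * m a) x := by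
  ext <;> simp [scaleTup, mul_assoc]

theorem scaleTup_one (x : S.Tup n d) : scaleTup (fun _ => 1) x = x := by
  ext <;> simp [scaleTup]

theorem latticeSum_indepTup_eq_tsum (hd : 2 ≤ d) (f : S.Tup n d → ℝ≥0∞)
    (y : S.G d ⧸ S.Gamma d) : latticeSum (S.indepTup n d) f y =
      ∑' m : Fin n → S.nsMonoid, latticeSum (S.primTup n d)
        (fun x => f (scaleTup (fun a => (m a : ℕ)) x)) y := by
  have h1 : latticeSum (S.indepTup n d) f y =
      ∑' z : S.indepTup n d, f (actTup y.out (S.diagTup z)) :=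
    (tsum_subtype _ fun z => f (actTup y.out (S.diagTup z))).symm
  rw [h1, ← (scalePrimEquiv S n hd).tsum_eq, ENNReal.tsum_prod']
  refine tsum_congr fun m => ?_
  rw [latticeSum, ← tsum_subtype]
  refine tsum_congr fun v => ?_
  rw [← actTup_scaleTup, ← diagTup_natCast_smul]
  rfl

/-- The character `m ↦ ∏ₐ m(a)^{-d}`. -/
noncomputable def zetaChar (S : PrimeTup) (n d : ℕ) : (Fin n → S.nsMonoid) →* ℝ≥0∞ where
  toFun m := ∏ a, (((m a : ℕ) : ℝ≥0∞) ^ d)⁻¹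
  map_one' := by simp
  map_mul' m k := by
    rw [← Finset.prod_mul_distrib]
    refine Finset.prod_congr rfl fun a _ => ?_
    rw [Pi.mul_apply, Submonoid.coe_mul, Nat.cast_mul, mul_pow, ENNReal.mul_inv] <;>
    simp

theorem zetaChar_ne_top (m : Fin n → S.nsMonoid) : S.zetaChar n d m ≠ ⊤ := by
  change ∏ a, (((m a : ℕ) : ℝ≥0∞) ^ d)⁻¹ ≠ ⊤
  refine ENNReal.prod_ne_top fun a _ => ENNReal.inv_ne_top.2 (pow_ne_zero _ ?_)
  exact Nat.cast_ne_zero.2 (m a).2.1.ne'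

theorem lintegral_latticeSum_primTup {μ : Measure (S.G d ⧸ S.Gamma d)} [IsProbabilityMeasure μ]
    (hμ : SMulInvariantMeasure (S.G d) (S.G d ⧸ S.Gamma d) μ) (hd : 2 ≤ d) (hnd : n < d)
    {f : S.Tup n d → ℝ≥0∞} (hf : Measurable f) (hfin : ∫⁻ x in S.realIndep n d, f x ≠ ⊤)
    (hZ : ∑' m, S.zetaChar n d m < 2) :
    ∫⁻ y, latticeSum (S.primTup n d) f y ∂μ =
      (∫⁻ x in S.realIndep n d, f x) / ∑' m, S.zetaChar n d m := by
  have hs : ∀ m : Fin n → ℕ, Measurable fun x : S.Tup n d => f (scaleTup m x) := fun m =>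
    hf.comp (continuous_scaleTup m).measurable
  have h := ENNReal.apply_one_eq_div_of_forall_tsum_mul (S.zetaChar n d) zetaChar_ne_top hZ
    (A := fun m => ∫⁻ y, latticeSum (S.primTup n d)
      (fun x => f (scaleTup (fun a => (m a : ℕ)) x)) y ∂μ) hfin fun k => by
      have h1 := lintegral_latticeSum_scaleTup hμ hnd hf (m := fun a => (k a : ℕ))
        fun a => (k a).2
      refine Eq.trans ?_ h1
      simp only [latticeSum_indepTup_eq_tsum hd, scaleTup_scaleTup]
      rw [lintegral_tsum]
      · rfl
      · intro m
        exact (measurable_latticeSum tupPerm_mem_primTup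
          (hs fun a => (k a : ℕ) * (m a : ℕ))).aemeasurable
  simp only [Pi.one_apply, OneMemClass.coe_one, scaleTup_one] at h
  exact h

theorem tsum_zetaChar_one (hd : 2 ≤ d) :
    ∑' m, S.zetaChar 1 d m = ENNReal.ofReal (S.zetaS d) := by
  rw [← (Equiv.funUnique (Fin 1) S.nsMonoid).symm.tsum_eq, zetaS,
    ENNReal.ofReal_tsum_of_nonneg (fun m => by positivity)]
  · refine tsum_congr fun m => ?_
    have hm : 0 < (m : ℕ) := m.2.1
    have hm' : (0 : ℝ) < ((m : ℕ) : ℝ) ^ d := by positivity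
    simp only [zetaChar, MonoidHom.coe_mk, OneHom.coe_mk, Finset.univ_unique, Finset.prod_singleton]
    rw [one_div, ENNReal.ofReal_inv_of_pos hm', ENNReal.ofReal_pow (by positivity),
      ENNReal.ofReal_natCast]
    rfl
  · exact (Real.summable_one_div_nat_pow.2 hd).subtype _

theorem tsum_zetaChar_two :
    ∑' m, S.zetaChar 2 d m = (∑' m, S.zetaChar 1 d m) ^ 2 := by
  rw [← (finTwoArrowEquiv S.nsMonoid).symm.tsum_eq, ENNReal.tsum_prod',
    ← (Equiv.funUnique (Fin 1) S.nsMonoid).symm.tsum_eq, sq, ← ENNReal.tsum_mul_right]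
  refine tsum_congr fun m => ?_
  rw [← ENNReal.tsum_mul_left]
  refine tsum_congr fun k => ?_
  simp [zetaChar]

theorem zetaS_lt (hd : 3 ≤ d) : S.zetaS d < 4 / 3 := by
  have hs : Summable fun m : ℕ => 1 / (m : ℝ) ^ d := Real.summable_one_div_nat_pow.2 (by omega)
  have h1 : S.zetaS d ≤ ∑' m : ℕ, 1 / (m : ℝ) ^ d :=
    Summable.tsum_subtype_le _ S.NS (fun m => by positivity) hs
  have h2 : ∀ m : ℕ, 1 / (m : ℝ) ^ d ≤ (1 / (m : ℝ) ^ 2 + if m = 1 then 1 else 0) / 2 := by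
    intro m
    rcases Nat.lt_or_ge m 2 with h | h
    · interval_cases m
      · simp [show d ≠ 0 by omega]
      · simp
    · have hm : (2 : ℝ) ≤ m := by exact_mod_cast h
      rw [if_neg (by omega), add_zero, div_div]
      refine one_div_le_one_div_of_le (by positivity) ?_
      calc (m : ℝ) ^ 2 * 2 ≤ (m : ℝ) ^ 2 * m := by gcongr
        _ = (m : ℝ) ^ 3 := by ring
        _ ≤ (m : ℝ) ^ d := pow_le_pow_right₀ (by linarith) hd
  have h3 := ((hasSum_zeta_two.add (hasSum_ite_eq (1 : ℕ) (1 : ℝ))).div_const 2)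
  have h4 := hasSum_le h2 hs.hasSum h3
  have h5 := Real.pi_lt_d2
  have h6 := Real.pi_pos
  nlinarith

theorem one_le_zetaS (hd : 2 ≤ d) : 1 ≤ S.zetaS d := by
  have hs : Summable fun m : S.NS => (1 : ℝ) / ((m : ℕ) : ℝ) ^ d :=
    (Real.summable_one_div_nat_pow.2 (by omega)).subtype _
  have h := hs.le_tsum ⟨1, S.nsMonoid.one_mem⟩ fun m _ => by positivity
  simpa [zetaS] using h

end PrimeTup

namespace PrimeTup

attribute [local instance] Padic.measureSpace Padic.isAddHaarMeasure_volume
  isAddHaarMeasure_volume_tup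

variable {S : PrimeTup} {n d : ℕ}

theorem isAddHaarMeasure_volume_QS : (volume : Measure (S.QS d)).IsAddHaarMeasure := by
  have h1 : ∀ i, (volume : Measure (Fin d → S.Qp i)).IsAddHaarMeasure :=
    fun i => Measure.pi.isAddHaarMeasure _
  have h2 : (volume : Measure ((i : Fin S.s) → Fin d → S.Qp i)).IsAddHaarMeasure :=
    Measure.pi.isAddHaarMeasure _
  have h3 : (volume : Measure (Fin d → ℝ)).IsAddHaarMeasure := Measure.pi.isAddHaarMeasure _
  exact Measure.prod.instIsAddHaarMeasure
    (volume : Measure (Fin d → ℝ)) (volume : Measure ((i : Fin S.s) → Fin d → S.Qp i))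

/-- The product of the local volumes of the factors of a product set. -/
noncomputable def factorVolume (B : Set (Fin d → ℝ)) (Bp : ∀ i, Set (Fin d → S.Qp i)) : ℝ≥0∞ :=
  volume B * ∏ i, volume (Bp i)

theorem volume_QS_eq (B : Set (Fin d → ℝ)) (Bp : ∀ i, Set (Fin d → S.Qp i)) :
    (volume : Measure (S.QS d)) {x | x.1 ∈ B ∧ ∀ i, x.2 i ∈ Bp i} = factorVolume B Bp := by
  have h : {x : S.QS d | x.1 ∈ B ∧ ∀ i, x.2 i ∈ Bp i} = B ×ˢ Set.univ.pi Bp := by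
    ext x; simp
  rw [h]
  change Measure.prod volume volume _ = _
  rw [Measure.prod_prod, factorVolume, volume_pi (ι := Fin S.s), Measure.pi_pi]

theorem volume_unitBox : (volume : Measure (S.QS d)) (S.unitBox d) = 1 := by
  have h : S.unitBox d = {x | x.1 ∈ Set.univ.pi (fun _ => Set.Icc (0 : ℝ) 1) ∧
      ∀ i, x.2 i ∈ Set.univ.pi fun _ => Metric.closedBall (0 : S.Qp i) 1} := by
    ext x; simp only [unitBox, Set.mem_ofPred_eq, Set.mem_univ_pi, mem_closedBall_zero_iff]
  rw [h, volume_QS_eq, factorVolume, volume_pi, Measure.pi_pi]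
  simp only [volume_pi, Measure.pi_pi, Padic.volume_closedBall_one]
  simp

theorem IsVolS.eq_volume {v : Measure (S.QS d)} (hv : S.IsVolS d v) : v = volume := by
  have h1 := hv.1
  have h2 : (volume : Measure (S.QS d)).IsAddHaarMeasure := isAddHaarMeasure_volume_QS
  have hsc : SecondCountableTopology (S.QS d) := inferInstanceAs (SecondCountableTopology
    ((Fin d → ℝ) × ((i : Fin S.s) → Fin d → S.Qp i)))
  have hB : BorelSpace (S.QS d) := Prod.borelSpace
  have h3 := Measure.isAddLeftInvariant_eq_smul v (volume : Measure (S.QS d))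
  have h4 := congrArg (fun m => m (S.unitBox d)) h3
  simp only [Measure.smul_apply, hv.2.2, volume_unitBox] at h4
  rw [h3]
  generalize v.addHaarScalarFactor volume = c at *
  have : c = 1 := by
    have h5 : (1 : ℝ≥0∞) = (c : ℝ≥0∞) * 1 := h4
    rw [mul_one] at h5
    exact_mod_cast h5.symm
  rw [this, one_smul]

/-- The tuples all of whose entries lie in a given product set. -/
def prodTup (n : ℕ) (B : Set (Fin d → ℝ)) (Bp : ∀ i, Set (Fin d → S.Qp i)) : Set (S.Tup n d) :=
  {x | (∀ a, x.1 a ∈ B) ∧ ∀ i a, x.2 i a ∈ Bp i}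

theorem prodTup_eq (B : Set (Fin d → ℝ)) (Bp : ∀ i, Set (Fin d → S.Qp i)) :
    prodTup n B Bp = (Set.univ.pi fun _ => B) ×ˢ
      (Set.univ.pi fun i => Set.univ.pi fun _ => Bp i) := by
  ext x; simp [prodTup]

theorem measurableSet_prodTup {B : Set (Fin d → ℝ)} {Bp : ∀ i, Set (Fin d → S.Qp i)}
    (hB : MeasurableSet B) (hBp : ∀ i, MeasurableSet (Bp i)) :
    MeasurableSet (prodTup n B Bp) := by
  rw [prodTup_eq]
  exact (MeasurableSet.univ_pi fun _ => hB).prod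
    (.univ_pi fun i => .univ_pi fun _ => hBp i)

theorem volume_prodTup (B : Set (Fin d → ℝ)) (Bp : ∀ i, Set (Fin d → S.Qp i)) :
    (volume : Measure (S.Tup n d)) (prodTup n B Bp) = factorVolume B Bp ^ n := by
  rw [prodTup_eq]
  change Measure.prod volume volume _ = _
  rw [Measure.prod_prod, volume_pi (ι := Fin n), Measure.pi_pi, volume_pi (ι := Fin S.s),
    Measure.pi_pi]
  simp only [volume_pi (ι := Fin n), Measure.pi_pi]
  simp [factorVolume, mul_pow, Finset.prod_pow]

theorem volume_compl_realIndep_one (hd : 0 < d) :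
    (volume : Measure (S.Tup 1 d)) (S.realIndep 1 d)ᶜ = 0 := by
  have h : (S.realIndep 1 d)ᶜ ⊆ ({0} : Set (Fin 1 → Fin d → ℝ)) ×ˢ Set.univ := by
    intro x hx
    rw [Set.mem_compl_iff, mem_realIndep_iff, linearIndependent_unique_iff, not_not] at hx
    refine ⟨?_, Set.mem_univ _⟩
    ext a j
    rw [Subsingleton.elim a default, hx]
    rfl
  refine measure_mono_null h ?_
  change Measure.prod volume volume _ = _
  have : Nonempty (Fin d) := ⟨⟨0, hd⟩⟩
  rw [Measure.prod_prod, measure_singleton, zero_mul]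

theorem lintegral_prim_one {μ : Measure (S.G d ⧸ S.Gamma d)} [IsProbabilityMeasure μ]
    (hμ : SMulInvariantMeasure (S.G d) (S.G d ⧸ S.Gamma d) μ) (hd : 3 ≤ d)
    {B : Set (Fin d → ℝ)} {Bp : ∀ i, Set (Fin d → S.Qp i)}
    (hB : MeasurableSet B) (hBp : ∀ i, MeasurableSet (Bp i)) (hV : factorVolume B Bp ≠ ⊤) :
    ∫⁻ y, latticeSum (S.primTup 1 d) ((prodTup 1 B Bp).indicator 1) y ∂μ =
      factorVolume B Bp / ENNReal.ofReal (S.zetaS d) := by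
  have hm := measurableSet_prodTup (n := 1) hB hBp
  have h1 : ∫⁻ x in S.realIndep 1 d, (prodTup 1 B Bp).indicator 1 x = factorVolume B Bp := by
    have hr : (volume : Measure (S.Tup 1 d)).restrict (S.realIndep 1 d) = volume :=
      Measure.restrict_eq_self_of_ae_mem
        (mem_ae_iff.2 (volume_compl_realIndep_one (S := S) (show 0 < d by omega)))
    rw [hr, lintegral_indicator_one hm, volume_prodTup, pow_one]
  have h2 := lintegral_latticeSum_primTup (n := 1) hμ (by omega) (by omega)
    (f := (prodTup 1 B Bp).indicator 1) (measurable_one.indicator hm) (by rwa [h1]) (by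
      rw [tsum_zetaChar_one (by omega), ENNReal.ofReal_lt_ofNat]
      have := S.zetaS_lt hd
      linarith)
  rw [h2, h1, tsum_zetaChar_one (by omega)]

theorem lintegral_prim_two_le {μ : Measure (S.G d ⧸ S.Gamma d)} [IsProbabilityMeasure μ]
    (hμ : SMulInvariantMeasure (S.G d) (S.G d ⧸ S.Gamma d) μ) (hd : 3 ≤ d)
    {B : Set (Fin d → ℝ)} {Bp : ∀ i, Set (Fin d → S.Qp i)}
    (hB : MeasurableSet B) (hBp : ∀ i, MeasurableSet (Bp i)) (hV : factorVolume B Bp ≠ ⊤) :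
    ∫⁻ y, latticeSum (S.primTup 2 d) ((prodTup 2 B Bp).indicator 1) y ∂μ ≤
      (factorVolume B Bp / ENNReal.ofReal (S.zetaS d)) ^ 2 := by
  have hm := measurableSet_prodTup (n := 2) hB hBp
  have h1 : ∫⁻ x in S.realIndep 2 d, (prodTup 2 B Bp).indicator 1 x ≤ factorVolume B Bp ^ 2 := by
    refine (setLIntegral_le_lintegral _ _).trans ?_
    rw [lintegral_indicator_one hm, volume_prodTup]
  have hz : 0 ≤ S.zetaS d := zero_le_one.trans (S.one_le_zetaS (by omega))
  have h2 := lintegral_latticeSum_primTup (n := 2) hμ (by omega) (by omega)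
    (f := (prodTup 2 B Bp).indicator 1) (measurable_one.indicator hm)
    (ne_top_of_le_ne_top (ENNReal.pow_ne_top hV) h1) (by
      rw [tsum_zetaChar_two, tsum_zetaChar_one (by omega), ← ENNReal.ofReal_pow hz,
        ENNReal.ofReal_lt_ofNat]
      have := S.zetaS_lt hd
      nlinarith)
  rw [h2, tsum_zetaChar_two, tsum_zetaChar_one (by omega)]
  refine (ENNReal.div_le_div_right h1 _).trans_eq ?_
  rw [ENNReal.div_eq_inv_mul, ENNReal.div_eq_inv_mul, mul_pow, ENNReal.inv_pow]

end PrimeTup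

theorem volume_inter_smul_mem_le {d : ℕ} {u : ℝ} (hu : u ≠ 0) (B : Set (Fin d → ℝ)) :
    volume (B ∩ {x | u • x ∈ B}) ≤ ENNReal.ofReal (min 1 |u|⁻¹) ^ d * volume B := by
  rcases min_cases 1 |u|⁻¹ with ⟨h, -⟩ | ⟨h, -⟩
  · rw [h, ENNReal.ofReal_one, one_pow, one_mul]
    exact measure_mono Set.inter_subset_left
  · rw [h]
    refine (measure_mono Set.inter_subset_right).trans_eq ?_
    have h1 := Measure.addHaar_preimage_smul (volume : Measure (Fin d → ℝ)) hu B
    rw [Module.finrank_pi, Fintype.card_fin] at h1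
    refine Eq.trans h1 ?_
    rw [abs_inv, abs_pow, ← ENNReal.ofReal_pow (by positivity), inv_pow]

attribute [local instance] Padic.measureSpace Padic.isAddHaarMeasure_volume in
theorem Padic.volume_inter_smul_mem_le {p : ℕ} [Fact p.Prime] {d : ℕ} {u : ℚ_[p]} (hu : u ≠ 0)
    {B : Set (Fin d → ℚ_[p])} (hB : MeasurableSet B) :
    volume (B ∩ {x | u • x ∈ B}) ≤ ENNReal.ofReal (min 1 ‖u‖⁻¹) ^ d * volume B := by
  rcases min_cases 1 ‖u‖⁻¹ with ⟨h, -⟩ | ⟨h, -⟩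
  · rw [h, ENNReal.ofReal_one, one_pow, one_mul]
    exact measure_mono Set.inter_subset_left
  · rw [h]
    refine (measure_mono Set.inter_subset_right).trans_eq ?_
    have h1 := congrArg (fun m => m B) (Padic.map_smul_volume_pi (d := d) hu)
    simp only [Measure.smul_apply, smul_eq_mul, norm_inv] at h1
    rw [Measure.map_apply (by fun_prop) hB] at h1
    exact h1

namespace PrimeTup

attribute [local instance] Padic.measureSpace Padic.isAddHaarMeasure_volume
  isAddHaarMeasure_volume_tup

variable {S : PrimeTup} {n d : ℕ}

/-- The product over all places of the factors `min(1, |u|⁻¹)`. -/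
noncomputable def unitWeight (S : PrimeTup) (u : ℚ) : ℝ :=
  min 1 |(u : ℝ)|⁻¹ * ∏ i, min 1 ‖(u : S.Qp i)‖⁻¹

theorem unitWeight_nonneg (u : ℚ) : 0 ≤ S.unitWeight u :=
  mul_nonneg (by positivity) (Finset.prod_nonneg fun i _ => by positivity)

/-- The points of a set whose multiple by `u` is in the set too. -/
abbrev selfInter {K V : Type*} [SMul K V] (u : K) (B : Set V) : Set V := B ∩ {x | u • x ∈ B}

theorem factorVolume_selfInter_le {u : ℚ} (hu : u ≠ 0) (B : Set (Fin d → ℝ))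
    {Bp : ∀ i, Set (Fin d → S.Qp i)} (hBp : ∀ i, MeasurableSet (Bp i)) :
    factorVolume (selfInter (u : ℝ) B) (fun i => selfInter (u : S.Qp i) (Bp i)) ≤
      ENNReal.ofReal (S.unitWeight u) ^ d * factorVolume B Bp := by
  have h0 : ∀ i, (0 : ℝ) ≤ min 1 ‖(u : S.Qp i)‖⁻¹ := fun i => by positivity
  have h1 : ENNReal.ofReal (S.unitWeight u) ^ d =
      ENNReal.ofReal (min 1 |(u : ℝ)|⁻¹) ^ d *
        ∏ i, ENNReal.ofReal (min 1 ‖(u : S.Qp i)‖⁻¹) ^ d := by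
    rw [unitWeight, ENNReal.ofReal_mul (by positivity), mul_pow,
      ENNReal.ofReal_prod_of_nonneg fun i _ => h0 i, Finset.prod_pow]
  have h2 := volume_inter_smul_mem_le (u := (u : ℝ)) (by exact_mod_cast hu) B
  have h3 : ∀ i, volume (selfInter (u : S.Qp i) (Bp i)) ≤
      ENNReal.ofReal (min 1 ‖(u : S.Qp i)‖⁻¹) ^ d * volume (Bp i) := fun i =>
    Padic.volume_inter_smul_mem_le (by exact_mod_cast hu) (hBp i)
  rw [h1, factorVolume, factorVolume, mul_mul_mul_comm, ← Finset.prod_mul_distrib]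
  exact mul_le_mul' h2 (Finset.prod_le_prod' fun i _ => h3 i)

theorem prod_norm_natCast {n : ℕ} (hn : n ≠ 0) (h : ∀ l, l.Prime → l ∣ n → ∃ i, S.p i = l) :
    ∏ i, ‖(n : S.Qp i)‖ = (n : ℝ)⁻¹ := by
  have h1 : ∏ i, S.p i ^ n.factorization (S.p i) = n := by
    conv_rhs => rw [← Nat.prod_factorization_pow_eq_self hn]
    rw [Finsupp.prod_of_support_subset (s := Finset.univ.image S.p), Finset.prod_image]
    · exact fun i _ j _ hij => S.inj hij
    · intro l hl
      rw [Nat.support_factorization, Nat.mem_primeFactors] at hl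
      obtain ⟨i, rfl⟩ := h l hl.1 hl.2.1
      exact Finset.mem_image_of_mem _ (Finset.mem_univ i)
    · simp
  have h2 : (n : ℝ) = ∏ i, (S.p i : ℝ) ^ n.factorization (S.p i) := by
    exact_mod_cast h1.symm
  rw [h2, ← Finset.prod_inv_distrib]
  refine Finset.prod_congr rfl fun i _ => ?_
  have hn' : (n : S.Qp i) ≠ 0 := Nat.cast_ne_zero.2 hn
  rw [Padic.norm_eq_zpow_neg_valuation hn', Padic.valuation_natCast, _root_.zpow_neg, zpow_natCast,
    Nat.factorization_def _ (S.hp i)]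

theorem unitWeight_le_inv_den {u : ℚ} (hu : u ∈ S.Zs) :
    S.unitWeight u ≤ min 1 |(u : ℝ)|⁻¹ * (u.den : ℝ)⁻¹ := by
  refine mul_le_mul_of_nonneg_left ?_ (by positivity)
  rw [← S.prod_norm_natCast u.den_ne_zero fun l hl hld => by
    obtain ⟨i, hi⟩ := S.eq_prime_of_dvd_den hu hl hld
    exact ⟨i, hi.symm⟩]
  refine Finset.prod_le_prod (fun i _ => by positivity) fun i _ => ?_
  by_cases hd : S.p i ∣ u.den
  · have h1 : ‖(u.num : S.Qp i)‖ = 1 := by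
      rw [Padic.norm_intCast_eq_one_iff]
      have h2 := u.reduced
      have h3 : ¬ (S.p i ∣ u.num.natAbs) := fun h =>
        (S.hp i).one_lt.ne' (Nat.dvd_one.1 (h2 ▸ Nat.dvd_gcd h hd))
      rw [Int.isCoprime_iff_gcd_eq_one, Int.gcd_comm]
      exact ((S.hp i).coprime_iff_not_dvd).2 h3
    refine (min_le_right _ _).trans_eq ?_
    conv_lhs => rw [← Rat.num_div_den u]
    rw [Rat.cast_div, norm_div, Rat.cast_intCast, Rat.cast_natCast, h1, one_div, inv_inv]
  · have h1 : ‖(u.den : S.Qp i)‖ = 1 := by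
      rw [Padic.norm_natCast_eq_one_iff]
      exact ((S.hp i).coprime_iff_not_dvd).2 hd
    rw [h1]
    exact min_le_left _ _

theorem unitWeight_le {u : ℚ} (hu : u ∈ S.Zs) (hu0 : u ≠ 0) :
    S.unitWeight u ≤ min (u.den : ℝ)⁻¹ |(u.num : ℝ)|⁻¹ := by
  refine (unitWeight_le_inv_den hu).trans ?_
  have hd : (0 : ℝ) < u.den := by exact_mod_cast u.den_pos
  have hn : (0 : ℝ) < |(u.num : ℝ)| := abs_pos.2 (by exact_mod_cast Rat.num_ne_zero.2 hu0)
  have h1 : |(u : ℝ)|⁻¹ * (u.den : ℝ)⁻¹ = |(u.num : ℝ)|⁻¹ := by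
    conv_lhs => rw [← Rat.num_div_den u]
    rw [Rat.cast_div, Rat.cast_intCast, Rat.cast_natCast, abs_div, abs_of_pos hd]
    simp only [Rat.num_div_den]
    field_simp
  refine le_min ?_ ?_
  · exact (mul_le_mul_of_nonneg_right (min_le_left _ _) (by positivity)).trans_eq (one_mul _)
  · exact (mul_le_mul_of_nonneg_right (min_le_right _ _) (by positivity)).trans_eq h1

theorem unitWeight_pow_le (hd : 3 ≤ d) {u : ℚ} (hu : u ∈ S.Zs) (hu0 : u ≠ 0) :
    S.unitWeight u ^ d ≤ |(u.num : ℝ)| ^ (-(3 / 2) : ℝ) * ((u.den : ℝ) ^ (3 / 2 : ℝ))⁻¹ := by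
  have h := unitWeight_le hu hu0
  have h0 := S.unitWeight_nonneg u
  have hd1 : (1 : ℝ) ≤ u.den := by exact_mod_cast u.den_pos
  have hdp : (0 : ℝ) < u.den := by linarith
  have hdi : (0 : ℝ) ≤ (u.den : ℝ)⁻¹ := by positivity
  have h1 : S.unitWeight u ≤ 1 :=
    (h.trans (min_le_left _ _)).trans (inv_le_one_of_one_le₀ hd1)
  have h2 : S.unitWeight u ^ (3 / 2 : ℝ) ≤ ((u.den : ℝ)⁻¹) ^ (3 / 2 : ℝ) :=
    Real.rpow_le_rpow h0 (h.trans (min_le_left _ _)) (by norm_num)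
  have h3 : S.unitWeight u ^ (3 / 2 : ℝ) ≤ (|(u.num : ℝ)|⁻¹) ^ (3 / 2 : ℝ) :=
    Real.rpow_le_rpow h0 (h.trans (min_le_right _ _)) (by norm_num)
  calc S.unitWeight u ^ d ≤ S.unitWeight u ^ 3 := pow_le_pow_of_le_one h0 h1 hd
    _ = S.unitWeight u ^ (3 / 2 : ℝ) * S.unitWeight u ^ (3 / 2 : ℝ) := by
      rw [← Real.rpow_add_of_nonneg h0 (by norm_num) (by norm_num), ← Real.rpow_natCast]
      norm_num
    _ ≤ (|(u.num : ℝ)|⁻¹) ^ (3 / 2 : ℝ) * ((u.den : ℝ)⁻¹) ^ (3 / 2 : ℝ) :=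
      mul_le_mul h3 h2 (by positivity) (by positivity)
    _ = _ := by
      rw [Real.rpow_neg (abs_nonneg _), Real.inv_rpow (abs_nonneg _), Real.inv_rpow hdp.le]

/-- The sum over the units of `ℤ_S` of the `d`-th powers of their weights. -/
noncomputable def unitWeightSum (S : PrimeTup) (d : ℕ) : ℝ≥0∞ :=
  ∑' u : S.Zsˣ, ENNReal.ofReal (S.unitWeight ((u : S.Zs) : ℚ)) ^ d

theorem unitWeightSum_ne_top (hd : 3 ≤ d) : S.unitWeightSum d ≠ ⊤ := by
  have hs : Summable fun q : ℤ × ℕ =>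
      |(q.1 : ℝ)| ^ (-(3 / 2) : ℝ) * ((q.2 : ℝ) ^ (3 / 2 : ℝ))⁻¹ :=
    (Real.summable_abs_int_rpow (by norm_num)).mul_of_nonneg
      (Real.summable_nat_rpow_inv.2 (by norm_num)) (fun _ => by positivity) fun _ => by positivity
  have hinj : Function.Injective fun u : S.Zsˣ =>
      (((u : S.Zs) : ℚ).num, ((u : S.Zs) : ℚ).den) := fun u v h => by
    have h' := Prod.ext_iff.1 h
    exact Units.ext (Subtype.ext (Rat.ext h'.1 h'.2))
  refine ne_top_of_le_ne_top (hs.comp_injective hinj).tsum_ofReal_ne_top ?_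
  refine ENNReal.tsum_le_tsum fun u => ?_
  rw [← ENNReal.ofReal_pow (unitWeight_nonneg _)]
  refine ENNReal.ofReal_le_ofReal (unitWeight_pow_le hd (u : S.Zs).2 ?_)
  have := u.ne_zero
  exact_mod_cast this

end PrimeTup

theorem MeasureTheory.lintegral_sq_sub_add_sq_sub_le {Ω : Type*} [MeasurableSpace Ω]
    {μ : Measure Ω} [IsProbabilityMeasure μ] {N : Ω → ℝ≥0∞} (hN : Measurable N) {c b : ℝ≥0∞}
    (hc : c ≠ ⊤) (h1 : ∫⁻ x, N x ∂μ = c) (h2 : ∫⁻ x, N x ^ 2 ∂μ ≤ c ^ 2 + b) :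
    ∫⁻ x, ((N x - c) ^ 2 + (c - N x) ^ 2) ∂μ ≤ b := by
  have hpt : ∀ t : ℝ≥0∞, ((t - c) ^ 2 + (c - t) ^ 2) + 2 * c * t ≤ t ^ 2 + c ^ 2 := by
    intro t
    rcases eq_or_ne t ⊤ with rfl | ht
    · simp
    lift t to NNReal using ht
    lift c to NNReal using hc
    norm_cast
    rw [← NNReal.coe_le_coe]
    push_cast
    rcases le_total c t with h | h
    · rw [NNReal.coe_sub h, tsub_eq_zero_of_le h, NNReal.coe_zero]
      exact le_of_eq (by ring)
    · rw [NNReal.coe_sub h, tsub_eq_zero_of_le h, NNReal.coe_zero]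
      exact le_of_eq (by ring)
  have h3 : ∫⁻ x, ((N x - c) ^ 2 + (c - N x) ^ 2) ∂μ + 2 * c * c ≤ b + 2 * c * c := by
    calc ∫⁻ x, ((N x - c) ^ 2 + (c - N x) ^ 2) ∂μ + 2 * c * c
        = ∫⁻ x, (((N x - c) ^ 2 + (c - N x) ^ 2) + 2 * c * N x) ∂μ := by
          rw [lintegral_add_right _ (hN.const_mul _), lintegral_const_mul _ hN, h1]
      _ ≤ ∫⁻ x, (N x ^ 2 + c ^ 2) ∂μ := lintegral_mono fun x => hpt _
      _ = ∫⁻ x, N x ^ 2 ∂μ + c ^ 2 := by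
          rw [lintegral_add_right _ measurable_const, lintegral_const, measure_univ, mul_one]
      _ ≤ c ^ 2 + b + c ^ 2 := by gcongr
      _ = b + 2 * c * c := by ring
  exact (ENNReal.add_le_add_iff_right (ENNReal.mul_ne_top (ENNReal.mul_ne_top (by simp) hc) hc)).1 h3

namespace PrimeTup

attribute [local instance] Padic.measureSpace Padic.isAddHaarMeasure_volume
  isAddHaarMeasure_volume_tup

variable {S : PrimeTup} {n d : ℕ}

theorem mem_primTup_one (hd : 0 < d) {z : Fin 1 → Fin d → S.Zs} :
    z ∈ S.primTup 1 d ↔ z 0 ∈ S.primZs d := by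
  constructor
  · exact fun h => h.1 0
  · refine fun h => ⟨fun a => ?_, mem_indepTup_one.2 (primZs_ne_zero hd h)⟩
    rwa [Subsingleton.elim a 0]

theorem diag_val_injective : Function.Injective fun w : Fin d → S.Zs =>
    S.diag fun j => ((w j : ℚ)) := by
  intro v w h
  ext j
  have h1 := congrFun (congrArg Prod.fst h) j
  simp only [diag] at h1
  exact_mod_cast h1

theorem actTup_diagTup_mem_prodTup (g : S.G d) (z : Fin n → Fin d → S.Zs)
    (B : Set (Fin d → ℝ)) (Bp : ∀ i, Set (Fin d → S.Qp i)) :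
    actTup g (S.diagTup z) ∈ prodTup n B Bp ↔
      ∀ a, S.act g (S.diag fun j => (z a j : ℚ)) ∈ {x : S.QS d | x.1 ∈ B ∧ ∀ i, x.2 i ∈ Bp i} := by
  simp only [prodTup, Set.mem_ofPred_eq, forall_and]
  rw [forall_comm (α := Fin n)]
  rfl

theorem tsum_prim_eq_latticeSum (hd : 0 < d) (B : Set (Fin d → ℝ))
    (Bp : ∀ i, Set (Fin d → S.Qp i)) (g : S.G d) :
    ∑' v : S.prim d, {x : S.QS d | x.1 ∈ B ∧ ∀ i, x.2 i ∈ Bp i}.indicator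
      (fun _ => (1 : ℝ≥0∞)) (S.act g v) =
      latticeSum (S.primTup 1 d) ((prodTup 1 B Bp).indicator 1) (QuotientGroup.mk g) := by
  rw [latticeSum_mk tupPerm_mem_primTup, prim,
    tsum_image (fun v => {x : S.QS d | x.1 ∈ B ∧ ∀ i, x.2 i ∈ Bp i}.indicator
      (fun _ => (1 : ℝ≥0∞)) (S.act g v)) diag_val_injective.injOn,
    tsum_subtype (S.primZs d) fun w => {x : S.QS d | x.1 ∈ B ∧ ∀ i, x.2 i ∈ Bp i}.indicator
      (fun _ => (1 : ℝ≥0∞)) (S.act g (S.diag fun j => (w j : ℚ))),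
    ← (Equiv.funUnique (Fin 1) (Fin d → S.Zs)).tsum_eq]
  refine tsum_congr fun z => ?_
  have h0 : (Equiv.funUnique (Fin 1) (Fin d → S.Zs)) z = z 0 := rfl
  rw [h0]
  by_cases hz : z 0 ∈ S.primZs d
  · rw [Set.indicator_of_mem hz, Set.indicator_of_mem ((mem_primTup_one hd).2 hz)]
    have h := actTup_diagTup_mem_prodTup g z B Bp
    rw [Fin.forall_fin_one] at h
    by_cases hA : actTup g (S.diagTup z) ∈ prodTup 1 B Bp
    · rw [Set.indicator_of_mem hA, Set.indicator_of_mem (h.1 hA)]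
      rfl
    · rw [Set.indicator_of_notMem hA, Set.indicator_of_notMem fun h' => hA (h.2 h')]
  · rw [Set.indicator_of_notMem hz, Set.indicator_of_notMem fun h => hz ((mem_primTup_one hd).1 h)]

theorem act_diag_smul (g : S.G d) (u : S.Zs) (v : Fin d → S.Zs) :
    S.act g (S.diag fun j => ((u • v) j : ℚ)) =
      (((u : ℚ) : ℝ) • (S.act g (S.diag fun j => (v j : ℚ))).1,
        fun i => ((u : ℚ) : S.Qp i) • (S.act g (S.diag fun j => (v j : ℚ))).2 i) := by
  have h1 : S.diag (fun j => ((u • v) j : ℚ)) =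
      (((u : ℚ) : ℝ) • (S.diag fun j => (v j : ℚ)).1,
        fun i => ((u : ℚ) : S.Qp i) • (S.diag fun j => (v j : ℚ)).2 i) := by
    ext <;> simp [diag]
  rw [h1]
  simp only [act, mulVec_smul]

theorem latticeSum_primTup_one_sq_le (hd : 0 < d) (B : Set (Fin d → ℝ))
    (Bp : ∀ i, Set (Fin d → S.Qp i)) (y : S.G d ⧸ S.Gamma d) :
    latticeSum (S.primTup 1 d) ((prodTup 1 B Bp).indicator 1) y ^ 2 ≤
      latticeSum (S.primTup 2 d) ((prodTup 2 B Bp).indicator 1) y +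
      ∑' u : S.Zsˣ, latticeSum (S.primTup 1 d)
        ((prodTup 1 (selfInter (((u : S.Zs) : ℚ) : ℝ) B)
          (fun i => selfInter (((u : S.Zs) : ℚ) : S.Qp i) (Bp i))).indicator 1) y := by
  classical
  induction y using QuotientGroup.induction_on with | _ g => ?_
  set A : Set (S.QS d) := {x | x.1 ∈ B ∧ ∀ i, x.2 i ∈ Bp i} with hA
  let P : Set (Fin d → S.Zs) := {v | v ∈ S.primZs d ∧ S.act g (S.diag fun j => (v j : ℚ)) ∈ A}
  have hsum : ∀ {n : ℕ} {E : Set (S.Tup n d)} {Q : Set (Fin n → Fin d → S.Zs)},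
      (∀ z, z ∈ S.primTup n d ∧ actTup g (S.diagTup z) ∈ E ↔ z ∈ Q) →
      latticeSum (S.primTup n d) (E.indicator 1) (QuotientGroup.mk g) =
        ∑' z, Q.indicator (fun _ => (1 : ℝ≥0∞)) z := by
    intro n E Q h
    rw [latticeSum_mk tupPerm_mem_primTup]
    refine tsum_congr fun z => ?_
    simp only [Set.indicator_apply, ← h z, Pi.one_apply]
    by_cases h1 : z ∈ S.primTup n d <;> simp [h1]
  have hN : latticeSum (S.primTup 1 d) ((prodTup 1 B Bp).indicator 1) (QuotientGroup.mk g) =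
      ∑' v, P.indicator (fun _ => (1 : ℝ≥0∞)) v := by
    rw [hsum (Q := {z | z 0 ∈ P}) fun z => by
      rw [mem_primTup_one hd, actTup_diagTup_mem_prodTup, Fin.forall_fin_one]; rfl,
      ← (Equiv.funUnique (Fin 1) (Fin d → S.Zs)).tsum_eq]
    rfl
  have hN2 : (∑' v, P.indicator (fun _ => (1 : ℝ≥0∞)) v) ^ 2 =
      ∑' z : Fin 2 → Fin d → S.Zs, {z | z 0 ∈ P ∧ z 1 ∈ P}.indicator (fun _ => (1 : ℝ≥0∞)) z := by
    rw [← (finTwoArrowEquiv (Fin d → S.Zs)).symm.tsum_eq, ENNReal.tsum_prod', sq,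
      ← ENNReal.tsum_mul_right]
    refine tsum_congr fun v => ?_
    rw [← ENNReal.tsum_mul_left]
    refine tsum_congr fun w => ?_
    simp only [Set.indicator_apply, Set.mem_ofPred_eq, finTwoArrowEquiv_symm_apply,
      Matrix.cons_val_zero, Matrix.cons_val_one]
    by_cases h1 : v ∈ P <;> by_cases h2 : w ∈ P <;> simp [h1, h2]
  have hind : latticeSum (S.primTup 2 d) ((prodTup 2 B Bp).indicator 1) (QuotientGroup.mk g) =
      ∑' z, {z | (z 0 ∈ P ∧ z 1 ∈ P) ∧ z ∈ S.indepTup 2 d}.indicator (fun _ => (1 : ℝ≥0∞)) z :=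
    hsum fun z => by
      rw [actTup_diagTup_mem_prodTup, Fin.forall_fin_two, primTup, Set.mem_ofPred_eq,
        Fin.forall_fin_two]
      simp only [P, hA, Set.mem_ofPred_eq]
      tauto
  have hdep : ∀ u : S.Zsˣ, latticeSum (S.primTup 1 d)
        ((prodTup 1 (selfInter (((u : S.Zs) : ℚ) : ℝ) B)
          (fun i => selfInter (((u : S.Zs) : ℚ) : S.Qp i) (Bp i))).indicator 1)
        (QuotientGroup.mk g) =
      ∑' v, {v | v ∈ P ∧ S.act g (S.diag fun j => (((u : S.Zs) • v) j : ℚ)) ∈ A}.indicator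
        (fun _ => (1 : ℝ≥0∞)) v := fun u => by
    rw [hsum (Q := {z | z 0 ∈ {v | v ∈ P ∧
      S.act g (S.diag fun j => (((u : S.Zs) • v) j : ℚ)) ∈ A}}) fun z => by
        rw [mem_primTup_one hd, actTup_diagTup_mem_prodTup, Fin.forall_fin_one,
          Set.mem_ofPred_eq, Set.mem_ofPred_eq, Set.mem_ofPred_eq, act_diag_smul]
        simp only [P, hA, Set.mem_ofPred_eq, Set.mem_inter_iff, forall_and]
        tauto,
      ← (Equiv.funUnique (Fin 1) (Fin d → S.Zs)).tsum_eq]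
    rfl
  rw [hN, hN2, hind]
  simp only [hdep]
  have hsplit : ∀ z : Fin 2 → Fin d → S.Zs, {z | z 0 ∈ P ∧ z 1 ∈ P}.indicator (fun _ => (1 : ℝ≥0∞)) z =
      {z | (z 0 ∈ P ∧ z 1 ∈ P) ∧ z ∈ S.indepTup 2 d}.indicator (fun _ => (1 : ℝ≥0∞)) z +
      {z | (z 0 ∈ P ∧ z 1 ∈ P) ∧ z ∉ S.indepTup 2 d}.indicator (fun _ => (1 : ℝ≥0∞)) z := fun z => by
    simp only [Set.indicator_apply, Set.mem_ofPred_eq]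
    by_cases h1 : z 0 ∈ P ∧ z 1 ∈ P <;> by_cases h2 : z ∈ S.indepTup 2 d <;> simp [h1, h2]
  rw [tsum_congr hsplit, ENNReal.tsum_add]
  refine add_le_add_right ?_ _
  have hu : ∀ z : {z : Fin 2 → Fin d → S.Zs | (z 0 ∈ P ∧ z 1 ∈ P) ∧ z ∉ S.indepTup 2 d},
      ∃ u : S.Zsˣ, z.1 1 = (u : S.Zs) • z.1 0 := fun z =>
    exists_unit_smul_eq_of_notMem_indepTup hd z.2.1.1.1 z.2.1.2.1 z.2.2
  choose u hu using hu
  rw [← tsum_subtype, ← ENNReal.tsum_prod (f := fun (u : S.Zsˣ) v =>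
    {v | v ∈ P ∧ S.act g (S.diag fun j => (((u : S.Zs) • v) j : ℚ)) ∈ A}.indicator
        (fun _ => (1 : ℝ≥0∞)) v)]
  have hinj : Function.Injective fun z :
      {z : Fin 2 → Fin d → S.Zs | (z 0 ∈ P ∧ z 1 ∈ P) ∧ z ∉ S.indepTup 2 d} => (u z, z.1 0) := by
    intro z w h
    have h1 := Prod.ext_iff.1 h
    refine Subtype.ext (funext (Fin.forall_fin_two.2 ⟨h1.2, ?_⟩))
    have h2 : u z = u w := h1.1
    have h3 : z.1 0 = w.1 0 := h1.2
    rw [hu z, hu w, h2, h3]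
  refine le_trans (le_of_eq ?_) (ENNReal.tsum_comp_le_tsum_of_injective hinj _)
  refine tsum_congr fun z => ?_
  rw [Set.indicator_of_mem]
  refine ⟨z.2.1.1, ?_⟩
  dsimp only
  rw [← hu z]
  exact z.2.1.2.2

theorem lintegral_latticeSum_primTup_one_sq_le {μ : Measure (S.G d ⧸ S.Gamma d)}
    [IsProbabilityMeasure μ] (hμ : SMulInvariantMeasure (S.G d) (S.G d ⧸ S.Gamma d) μ)
    (hd : 3 ≤ d) {B : Set (Fin d → ℝ)} {Bp : ∀ i, Set (Fin d → S.Qp i)}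
    (hB : MeasurableSet B) (hBp : ∀ i, MeasurableSet (Bp i)) (hV : factorVolume B Bp ≠ ⊤) :
    ∫⁻ y, latticeSum (S.primTup 1 d) ((prodTup 1 B Bp).indicator 1) y ^ 2 ∂μ ≤
      (factorVolume B Bp / ENNReal.ofReal (S.zetaS d)) ^ 2 +
        S.unitWeightSum d * factorVolume B Bp := by
  have hd0 : 0 < d := by omega
  have hmS : ∀ u : ℚ, MeasurableSet (selfInter (u : ℝ) B) := fun u =>
    hB.inter (measurableSet_preimage (by fun_prop) hB)
  have hmSp : ∀ (u : ℚ) i, MeasurableSet (selfInter (u : S.Qp i) (Bp i)) := fun u i =>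
    (hBp i).inter (measurableSet_preimage (by fun_prop) (hBp i))
  have hm : ∀ u : ℚ, Measurable (latticeSum (S.primTup 1 d)
      ((prodTup 1 (selfInter (u : ℝ) B) (fun i => selfInter (u : S.Qp i) (Bp i))).indicator 1)) :=
    fun u => measurable_latticeSum tupPerm_mem_primTup
      (measurable_one.indicator (measurableSet_prodTup (hmS u) (hmSp u)))
  refine (lintegral_mono fun y => latticeSum_primTup_one_sq_le hd0 B Bp y).trans ?_
  have : Countable S.Zsˣ := Units.val_injective.countable
  rw [lintegral_add_right _ (Measurable.tsum fun u => hm _),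
    lintegral_tsum fun u => (hm _).aemeasurable]
  refine add_le_add (lintegral_prim_two_le hμ hd hB hBp hV) ?_
  rw [unitWeightSum, ← ENNReal.tsum_mul_right]
  refine ENNReal.tsum_le_tsum fun u => ?_
  have hu0 : ((u : S.Zs) : ℚ) ≠ 0 := by
    have := u.ne_zero
    exact_mod_cast this
  have hle := factorVolume_selfInter_le (S := S) hu0 B hBp
  have hfin : ENNReal.ofReal (S.unitWeight ((u : S.Zs) : ℚ)) ^ d * factorVolume B Bp ≠ ⊤ :=
    ENNReal.mul_ne_top (ENNReal.pow_ne_top ENNReal.ofReal_ne_top) hV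
  rw [lintegral_prim_one hμ hd (hmS _) (hmSp _) (ne_top_of_le_ne_top hfin hle)]
  refine le_trans ?_ hle
  refine ENNReal.div_le_of_le_mul (le_mul_of_one_le_right' ?_)
  rw [ENNReal.one_le_ofReal]
  exact one_le_zetaS (by omega)

end PrimeTup

open PrimeTup in
/-- **Variance bound for the primitive counting function, `d ≥ 3`** (Proposition 5.1 (1)).
There is `C > 0`, depending only on `d` and `S`, such that for every product Borel set
`A ⊆ ℚ_S^d` with `0 < vol_S(A) < ∞` and every admissible `μ` on `G_d/Γ_d`, the counting
function `N(gΓ_d) = #(g·P(ℤ_S^d) ∩ A)` satisfies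
`∫ (N − vol_S(A)/ζ_S(d))² dμ ≤ C·vol_S(A)`. -/
theorem primitive_counting_variance_bound
    (S : PrimeTup) (d : ℕ) (hd : 3 ≤ d) :
    ∃ C : ℝ, 0 < C ∧
      ∀ (volS : Measure (S.QS d)), S.IsVolS d volS →
      ∀ (Ainf : Set (Fin d → ℝ)), MeasurableSet Ainf →
      ∀ (Ap : (i : Fin S.s) → Set (Fin d → S.Qp i)), (∀ i, MeasurableSet (Ap i)) →
      ∀ (A : Set (S.QS d)), A = {x | x.1 ∈ Ainf ∧ ∀ i, x.2 i ∈ Ap i} →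
        0 < volS A → volS A ≠ ⊤ →
      ∀ (μ : Measure (S.G d ⧸ S.Gamma d)), S.Admissible d μ →
      ∀ (N : (S.G d ⧸ S.Gamma d) → ℝ≥0∞),
        (∀ g : S.G d, N (QuotientGroup.mk g) =
          ∑' v : S.prim d, A.indicator (fun _ => (1 : ℝ≥0∞)) (S.act g v)) →
        ∫⁻ x, ((N x - volS A / ENNReal.ofReal (S.zetaS d)) ^ 2 +
            (volS A / ENNReal.ofReal (S.zetaS d) - N x) ^ 2) ∂μ ≤
          ENNReal.ofReal C * volS A := by
  have hd0 : 0 < d := by omega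
  refine ⟨(S.unitWeightSum d).toReal + 1, by positivity, ?_⟩
  intro volS hvol Ainf hAinf Ap hAp A hA _ hfin μ hμ N hN
  have hV : volS A = PrimeTup.factorVolume Ainf Ap := by
    rw [hvol.eq_volume, hA, PrimeTup.volume_QS_eq]
  rw [hV] at hfin ⊢
  have := hμ.1
  have hNeq : N = PrimeTup.latticeSum (S.primTup 1 d)
      ((PrimeTup.prodTup 1 Ainf Ap).indicator 1) := by
    ext y
    induction y using QuotientGroup.induction_on with | _ g => ?_
    rw [hN, hA, PrimeTup.tsum_prim_eq_latticeSum hd0]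
  have hNm : Measurable N := hNeq ▸ PrimeTup.measurable_latticeSum PrimeTup.tupPerm_mem_primTup
    (measurable_one.indicator (PrimeTup.measurableSet_prodTup hAinf hAp))
  have hz : ENNReal.ofReal (S.zetaS d) ≠ 0 := by
    rw [ne_eq, ENNReal.ofReal_eq_zero, not_le]
    exact one_pos.trans_le (S.one_le_zetaS (by omega))
  have h := lintegral_sq_sub_add_sq_sub_le hNm (ENNReal.div_ne_top hfin hz)
    (by rw [hNeq]; exact PrimeTup.lintegral_prim_one hμ.2.2 hd hAinf hAp hfin)
    (by rw [hNeq]; exact PrimeTup.lintegral_latticeSum_primTup_one_sq_le hμ.2.2 hd hAinf hAp hfin)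
  refine h.trans (mul_le_mul_left ?_ _)
  rw [ENNReal.le_ofReal_iff_toReal_le (PrimeTup.unitWeightSum_ne_top hd) (by positivity)]
  linarith
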